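/- arXiv:2504.11452 — 3 statements merged into one kernel-verified Lean document; each statement's English description precedes it below -/
import Mathlib

section
/- For every real number r ≥ 1 there is a constant C depending only on r such that for all real y ≥ 2 and all integers n ≥ 3, (1/n)·#{1 ≤ m ≤ n : m is not y-typical} ≤ C·y^{4r}/(log log n)^r. In particular, if y = y(n) satisfies y(n) = o((log log n)^{1/4}), then lim_{n→∞} (1/n)·#{1 ≤ m ≤ n : m is y(n)-typical} = 1. -/
open MeasureTheory ProbabilityTheory Filter

noncomputable section

/-- A key encoding the lexicographic order on pairs `(φ(q), q)`; this is a valid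
encoding on prime powers since every prime power satisfies `q ≤ 2 * φ(q)`. -/
def ppKey (q : ℕ) : ℕ := 2 * Nat.totient q ^ 2 + q

/-- The `n`-th smallest key of a prime power (0-indexed). -/
def ppNthKey (n : ℕ) : ℕ := Nat.nth (fun k => ∃ q : ℕ, IsPrimePow q ∧ ppKey q = k) n

/-- The total φ-sequence `q̃_i` (1-indexed): the enumeration of all prime powers
ordered by nondecreasing totient, with ties broken by increasing size. -/
def qt (i : ℕ) : ℕ := sInf {q : ℕ | IsPrimePow q ∧ ppKey q = ppNthKey (i - 1)}

/-- `lcm(q̃_1, …, q̃_i)`. -/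
def Lseq (i : ℕ) : ℕ := (Finset.Icc 1 i).lcm qt

/-- The universal factor order set `f_i`. -/
def UFO (i : ℕ) : Set ℕ :=
  if Nat.totient (qt i) < Nat.totient (qt (i + 1)) then {Lseq i}
  else {Lseq i, Nat.lcm (Lseq (i - 1)) (qt (i + 1))}

/-- `φ(q̃_i)` as a real number. -/
def phiQ (i : ℕ) : ℝ := (Nat.totient (qt i) : ℝ)

/-- `μ_i = 1/φ(q̃_i) − 1/φ(q̃_{i+1})`. -/
def muSeq (i : ℕ) : ℝ := 1 / phiQ i - 1 / phiQ (i + 1)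

/-- `σ_i = (1/φ(q̃_i) + 1/φ(q̃_{i+1}) − 2/(φ(q̃_i)·φ(q̃_{i+1})))^{1/2}`. -/
def sigSeq (i : ℕ) : ℝ :=
  Real.sqrt (1 / phiQ i + 1 / phiQ (i + 1) - 2 / (phiQ i * phiQ (i + 1)))

/-- `σ_{i;a,b} = (φ(q̃_i)^{−a} + φ(q̃_{i+1})^{−b} − 2/(φ(q̃_i)·φ(q̃_{i+1})))^{1/2}`. -/
def sigAB (i a b : ℕ) : ℝ :=
  Real.sqrt (1 / phiQ i ^ a + 1 / phiQ (i + 1) ^ b - 2 / (phiQ i * phiQ (i + 1)))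

/-- `ν_j = (φ(q̃_j)^{−1}·(1 − φ(q̃_j)^{−1}))^{1/2}`. -/
def nuSeq (j : ℕ) : ℝ := Real.sqrt (1 / phiQ j * (1 - 1 / phiQ j))

/-- `J` is an invariant-factor count function for `d`: whenever `(ℤ/mℤ)ˣ` is isomorphic to
a direct product of cyclic groups `ℤ/λ_1 × ⋯ × ℤ/λ_K` with `1 < λ_1 ∣ λ_2 ∣ ⋯ ∣ λ_K`,
`J m` is the number of indices `j` with `λ_j = d`. -/
def IsInvCount (d : ℕ) (J : ℕ → ℕ) : Prop :=
  ∀ m : ℕ, 1 ≤ m → ∀ K : ℕ, ∀ lam : Fin K → ℕ,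
    (∀ j, 1 < lam j) →
    (∀ j k : Fin K, j ≤ k → lam j ∣ lam k) →
    Nonempty ((ZMod m)ˣ ≃* Multiplicative (∀ j : Fin K, ZMod (lam j))) →
    J m = (Finset.univ.filter fun j : Fin K => lam j = d).card

/-- The number of `m ∈ {1, …, n}` satisfying `P`. -/
def cnt (P : ℕ → Prop) (n : ℕ) : ℕ := {m : ℕ | 1 ≤ m ∧ m ≤ n ∧ P m}.ncard

/-- The average `(1/n)·∑_{m=1}^n J(m)`. -/
def avg (J : ℕ → ℕ) (n : ℕ) : ℝ := (∑ m ∈ Finset.Icc 1 n, (J m : ℝ)) / n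

/-- `log log n`. -/
def LL (n : ℕ) : ℝ := Real.log (Real.log n)

/-- The standard normal cumulative distribution function. -/
def Phi (x : ℝ) : ℝ := (Real.sqrt (2 * Real.pi))⁻¹ * ∫ t in Set.Iic x, Real.exp (-t ^ 2 / 2)

/-- Owen's T-function. -/
def OwenT (h a : ℝ) : ℝ :=
  (2 * Real.pi)⁻¹ * ∫ t in (0:ℝ)..a, Real.exp (-(1 + t ^ 2) * h ^ 2 / 2) / (1 + t ^ 2)

/-- The skew-normal cumulative distribution function with parameter `α`. -/
def PhiSkew (x α : ℝ) : ℝ := Phi x - 2 * OwenT x α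

/-- The standard Gaussian probability measure `γ^k` on `ℝ^k`. -/
def stdGaussian (k : ℕ) : Measure (Fin k → ℝ) :=
  Measure.pi fun _ => gaussianReal 0 1

/-- `ω(m;q,1)`: the number of distinct primes `p ∣ m` with `p ≡ 1 (mod q)`. -/
def omegaQ (m q : ℕ) : ℕ := (m.primeFactors.filter fun p => p % q = 1 % q).card

/-- The correction term `Ē(m;p^α)`. -/
def Ebar (m p α : ℕ) : ℕ :=
  if p ^ α = 2 ∧ 8 ∣ m then 2
  else if p ^ α = 2 ∧ 4 ∣ m ∧ ¬(8 ∣ m) then 1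
  else if p = 2 ∧ 2 ≤ α ∧ 2 ^ (α + 2) ∣ m then 1
  else if p ≠ 2 ∧ p ^ (α + 1) ∣ m then 1
  else 0

/-- `prm(m;q)` for a prime power `q = p^α`: the unique `k` such that `p^k` is the cardinality
of the subgroup `{x ∈ (ℤ/mℤ)ˣ : x^p = 1 and x = y^{p^{α−1}} for some y}` (obtained here as the
`p`-adic valuation of that cardinality; note `p = q.minFac` and `p^{α−1} = q / p`). -/
def prm (m q : ℕ) : ℕ :=
  (Nat.card {x : (ZMod m)ˣ // x ^ q.minFac = 1 ∧ ∃ y : (ZMod m)ˣ, y ^ (q / q.minFac) = x}).factorization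
    q.minFac

/-- `m` is `y`-typical: for all prime powers `q₁, q₂` with `φ(q₁) ≤ y` and `φ(q₁) < φ(q₂)`
one has `prm(m;q₁) > prm(m;q₂)`. -/
def yTypical (y : ℝ) (m : ℕ) : Prop :=
  ∀ q₁ q₂ : ℕ, IsPrimePow q₁ → IsPrimePow q₂ →
    (Nat.totient q₁ : ℝ) ≤ y → Nat.totient q₁ < Nat.totient q₂ →
    prm m q₂ < prm m q₁


/-- The subgroup of elements killed by `p` that are `k`-th powers. -/
def torsionPow (G : Type*) [CommGroup G] (p k : ℕ) : Subgroup G :=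
  (powMonoidHom p).ker ⊓ (powMonoidHom k).range

theorem mem_torsionPow {G : Type*} [CommGroup G] {p k : ℕ} {x : G} :
    x ∈ torsionPow G p k ↔ x ^ p = 1 ∧ ∃ y : G, y ^ k = x := by
  simp [torsionPow, Subgroup.mem_inf, MonoidHom.mem_ker, MonoidHom.mem_range]

theorem prm_eq (m q : ℕ) :
    prm m q = (Nat.card (torsionPow (ZMod m)ˣ q.minFac (q / q.minFac))).factorization q.minFac := by
  unfold prm
  rw [Nat.card_congr (Equiv.subtypeEquivRight fun x => mem_torsionPow.symm)]

theorem card_torsionPow_congr {G H : Type*} [CommGroup G] [CommGroup H] (e : G ≃* H) (p k : ℕ) :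
    Nat.card (torsionPow G p k) = Nat.card (torsionPow H p k) := by
  refine Nat.card_congr (e.toEquiv.subtypeEquiv fun x => ?_)
  simp only [mem_torsionPow, MulEquiv.toEquiv_eq_coe, EquivLike.coe_coe]
  constructor
  · rintro ⟨h, y, rfl⟩
    exact ⟨by rw [← map_pow, h, map_one], e y, by rw [map_pow]⟩
  · rintro ⟨h, y, hy⟩
    refine ⟨e.injective (by rw [map_pow, h, map_one]), e.symm y, e.injective ?_⟩
    rw [map_pow, e.apply_symm_apply, hy]

theorem card_torsionPow_prod (G H : Type*) [CommGroup G] [CommGroup H] (p k : ℕ) :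
    Nat.card (torsionPow (G × H) p k) =
      Nat.card (torsionPow G p k) * Nat.card (torsionPow H p k) := by
  have : torsionPow (G × H) p k = (torsionPow G p k).prod (torsionPow H p k) := by
    ext ⟨x, y⟩
    simp only [Subgroup.mem_prod, mem_torsionPow, Prod.pow_mk, Prod.mk_eq_one, Prod.exists,
      Prod.mk.injEq]
    constructor
    · rintro ⟨⟨h1, h2⟩, a, b, h3, h4⟩
      exact ⟨⟨h1, a, h3⟩, h2, b, h4⟩
    · rintro ⟨⟨h1, a, h3⟩, h2, b, h4⟩
      exact ⟨⟨h1, h2⟩, a, b, h3, h4⟩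
  rw [this, Nat.card_congr ((torsionPow G p k).prodEquiv (torsionPow H p k)).toEquiv, Nat.card_prod]

theorem prm_mul_of_coprime {a b : ℕ} [NeZero a] [NeZero b] (hab : a.Coprime b) (q : ℕ) :
    prm (a * b) q = prm a q + prm b q := by
  rw [prm_eq, prm_eq, prm_eq,
    card_torsionPow_congr ((Units.mapEquiv (ZMod.chineseRemainder hab).toMulEquiv).trans
      MulEquiv.prodUnits), card_torsionPow_prod,
    Nat.factorization_mul Nat.card_pos.ne' Nat.card_pos.ne', Finsupp.add_apply]

theorem omegaQ_mul_of_coprime {a b : ℕ} (hab : a.Coprime b) (q : ℕ) :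
    omegaQ (a * b) q = omegaQ a q + omegaQ b q := by
  unfold omegaQ
  rw [hab.primeFactors_mul, Finset.filter_union, Finset.card_union_of_disjoint]
  exact Finset.disjoint_filter_filter hab.disjoint_primeFactors

theorem omegaQ_prime_pow {l e : ℕ} (hl : l.Prime) (he : e ≠ 0) (q : ℕ) :
    omegaQ (l ^ e) q = if l % q = 1 % q then 1 else 0 := by
  unfold omegaQ
  rw [Nat.primeFactors_prime_pow he hl, Finset.filter_singleton]
  split_ifs <;> simp

theorem exists_torsionPow_orderOf {G : Type*} [CommGroup G] [Finite G] {p k : ℕ}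
    (hp : p.Prime) (h : p ∣ Nat.card (torsionPow G p k)) :
    ∃ x : G, orderOf x = p ∧ ∃ y : G, y ^ k = x := by
  have := Fact.mk hp
  obtain ⟨x, hx⟩ := exists_prime_orderOf_dvd_card' p h
  exact ⟨x, by rwa [Subgroup.orderOf_coe], (mem_torsionPow.1 x.2).2⟩

theorem prime_pow_dvd_card_of_dvd_card_torsionPow {G : Type*} [CommGroup G] [Finite G] {p a : ℕ}
    (hp : p.Prime) (h : p ∣ Nat.card (torsionPow G p (p ^ a))) : p ^ (a + 1) ∣ Nat.card G := by
  have := Fact.mk hp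
  obtain ⟨x, hx, y, rfl⟩ := exists_torsionPow_orderOf hp h
  rw [← orderOf_eq_prime_pow (x := y) (n := a) (p := p)]
  · exact orderOf_dvd_natCard y
  · intro h1
    rw [h1, orderOf_one] at hx
    exact hp.one_lt.ne hx
  · simpa [hx, pow_succ, pow_mul] using pow_orderOf_eq_one (y ^ p ^ a)

theorem dvd_card_torsionPow {G : Type*} [CommGroup G] [Finite G] [IsCyclic G] {p a : ℕ}
    (hp : p.Prime) (h : p ^ (a + 1) ∣ Nat.card G) : p ∣ Nat.card (torsionPow G p (p ^ a)) := by
  obtain ⟨g, hg⟩ := IsCyclic.exists_ofOrder_eq_natCard (α := G)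
  obtain ⟨c, hc⟩ := h
  have hc0 : c ≠ 0 := by
    rintro rfl
    exact Nat.card_pos.ne' (hc.trans (mul_zero _))
  have h1 : orderOf (g ^ c) = p ^ (a + 1) := by
    rw [orderOf_pow_of_dvd hc0 (by rw [hg, hc]; exact dvd_mul_left _ _), hg, hc,
      Nat.mul_div_cancel _ (Nat.pos_of_ne_zero hc0)]
  have h2 : orderOf ((g ^ c) ^ p ^ a) = p := by
    rw [orderOf_pow_of_dvd (pow_pos hp.pos a).ne' (by rw [h1]; exact pow_dvd_pow _ (by omega)),
      h1, pow_succ, Nat.mul_div_cancel_left _ (pow_pos hp.pos a)]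
  have hm : (g ^ c) ^ p ^ a ∈ torsionPow G p (p ^ a) :=
    mem_torsionPow.2 ⟨by simpa [h2] using pow_orderOf_eq_one ((g ^ c) ^ p ^ a), _, rfl⟩
  have := orderOf_dvd_natCard (⟨_, hm⟩ : torsionPow G p (p ^ a))
  rwa [← Subgroup.orderOf_coe, h2] at this

theorem card_torsionPow_le_of_isCyclic {G : Type*} [CommGroup G] [Finite G] [IsCyclic G] {p k : ℕ}
    (hp : p ≠ 0) : Nat.card (torsionPow G p k) ≤ p := by
  refine (Nat.card_mono (Set.toFinite ((powMonoidHom p : G →* G).ker : Set G)) ?_).trans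
    (b := Nat.card (powMonoidHom p : G →* G).ker) ?_
  · intro x hx
    exact (Subgroup.mem_inf.1 hx).1
  · rw [IsCyclic.card_powMonoidHom_ker]
    exact Nat.gcd_le_right _ (Nat.pos_of_ne_zero hp)

theorem card_units_two_pow_sq_eq_one_le (e : ℕ) (k : ℕ) :
    Nat.card (torsionPow (ZMod (2 ^ e))ˣ 2 k) ≤ 4 := by
  rcases e with _ | e
  · refine (Finite.card_le_one_iff_subsingleton.2 ?_).trans (by norm_num)
    have : Subsingleton (ZMod (2 ^ 0))ˣ := by
      rw [pow_zero]; infer_instance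
    infer_instance
  have : NeZero (2 ^ (e + 1)) := ⟨by positivity⟩
  set M := 2 ^ (e + 1) with hM
  set S : Finset (ZMod M) := {1, 1 + 2 ^ e, -1, -1 + 2 ^ e} with hS
  have key : ∀ x : ZMod M, x ^ 2 = 1 → x ∈ S := by
    intro x hx
    obtain ⟨a, rfl⟩ := ZMod.intCast_surjective x
    have h1 : ((2 ^ (e + 1) : ℕ) : ℤ) ∣ (a - 1) * (a + 1) := by
      rw [← hM, ← ZMod.intCast_zmod_eq_zero_iff_dvd]
      push_cast
      linear_combination hx
    have h2 : ∀ b : ℤ, (2 ^ e : ℤ) ∣ a - b → (a : ZMod M) = b ∨ (a : ZMod M) = b + (2 ^ e : ℤ) := by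
      rintro b ⟨c, hc⟩
      have h0 : ((2 ^ (e + 1) : ℤ) : ZMod M) = 0 := by
        rw [ZMod.intCast_zmod_eq_zero_iff_dvd]; simp [hM]
      have ha : a = b + 2 ^ e * c := by linarith
      rcases Int.even_or_odd' c with ⟨d, rfl | rfl⟩
      · left
        have : a = b + 2 ^ (e + 1) * d := by rw [ha]; ring
        rw [this, Int.cast_add, Int.cast_mul, h0, zero_mul, add_zero]
      · right
        have : a = b + 2 ^ e + 2 ^ (e + 1) * d := by rw [ha]; ring
        rw [this, Int.cast_add, Int.cast_mul, h0, zero_mul, add_zero, Int.cast_add]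
    have h3 : (2 ^ e : ℤ) ∣ a - 1 ∨ (2 ^ e : ℤ) ∣ a - (-1) := by
      have hodd : Odd a := by
        by_contra hcon
        rw [Int.not_odd_iff_even] at hcon
        have h4 : (2 : ℤ) ∣ (a - 1) * (a + 1) :=
          dvd_trans (by push_cast; exact dvd_pow_self _ (by omega)) h1
        obtain ⟨b, rfl⟩ := hcon
        rcases Int.prime_two.dvd_or_dvd h4 with h | h <;> omega
      obtain ⟨b, rfl⟩ := hodd
      push_cast at h1
      rcases e with _ | e
      · left; simp
      have h5 : (2 : ℤ) ^ e ∣ b * (b + 1) := by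
        have : (2 : ℤ) ^ (e + 1 + 1) = 4 * 2 ^ e := by ring
        rw [this, show (2 * b + 1 - 1) * (2 * b + 1 + 1) = 4 * (b * (b + 1)) by ring] at h1
        exact (mul_dvd_mul_iff_left (by norm_num)).1 h1
      have hcop : IsCoprime b (b + 1) := ⟨-1, 1, by ring⟩
      rcases Int.even_or_odd b with hb | hb
      · left
        have hc : IsCoprime ((2 : ℤ) ^ e) (b + 1) :=
          (IsCoprime.pow_left (by
              obtain ⟨c, hc⟩ := hb.add_one
              exact ⟨-c, 1, by rw [hc]; ring⟩))
        have := hc.dvd_of_dvd_mul_right h5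
        rw [show 2 * b + 1 - 1 = b * 2 by ring, pow_succ]
        exact mul_dvd_mul_right this 2
      · right
        have hc : IsCoprime ((2 : ℤ) ^ e) b :=
          (IsCoprime.pow_left (by
              obtain ⟨c, hc⟩ := hb
              exact ⟨-c, 1, by rw [hc]; ring⟩))
        have := hc.dvd_of_dvd_mul_left h5
        rw [show 2 * b + 1 - -1 = (b + 1) * 2 by ring, pow_succ]
        exact mul_dvd_mul_right this 2
    simp only [hS, Finset.mem_insert, Finset.mem_singleton]
    rcases h3 with h | h
    · rcases h2 1 h with h | h
      · left; simpa using h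
      · right; left; simpa using h
    · rcases h2 (-1) h with h | h
      · right; right; left; simpa using h
      · right; right; right; simpa using h
  have hcard : S.card ≤ 4 := Finset.card_le_four
  refine le_trans ?_ hcard
  rw [← Nat.card_eq_finsetCard]
  refine Nat.card_le_card_of_injective
    (fun x : torsionPow (ZMod M)ˣ 2 k => (⟨((x : (ZMod M)ˣ) : ZMod M), key _ ?_⟩ : S)) ?_
  · rw [← Units.val_pow_eq_pow_val, (mem_torsionPow.1 x.2).1, Units.val_one]
  · intro x y hxy
    exact Subtype.ext (Units.ext (congrArg Subtype.val hxy))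

theorem prm_prime_pow_bounds {l e q : ℕ} (hl : l.Prime) (he : e ≠ 0) (hq : IsPrimePow q) :
    omegaQ (l ^ e) q ≤ prm (l ^ e) q ∧
      prm (l ^ e) q ≤ omegaQ (l ^ e) q + if q.minFac ∣ l ^ e then 2 else 0 := by
  have hp : q.minFac.Prime := Nat.minFac_prime hq.ne_one
  obtain ⟨a, ha⟩ : ∃ a, q = q.minFac ^ (a + 1) := by
    refine ⟨q.factorization q.minFac - 1, ?_⟩
    have h1 := hq.minFac_pow_factorization_eq
    rw [Nat.sub_add_cancel, h1]
    by_contra h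
    have : q.factorization q.minFac = 0 := by omega
    rw [this, pow_zero] at h1
    exact hq.ne_one h1.symm
  have hdiv : q / q.minFac = q.minFac ^ a := by
    conv_lhs => enter [1]; rw [ha]
    rw [pow_succ, Nat.mul_div_cancel _ hp.pos]
  have hq2 : 2 ≤ q := hq.two_le
  set p := q.minFac with hpdef
  have : NeZero (l ^ e) := ⟨(pow_pos hl.pos e).ne'⟩
  rw [prm_eq, ← hpdef, hdiv, omegaQ_prime_pow hl he]
  have hcardG : Nat.card (ZMod (l ^ e))ˣ = l ^ (e - 1) * (l - 1) := by
    rw [Nat.card_eq_fintype_card, ZMod.card_units_eq_totient,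
      Nat.totient_prime_pow hl (Nat.pos_of_ne_zero he)]
  set N := Nat.card (torsionPow (ZMod (l ^ e))ˣ p (p ^ a)) with hN
  have hN0 : N ≠ 0 := Nat.card_pos.ne'
  have hfac_le : ∀ b, N ≤ p ^ b → N.factorization p ≤ b := by
    intro b hb
    have := Nat.le_of_dvd (Nat.pos_of_ne_zero hN0) (Nat.ordProj_dvd N p)
    exact (Nat.pow_le_pow_iff_right hp.one_lt).1 (this.trans hb)
  have hcyc : l ≠ 2 → N.factorization p ≤ 1 := by
    intro hl2
    have := ZMod.isCyclic_units_of_prime_pow l hl hl2 e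
    exact hfac_le 1 (by rw [pow_one]; exact card_torsionPow_le_of_isCyclic hp.ne_zero)
  have hmod : l % q = 1 % q ↔ q ∣ l - 1 := by
    rw [← Nat.modEq_iff_dvd' hl.one_lt.le]
    exact ⟨fun h => Eq.symm h, fun h => Eq.symm h⟩
  by_cases h1 : q ∣ l - 1
  · have hl2 : l ≠ 2 := by
      rintro rfl
      have := Nat.le_of_dvd (by norm_num) h1
      omega
    rw [if_pos (hmod.2 h1)]
    refine ⟨?_, (hcyc hl2).trans (by omega)⟩
    rw [← hp.dvd_iff_one_le_factorization hN0]
    have := ZMod.isCyclic_units_of_prime_pow l hl hl2 e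
    refine dvd_card_torsionPow hp ?_
    rw [← ha, hcardG]
    exact h1.mul_left _
  · rw [if_neg (fun h => h1 (hmod.1 h)), zero_add]
    refine ⟨Nat.zero_le _, ?_⟩
    by_cases hpl : p = l
    · rw [if_pos (by rw [hpl]; exact dvd_pow_self _ he)]
      by_cases hl2 : l = 2
      · refine hfac_le 2 ?_
        rw [hN, hpl]
        subst hl2
        exact card_units_two_pow_sq_eq_one_le e _
      · exact (hcyc hl2).trans (by norm_num)
    · refine (Nat.le_of_eq ?_).trans (Nat.zero_le _)
      refine Nat.factorization_eq_zero_of_not_dvd fun hdvd => h1 ?_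
      have := prime_pow_dvd_card_of_dvd_card_torsionPow hp hdvd
      rw [← ha, hcardG] at this
      refine Nat.Coprime.dvd_of_dvd_mul_left ?_ this
      rw [ha]
      exact Nat.Coprime.pow _ _ ((Nat.coprime_primes hp hl).2 hpl)

theorem prm_bounds {q : ℕ} (hq : IsPrimePow q) (m : ℕ) (hm : m ≠ 0) :
    omegaQ m q ≤ prm m q ∧ prm m q ≤ omegaQ m q + if q.minFac ∣ m then 2 else 0 := by
  induction m using Nat.recOnPosPrimePosCoprime with
  | prime_pow p n hp hn => exact prm_prime_pow_bounds hp hn.ne' hq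
  | zero => exact absurd rfl hm
  | one =>
    have h1 : omegaQ 1 q = 0 := by simp [omegaQ]
    have h2 : prm 1 q = 0 := by
      rw [prm_eq, Nat.card_unique, Nat.factorization_one]; rfl
    rw [h1, h2]
    exact ⟨le_rfl, Nat.zero_le _⟩
  | coprime a b ha hb hab iha ihb =>
    have : NeZero a := ⟨by omega⟩
    have : NeZero b := ⟨by omega⟩
    obtain ⟨h1, h2⟩ := iha (NeZero.ne a)
    obtain ⟨h3, h4⟩ := ihb (NeZero.ne b)
    rw [prm_mul_of_coprime hab, omegaQ_mul_of_coprime hab]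
    refine ⟨add_le_add h1 h3, (add_le_add h2 h4).trans ?_⟩
    have hp := Nat.minFac_prime hq.ne_one
    have : ¬ (q.minFac ∣ a ∧ q.minFac ∣ b) := fun h =>
      hp.one_lt.ne' (Nat.dvd_one.1 (hab ▸ Nat.dvd_gcd h.1 h.2))
    by_cases hA : q.minFac ∣ a <;> by_cases hB : q.minFac ∣ b
    · exact absurd ⟨hA, hB⟩ this
    · simp only [hA, hB, hA.mul_right, if_true, if_false]; omega
    · simp only [hA, hB, hB.mul_left, if_true, if_false]; omega
    · simp only [hA, hB, if_false]; omega

theorem omegaQ_le_prm {q m : ℕ} (hq : IsPrimePow q) (hm : m ≠ 0) : omegaQ m q ≤ prm m q :=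
  (prm_bounds hq m hm).1

theorem prm_le_omegaQ_add_two {q m : ℕ} (hq : IsPrimePow q) (hm : m ≠ 0) :
    prm m q ≤ omegaQ m q + 2 :=
  (prm_bounds hq m hm).2.trans (by split_ifs <;> omega)

/-- The primes `p ≤ n` with `p ≡ 1 (mod q)`. -/
def apPrimes (n q : ℕ) : Finset ℕ :=
  (Finset.Icc 1 n).filter fun p => p.Prime ∧ p % q = 1 % q

theorem mem_apPrimes {n q p : ℕ} : p ∈ apPrimes n q ↔ p ≤ n ∧ p.Prime ∧ p % q = 1 % q := by
  simp only [apPrimes, Finset.mem_filter, Finset.mem_Icc]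
  exact ⟨fun h => ⟨h.1.2, h.2⟩, fun h => ⟨⟨h.2.1.one_lt.le, h.1⟩, h.2⟩⟩

/-- The sum of `1/p` over the primes `p ≤ n` with `p ≡ 1 (mod q)`. -/
def recipSum (n q : ℕ) : ℝ := ∑ p ∈ apPrimes n q, (1 : ℝ) / p

theorem dvd_prod_one_add_mul {q K D : ℕ} (hD : D.Coprime q) (hDK : D ∣ K.factorial) :
    D ∣ ∏ k ∈ Finset.range K, (1 + (k + 1) * q) := by
  rcases Nat.lt_or_ge 1 D with h1 | h1
  swap
  · interval_cases D
    · have := Nat.eq_zero_of_zero_dvd hDK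
      exact absurd this (Nat.factorial_ne_zero K)
    · exact one_dvd _
  obtain ⟨u, -, hu⟩ := Nat.exists_mul_mod_eq_one_of_coprime hD.symm h1
  have hu' : q * u ≡ 1 [MOD D] := by rw [Nat.ModEq, hu, Nat.mod_eq_of_lt h1]
  have h2 : ∏ k ∈ Finset.range K, (1 + (k + 1) * q) ≡
      ∏ k ∈ Finset.range K, (q * (u + 1 + k)) [MOD D] := by
    refine Nat.ModEq.prod fun k _ => ?_
    have : q * (u + 1 + k) = q * u + (k + 1) * q := by ring
    rw [this]
    exact (hu'.symm.add_right _)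
  rw [Finset.prod_mul_distrib, ← Nat.ascFactorial_eq_prod_range] at h2
  rw [← Nat.modEq_zero_iff_dvd]
  refine h2.trans ((Nat.modEq_zero_iff_dvd).2 ?_)
  exact (hDK.trans (Nat.factorial_dvd_ascFactorial _ _)).mul_left _

theorem factorial_dvd_pow_mul_prod {q : ℕ} (hq : IsPrimePow q) (K : ℕ) :
    K.factorial ∣ q ^ K * ∏ k ∈ Finset.range K, (1 + (k + 1) * q) := by
  obtain ⟨p, a, hp, ha, rfl⟩ := hq
  replace hp := hp.nat_prime
  have hK := Nat.factorial_ne_zero K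
  rw [← Nat.ordProj_mul_ordCompl_eq_self K.factorial p]
  refine mul_dvd_mul ?_ (dvd_prod_one_add_mul ?_ (Nat.ordCompl_dvd _ _))
  · rw [← pow_mul]
    refine pow_dvd_pow _ ?_
    calc K.factorial.factorization p ≤ K / (p - 1) := Nat.factorization_factorial_le_div_pred hp K
      _ ≤ K := Nat.div_le_self _ _
      _ ≤ a * K := Nat.le_mul_of_pos_left _ ha
  · exact (Nat.coprime_ordCompl hp hK).symm.pow_right _

theorem prod_apPrimes_le {q : ℕ} (hq : IsPrimePow q) (K : ℕ) :
    ∏ p ∈ (apPrimes (1 + K * q) q).filter (K < ·), p ≤ (q * (q + 1)) ^ K := by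
  set P := ∏ p ∈ (apPrimes (1 + K * q) q).filter (K < ·), p with hP
  set Q := ∏ k ∈ Finset.range K, (1 + (k + 1) * q) with hQ
  have hQ0 : 0 < q ^ K * Q :=
    mul_pos (pow_pos hq.pos _) (Finset.prod_pos fun k _ => by positivity)
  have hPQ : P ∣ Q := by
    refine Finset.prod_primes_dvd _ (fun p hp => ?_) fun p hp => ?_
    · exact (mem_apPrimes.1 (Finset.mem_filter.1 hp).1).2.1.prime
    · obtain ⟨h1, -⟩ := Finset.mem_filter.1 hp
      obtain ⟨hle, hpp, hmod⟩ := mem_apPrimes.1 h1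
      have h2 : q ∣ p - 1 := (Nat.modEq_iff_dvd' hpp.one_lt.le).1 (Eq.symm hmod)
      obtain ⟨k, hk⟩ := h2
      have h3 : k ≠ 0 := by
        rintro rfl
        have := hpp.one_lt
        omega
      have h4 : p = 1 + k * q := by
        have := hpp.one_lt
        rw [mul_comm k q]; omega
      have h5 : k ≤ K := by
        by_contra hcon
        push Not at hcon
        have : K * q < k * q := Nat.mul_lt_mul_of_pos_right hcon hq.pos
        omega
      have h6 : 1 + (k - 1 + 1) * q ∣ Q :=
        Finset.dvd_prod_of_mem (fun k => 1 + (k + 1) * q) (Finset.mem_range.2 (by omega))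
      rwa [Nat.sub_add_cancel (by omega), ← h4] at h6
  have hcop : K.factorial.Coprime P := by
    refine Nat.Coprime.prod_right fun p hp => ?_
    obtain ⟨h1, h2⟩ := Finset.mem_filter.1 hp
    exact ((Nat.coprime_factorial_iff (mem_apPrimes.1 h1).2.1.ne_one).2
      (by rwa [(mem_apPrimes.1 h1).2.1.minFac_eq])).symm
  have h1 : K.factorial * P ≤ q ^ K * Q :=
    Nat.le_of_dvd hQ0 (hcop.mul_dvd_of_dvd_of_dvd (factorial_dvd_pow_mul_prod hq K)
      (hPQ.mul_left _))
  have h2 : Q ≤ K.factorial * (q + 1) ^ K := by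
    rw [← Finset.prod_range_add_one_eq_factorial, ← Finset.card_range K, ← Finset.prod_const,
      Finset.card_range, ← Finset.prod_mul_distrib]
    refine Finset.prod_le_prod' fun k _ => ?_
    nlinarith
  have h3 : K.factorial * P ≤ K.factorial * (q * (q + 1)) ^ K :=
    calc K.factorial * P ≤ q ^ K * (K.factorial * (q + 1) ^ K) :=
          h1.trans (Nat.mul_le_mul_left _ h2)
      _ = _ := by rw [mul_pow]; ring
  exact Nat.le_of_mul_le_mul_left h3 (Nat.factorial_pos K)

theorem sum_log_apPrimes_le {q : ℕ} (hq : IsPrimePow q) (K : ℕ) :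
    ∑ p ∈ (apPrimes (1 + K * q) q).filter (K < ·), Real.log p ≤ 2 * K * Real.log (q + 1) := by
  have h := prod_apPrimes_le hq K
  have hpos : ∀ p ∈ (apPrimes (1 + K * q) q).filter (K < ·), (p : ℝ) ≠ 0 := fun p hp =>
    Nat.cast_ne_zero.2 (mem_apPrimes.1 (Finset.mem_filter.1 hp).1).2.1.ne_zero
  rw [← Real.log_prod hpos]
  have h2 : ((∏ p ∈ (apPrimes (1 + K * q) q).filter (K < ·), p : ℕ) : ℝ) ≤
      ((q : ℝ) + 1) ^ (2 * K) := by
    calc ((∏ p ∈ (apPrimes (1 + K * q) q).filter (K < ·), p : ℕ) : ℝ)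
        ≤ (((q * (q + 1)) ^ K : ℕ) : ℝ) := by exact_mod_cast h
      _ = ((q : ℝ) * (q + 1)) ^ K := by push_cast; ring
      _ ≤ ((q + 1) * ((q : ℝ) + 1)) ^ K := by gcongr; linarith
      _ = _ := by rw [pow_mul]; ring
  push_cast at h2
  refine (Real.log_le_log (Finset.prod_pos fun p hp =>
    lt_of_le_of_ne (Nat.cast_nonneg _) (hpos p hp).symm) h2).trans ?_
  rw [Real.log_pow]
  push_cast
  exact le_rfl

theorem sum_block_le {q : ℕ} (hq : IsPrimePow q) (n j : ℕ) :
    ∑ p ∈ (apPrimes n q).filter (fun p => Nat.log 2 ((p - 1) / q) = j), (1 : ℝ) / p ≤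
      6 * Real.log (q + 1) / q * (1 / (j + 1)) := by
  set B := (apPrimes n q).filter (fun p => Nat.log 2 ((p - 1) / q) = j) with hB
  have hq2 : 2 ≤ q := hq.two_le
  have hqR : (2 : ℝ) ≤ q := by exact_mod_cast hq2
  have hkey : ∀ p ∈ B, 2 ^ j * q < p ∧ p ∈ (apPrimes (1 + 2 ^ (j + 1) * q) q).filter
      (2 ^ (j + 1) < ·) := by
    intro p hp
    obtain ⟨h1, h2⟩ := Finset.mem_filter.1 hp
    obtain ⟨-, hpp, hmod⟩ := mem_apPrimes.1 h1
    obtain ⟨k, hk⟩ := (Nat.modEq_iff_dvd' hpp.one_lt.le).1 (Eq.symm hmod : 1 ≡ p [MOD q])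
    have h3 : k ≠ 0 := by
      rintro rfl
      have := hpp.one_lt
      omega
    have h5 := hpp.one_lt
    rw [hk, Nat.mul_div_cancel_left _ hq.pos] at h2
    have h6 : 2 ^ j ≤ k := h2 ▸ Nat.pow_log_le_self 2 h3
    have h7 : k < 2 ^ (j + 1) := h2 ▸ Nat.lt_pow_succ_log_self (by norm_num) k
    have h8 : 2 ^ j * q ≤ q * k := by rw [mul_comm]; exact Nat.mul_le_mul_left _ h6
    have h9 : q * k ≤ 2 ^ (j + 1) * q := by rw [mul_comm]; exact Nat.mul_le_mul_right _ h7.le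
    have h10 : 2 ^ (j + 1) ≤ 2 ^ j * q := by rw [pow_succ]; exact Nat.mul_le_mul_left _ hq2
    exact ⟨by omega, Finset.mem_filter.2 ⟨mem_apPrimes.2 ⟨by omega, hpp, hmod⟩, by omega⟩⟩
  have hX : (0 : ℝ) < 2 ^ j * q := by positivity
  have hlog2 := Real.log_two_gt_d9
  have hlogX : ((j : ℝ) + 1) * Real.log 2 ≤ Real.log (2 ^ j * q) := by
    rw [Real.log_mul (by positivity) (by positivity), Real.log_pow]
    have := Real.log_le_log (by norm_num) hqR
    linarith
  have hlogpos : 0 < Real.log (2 ^ j * q) := lt_of_lt_of_le (by positivity) hlogX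
  have hlq : 0 ≤ Real.log ((q : ℝ) + 1) := Real.log_nonneg (by linarith)
  have h1 : (B.card : ℝ) * Real.log (2 ^ j * q) ≤ 2 * 2 ^ (j + 1) * Real.log (q + 1) := by
    have h := sum_log_apPrimes_le hq (2 ^ (j + 1))
    push_cast at h
    refine le_trans ?_ h
    rw [← nsmul_eq_mul]
    refine (Finset.card_nsmul_le_sum B (fun p : ℕ => Real.log p) _ fun p hp => ?_).trans
      (Finset.sum_le_sum_of_subset_of_nonneg (fun p hp => (hkey p hp).2) fun p hp _ => ?_)
    · exact Real.log_le_log hX (by exact_mod_cast (hkey p hp).1.le)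
    · exact Real.log_natCast_nonneg p
  have h2 : ∑ p ∈ B, (1 : ℝ) / p ≤ B.card * (1 / (2 ^ j * q)) := by
    rw [← nsmul_eq_mul]
    refine Finset.sum_le_card_nsmul _ _ _ fun p hp => ?_
    exact one_div_le_one_div_of_le hX (by exact_mod_cast (hkey p hp).1.le)
  refine h2.trans ?_
  have h3 : (B.card : ℝ) * ((j + 1) * Real.log 2) ≤ 4 * 2 ^ j * Real.log (q + 1) := by
    refine (mul_le_mul_of_nonneg_left hlogX (Nat.cast_nonneg _)).trans (h1.trans (le_of_eq ?_))
    ring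
  have h4 : (B.card : ℝ) * (j + 1) ≤ 6 * 2 ^ j * Real.log (q + 1) := by
    have h5 : (B.card : ℝ) * (j + 1) * (2 / 3) ≤ (B.card : ℝ) * ((j + 1) * Real.log 2) := by
      rw [mul_assoc]
      gcongr
      linarith
    linarith
  rw [mul_one_div, mul_one_div, div_le_div_iff₀ hX (by positivity)]
  have : 6 * Real.log (q + 1) / q * (2 ^ j * (q : ℝ)) = 6 * 2 ^ j * Real.log (q + 1) := by
    field_simp
  rw [this]
  exact h4

/-- A Brun–Titchmarsh type bound with an extra factor `log q`, by Chebyshev's method. -/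
theorem recipSum_le {q : ℕ} (hq : IsPrimePow q) {n : ℕ} (hn : 3 ≤ n) :
    recipSum n q ≤ 6 * Real.log (q + 1) / q * (LL n + 2) := by
  have hq2 : 2 ≤ q := hq.two_le
  have hqR : (2 : ℝ) ≤ q := by exact_mod_cast hq2
  have hlq : 0 ≤ Real.log ((q : ℝ) + 1) := Real.log_nonneg (by linarith)
  set J := Nat.log 2 n with hJ
  have hmaps : ∀ p ∈ apPrimes n q, Nat.log 2 ((p - 1) / q) ∈ Finset.range J := by
    intro p hp
    obtain ⟨hle, hpp, -⟩ := mem_apPrimes.1 hp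
    rw [Finset.mem_range, hJ]
    have h1 : (p - 1) / q ≤ n / 2 :=
      (Nat.div_le_div_left hq2 (by norm_num)).trans (Nat.div_le_div_right (by omega))
    have h2 : Nat.log 2 (n / 2) = Nat.log 2 n - 1 := Nat.log_div_base 2 n
    have h3 : 0 < Nat.log 2 n := Nat.log_pos (by norm_num) (by omega)
    have := Nat.log_mono_right (b := 2) h1
    omega
  have hJ1 : 1 ≤ J := Nat.log_pos (by norm_num) (by omega)
  have hlogn : 1 ≤ Real.log n := by
    rw [Real.le_log_iff_exp_le (by positivity)]
    have : (3 : ℝ) ≤ n := by exact_mod_cast hn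
    linarith [Real.exp_one_lt_d9]
  have hJn : (J : ℝ) ≤ 2 * Real.log n := by
    have h1 : ((2 ^ J : ℕ) : ℝ) ≤ n := by exact_mod_cast Nat.pow_log_le_self 2 (by omega)
    have h2 := Real.log_le_log (by positivity) h1
    push_cast at h2
    rw [Real.log_pow] at h2
    nlinarith [Real.log_two_gt_d9]
  have hlogJ : Real.log J ≤ LL n + 1 := by
    have h1 := Real.log_le_log (by positivity) hJn
    rw [Real.log_mul (by norm_num) (by positivity)] at h1
    unfold LL
    linarith [Real.log_two_lt_d9]
  unfold recipSum
  rw [← Finset.sum_fiberwise_of_maps_to hmaps]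
  calc _ ≤ ∑ j ∈ Finset.range J, 6 * Real.log (q + 1) / q * (1 / ((j : ℝ) + 1)) :=
        Finset.sum_le_sum fun j _ => sum_block_le hq n j
    _ = 6 * Real.log (q + 1) / q * ((harmonic J : ℚ) : ℝ) := by
        rw [← Finset.mul_sum, harmonic]
        push_cast
        simp only [one_div]
    _ ≤ 6 * Real.log (q + 1) / q * (LL n + 2) := by
        gcongr
        linarith [harmonic_le_one_add_log J]

/-- The `L`-series of a Dirichlet character at a real point. -/
def realL {q : ℕ} (χ : DirichletCharacter ℂ q) (s : ℝ) : ℂ :=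
  ∑' n : ℕ, χ n * (((n : ℝ) ^ (-s) : ℝ) : ℂ)

/-- The prime sum `∑ₚ Re χ(p) p⁻ˢ`. -/
def primeL {q : ℕ} (χ : DirichletCharacter ℂ q) (s : ℝ) : ℝ :=
  ∑' p : Nat.Primes, (χ (p : ℕ)).re * ((p : ℕ) : ℝ) ^ (-s)

/-- The sum `∑ₙ n⁻ˢ`. -/
def realZeta (s : ℝ) : ℝ := ∑' n : ℕ, (n : ℝ) ^ (-s)

lemma LSeries_eq_realL {q : ℕ} (χ : DirichletCharacter ℂ q) {s : ℝ} (hs : s ≠ 0) :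
    LSeries (fun n : ℕ => χ n) (s : ℂ) = realL χ s := by
  unfold LSeries realL
  refine tsum_congr fun n => ?_
  rw [LSeries.term_def]
  split_ifs with h
  · subst h
    simp [Real.zero_rpow (neg_ne_zero.mpr hs)]
  · rw [Complex.ofReal_cpow (by positivity)]
    push_cast
    rw [Complex.cpow_neg, div_eq_mul_inv]

lemma summable_nat_rpow_neg {s : ℝ} (hs : 1 < s) : Summable fun n : ℕ => (n : ℝ) ^ (-s) :=
  Real.summable_nat_rpow.mpr (by linarith)

lemma norm_term_le {q : ℕ} (χ : DirichletCharacter ℂ q) (s : ℝ) (n : ℕ) :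
    ‖χ n * (((n : ℝ) ^ (-s) : ℝ) : ℂ)‖ ≤ (n : ℝ) ^ (-s) := by
  rw [norm_mul, Complex.norm_real, Real.norm_of_nonneg (by positivity)]
  exact mul_le_of_le_one_left (by positivity) (χ.norm_le_one _)

lemma summable_realL {q : ℕ} (χ : DirichletCharacter ℂ q) {s : ℝ} (hs : 1 < s) :
    Summable fun n : ℕ => χ n * (((n : ℝ) ^ (-s) : ℝ) : ℂ) :=
  Summable.of_norm_bounded (summable_nat_rpow_neg hs) (norm_term_le χ s)

lemma norm_realL_le_realZeta {q : ℕ} (χ : DirichletCharacter ℂ q) {s : ℝ} (hs : 1 < s) :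
    ‖realL χ s‖ ≤ realZeta s :=
  tsum_of_norm_bounded (summable_nat_rpow_neg hs).hasSum (norm_term_le χ s)

lemma summable_primes_rpow_neg {s : ℝ} (hs : 1 < s) :
    Summable fun p : Nat.Primes => ((p : ℕ) : ℝ) ^ (-s) :=
  (summable_nat_rpow_neg hs).subtype (fun n : ℕ => n.Prime)

lemma abs_re_mul_rpow_le {q : ℕ} (χ : DirichletCharacter ℂ q) (s : ℝ) (n : ℕ) :
    |(χ n).re * (n : ℝ) ^ (-s)| ≤ (n : ℝ) ^ (-s) := by
  rw [abs_mul, abs_of_nonneg (by positivity : (0 : ℝ) ≤ (n : ℝ) ^ (-s))]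
  exact mul_le_of_le_one_left (by positivity) ((Complex.abs_re_le_norm _).trans (χ.norm_le_one _))

lemma summable_primeL {q : ℕ} (χ : DirichletCharacter ℂ q) {s : ℝ} (hs : 1 < s) :
    Summable fun p : Nat.Primes => (χ (p : ℕ)).re * ((p : ℕ) : ℝ) ^ (-s) :=
  Summable.of_norm_bounded (summable_primes_rpow_neg hs) fun p => abs_re_mul_rpow_le χ s p

lemma tsum_primes_sq_le : (∑' p : Nat.Primes, 1 / ((p : ℕ) : ℝ) ^ 2) ≤ 2 := by
  refine (Summable.tsum_subtype_le (fun n : ℕ => 1 / (n : ℝ) ^ 2) {n | n.Prime}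
    (fun n => by positivity) hasSum_zeta_two.summable).trans ?_
  rw [hasSum_zeta_two.tsum_eq]
  have := Real.pi_lt_d2
  have := Real.pi_pos
  nlinarith

lemma exp_eq_norm_realL {q : ℕ} (χ : DirichletCharacter ℂ q) {s : ℝ} (hs : 1 < s) :
    ∃ E : ℝ, |E| ≤ 2 ∧ ‖realL χ s‖ = Real.exp (primeL χ s + E) := by
  have hs' : 1 < (s : ℂ).re := by simpa using hs
  have h := DirichletCharacter.LSeries_eulerProduct_exp_log χ hs'
  have hsum := DirichletCharacter.summable_neg_log_one_sub_mul_prime_cpow χ hs'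
  rw [LSeries_eq_realL χ (by linarith)] at h
  set z : Nat.Primes → ℂ := fun p => χ (p : ℕ) * ((p : ℕ) : ℂ) ^ (-(s : ℂ)) with hz
  have hzre : ∀ p, (z p).re = (χ (p : ℕ)).re * ((p : ℕ) : ℝ) ^ (-s) := by
    intro p
    have : ((p : ℕ) : ℂ) ^ (-(s : ℂ)) = ((((p : ℕ) : ℝ) ^ (-s) : ℝ) : ℂ) := by
      rw [Complex.ofReal_cpow (by positivity)]; push_cast; rfl
    simp only [hz, this, Complex.re_mul_ofReal]
  have hzn : ∀ p, ‖z p‖ ≤ 1 / ((p : ℕ) : ℝ) := by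
    intro p
    have hp : (0 : ℝ) < (p : ℕ) := by exact_mod_cast p.2.pos
    have hp1 : (1 : ℝ) ≤ (p : ℕ) := by exact_mod_cast p.2.one_le
    simp only [hz, norm_mul]
    rw [Complex.norm_natCast_cpow_of_pos p.2.pos]
    refine (mul_le_of_le_one_left (by positivity) (χ.norm_le_one _)).trans ?_
    rw [one_div, ← Real.rpow_neg_one]
    exact Real.rpow_le_rpow_of_exponent_le hp1 (by simp; linarith)
  have herr : ∀ p, |(-Complex.log (1 - z p)).re - (z p).re| ≤ 1 / ((p : ℕ) : ℝ) ^ 2 := by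
    intro p
    have hp2 : (2 : ℝ) ≤ (p : ℕ) := by exact_mod_cast p.2.two_le
    have hh : ‖z p‖ ≤ 1 / 2 := (hzn p).trans (by gcongr)
    have h1 := Complex.norm_log_one_add_sub_self_le (z := -z p) (by rw [norm_neg]; linarith)
    rw [← Complex.sub_re]
    refine (Complex.abs_re_le_norm _).trans ?_
    have : -Complex.log (1 - z p) - z p = -(Complex.log (1 + -z p) - -z p) := by
      rw [← sub_eq_add_neg]; ring
    rw [this, norm_neg]
    refine h1.trans ?_
    rw [norm_neg]
    have h2 : (1 - ‖z p‖)⁻¹ ≤ 2 := by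
      rw [inv_le_comm₀ (by linarith) (by norm_num)]; linarith
    calc ‖z p‖ ^ 2 * (1 - ‖z p‖)⁻¹ / 2 ≤ ‖z p‖ ^ 2 * 2 / 2 := by gcongr
      _ = ‖z p‖ ^ 2 := by ring
      _ ≤ (1 / ((p : ℕ) : ℝ)) ^ 2 := by gcongr; exact hzn p
      _ = _ := by rw [one_div, one_div, inv_pow]
  have hsq : Summable fun p : Nat.Primes => 1 / ((p : ℕ) : ℝ) ^ 2 :=
    hasSum_zeta_two.summable.subtype (fun n : ℕ => n.Prime)
  have hre : Summable fun p : Nat.Primes => (-Complex.log (1 - z p)).re :=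
    (Complex.hasSum_re hsum.hasSum).summable
  have hV : Summable fun p => (z p).re := by simpa only [hzre] using summable_primeL χ hs
  refine ⟨∑' p, ((-Complex.log (1 - z p)).re - (z p).re), ?_, ?_⟩
  · refine le_trans ?_ tsum_primes_sq_le
    rw [← Real.norm_eq_abs]
    exact tsum_of_norm_bounded hsq.hasSum fun p => (Real.norm_eq_abs _).trans_le (herr p)
  · rw [← h, Complex.norm_exp, Complex.re_tsum hsum]
    congr 1
    rw [hre.tsum_sub hV]
    simp only [primeL, ← hzre]
    ring

lemma realL_ne_zero {q : ℕ} (χ : DirichletCharacter ℂ q) {s : ℝ} (hs : 1 < s) :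
    realL χ s ≠ 0 := by
  obtain ⟨E, -, hE⟩ := exp_eq_norm_realL χ hs
  rw [← norm_ne_zero_iff, hE]
  exact (Real.exp_pos _).ne'

lemma abs_log_norm_realL_sub_primeL_le {q : ℕ} (χ : DirichletCharacter ℂ q) {s : ℝ} (hs : 1 < s) :
    |Real.log ‖realL χ s‖ - primeL χ s| ≤ 2 := by
  obtain ⟨E, hE, h⟩ := exp_eq_norm_realL χ hs
  rwa [h, Real.log_exp, add_sub_cancel_left]

lemma realL_one_eq (s : ℝ) :
    realL (1 : DirichletCharacter ℂ 1) s = (realZeta s : ℂ) := by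
  unfold realL realZeta
  rw [Complex.ofReal_tsum]
  refine tsum_congr fun n => ?_
  rw [MulChar.one_apply (isUnit_of_subsingleton _), one_mul]

lemma primeL_one_eq (s : ℝ) :
    primeL (1 : DirichletCharacter ℂ 1) s = ∑' p : Nat.Primes, ((p : ℕ) : ℝ) ^ (-s) := by
  unfold primeL
  refine tsum_congr fun n => ?_
  rw [MulChar.one_apply (isUnit_of_subsingleton _), Complex.one_re, one_mul]

lemma norm_sum_range_character_le {q : ℕ} [NeZero q] {χ : DirichletCharacter ℂ q} (hχ : χ ≠ 1)
    (N : ℕ) : ‖∑ i ∈ Finset.range N, χ (i : ZMod q)‖ ≤ q := by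
  have hper : Function.Periodic (fun i : ℕ => χ (i : ZMod q)) q := fun i => by simp
  have hfull : ∑ i ∈ Finset.range q, χ (i : ZMod q) = 0 := by
    rw [← MulChar.sum_eq_zero_of_ne_one hχ]
    refine Finset.sum_bij (fun i _ => (i : ZMod q)) (fun _ _ => Finset.mem_univ _) ?_ ?_
      (fun _ _ => rfl)
    · intro a ha b hb hab
      rw [Finset.mem_range] at ha hb
      have := congrArg ZMod.val hab
      rwa [ZMod.val_natCast_of_lt ha, ZMod.val_natCast_of_lt hb] at this
    · intro b _
      exact ⟨b.val, Finset.mem_range.mpr (ZMod.val_lt b), by simp⟩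
  have hblock : ∀ k : ℕ, ∑ i ∈ Finset.range (q * k), χ (i : ZMod q) = 0 := by
    intro k
    induction k with
    | zero => simp
    | succ k ih =>
      rw [Nat.mul_succ, Finset.sum_range_add, ih, zero_add, ← hfull]
      exact Finset.sum_congr rfl fun i _ => by simp
  have hsplit : ∑ i ∈ Finset.range N, χ (i : ZMod q) =
      ∑ i ∈ Finset.range (N % q), χ (i : ZMod q) := by
    conv_lhs => rw [← Nat.div_add_mod N q, Finset.sum_range_add, hblock, zero_add]
    exact Finset.sum_congr rfl fun i _ => by simp
  rw [hsplit]
  calc _ ≤ ∑ i ∈ Finset.range (N % q), ‖χ (i : ZMod q)‖ := norm_sum_le _ _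
    _ ≤ ∑ i ∈ Finset.range (N % q), (1 : ℝ) := Finset.sum_le_sum fun i _ => χ.norm_le_one _
    _ ≤ q := by
      rw [Finset.sum_const, Finset.card_range, nsmul_eq_mul, mul_one]
      exact_mod_cast (Nat.mod_lt _ (NeZero.pos q)).le

lemma norm_sum_range_succ_character_le {q : ℕ} [NeZero q] {χ : DirichletCharacter ℂ q}
    (hχ : χ ≠ 1) (N : ℕ) : ‖∑ i ∈ Finset.range N, χ ((i + 1 : ℕ) : ZMod q)‖ ≤ q := by
  have hq : q ≠ 1 := by
    rintro rfl
    exact hχ (Subsingleton.elim _ _)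
  have : ∑ i ∈ Finset.range N, χ ((i + 1 : ℕ) : ZMod q) =
      ∑ i ∈ Finset.range (N + 1), χ (i : ZMod q) := by
    rw [Finset.sum_range_succ']
    have : Nontrivial (ZMod q) := ZMod.nontrivial_iff.mpr hq
    rw [Nat.cast_zero, χ.map_zero, add_zero]
  rw [this]
  exact norm_sum_range_character_le hχ _

lemma norm_sum_mul_le_of_bounded_partial_sums {f : ℕ → ℂ} {g : ℕ → ℝ} {M : ℝ}
    (hf : ∀ N, ‖∑ i ∈ Finset.range N, f i‖ ≤ M) (N : ℕ) :
    ‖∑ i ∈ Finset.range (N + 1), f i * (g i : ℂ)‖ ≤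
      M * (|g N| + ∑ i ∈ Finset.range N, |g (i + 1) - g i|) := by
  have h := Finset.sum_range_by_parts g f (N + 1)
  simp only [Complex.real_smul, Nat.add_sub_cancel] at h
  have h' : ∑ i ∈ Finset.range (N + 1), f i * (g i : ℂ) =
      ∑ i ∈ Finset.range (N + 1), (g i : ℂ) * f i := Finset.sum_congr rfl fun i _ => mul_comm _ _
  rw [h', h, mul_add]
  refine (norm_sub_le _ _).trans (add_le_add ?_ ?_)
  · rw [norm_mul, Complex.norm_real, Real.norm_eq_abs, mul_comm]
    gcongr
    exact hf _
  · rw [Finset.mul_sum]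
    refine (norm_sum_le _ _).trans (Finset.sum_le_sum fun i _ => ?_)
    rw [norm_mul, Complex.norm_real, Real.norm_eq_abs, mul_comm]
    gcongr
    exact hf _

/-- Weighted character sums with nonnegative antitone weights. -/
lemma norm_sum_character_mul_antitone_le {q : ℕ} [NeZero q] {χ : DirichletCharacter ℂ q}
    (hχ : χ ≠ 1) {g : ℕ → ℝ} (hg : Antitone g) (hg0 : ∀ n, 0 ≤ g n) (N : ℕ) :
    ‖∑ i ∈ Finset.range N, χ ((i + 1 : ℕ) : ZMod q) * (g i : ℂ)‖ ≤ q * g 0 := by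
  cases N with
  | zero => simpa using mul_nonneg (Nat.cast_nonneg _) (hg0 0)
  | succ N =>
    refine (norm_sum_mul_le_of_bounded_partial_sums
      (norm_sum_range_succ_character_le hχ) N).trans ?_
    have : ∑ i ∈ Finset.range N, |g (i + 1) - g i| = g 0 - g N := by
      rw [← Finset.sum_range_sub' g]
      refine Finset.sum_congr rfl fun i _ => ?_
      rw [abs_sub_comm, abs_of_nonneg (sub_nonneg.mpr (hg (Nat.le_succ i)))]
    rw [this, abs_of_nonneg (hg0 N)]
    apply le_of_eq
    ring

lemma realL_tendsto {q : ℕ} (χ : DirichletCharacter ℂ q) {s : ℝ} (hs : 1 < s) :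
    Tendsto (fun N => ∑ i ∈ Finset.range N, χ ((i + 1 : ℕ) : ZMod q) *
      ((((i : ℝ) + 1) ^ (-s) : ℝ) : ℂ)) atTop (nhds (realL χ s)) := by
  have h := (summable_realL χ hs).hasSum.tendsto_sum_nat
  have h2 := h.comp (tendsto_add_atTop_nat 1)
  refine h2.congr fun N => ?_
  simp only [Function.comp]
  rw [Finset.sum_range_succ']
  simp [Real.zero_rpow (by linarith : -s ≠ 0)]

lemma norm_realL_le {q : ℕ} [NeZero q] {χ : DirichletCharacter ℂ q} (hχ : χ ≠ 1) {s : ℝ}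
    (hs : 1 < s) : ‖realL χ s‖ ≤ q := by
  refine le_of_tendsto (realL_tendsto χ hs).norm (Eventually.of_forall fun N => ?_)
  have h := norm_sum_character_mul_antitone_le hχ (g := fun i : ℕ => ((i : ℝ) + 1) ^ (-s))
    (fun a b hab => Real.rpow_le_rpow_of_nonpos (by positivity)
      (by have : (a : ℝ) ≤ b := by exact_mod_cast hab
          linarith) (by linarith)) (fun n => by positivity) N
  simpa using h

/-- The function `x⁻ˢ - x⁻ᵗ` changes slowly when `s` and `t` are close. -/
lemma abs_rpow_sub_rpow_le {s t : ℝ} (hs : 1 ≤ s) (hst : s ≤ t) (ht : t ≤ 2) {a b : ℝ}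
    (ha : 1 ≤ a) (hab : a ≤ b) :
    |(b ^ (-s) - b ^ (-t)) - (a ^ (-s) - a ^ (-t))| ≤
      10 * (t - s) * (a ^ (-(1 / 2) : ℝ) - b ^ (-(1 / 2) : ℝ)) := by
  set δ := t - s with hδ
  have hd0 : 0 ≤ δ := by linarith
  have hder : ∀ x : ℝ, 0 < x → HasDerivAt (fun x : ℝ => x ^ (-s) - x ^ (-t))
      (-s * x ^ (-s - 1) - -t * x ^ (-t - 1)) x := fun x hx =>
    (Real.hasDerivAt_rpow_const (Or.inl hx.ne')).sub (Real.hasDerivAt_rpow_const (Or.inl hx.ne'))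
  have hder2 : ∀ x : ℝ, 0 < x → HasDerivAt (fun x : ℝ => 10 * δ * x ^ (-(1 / 2) : ℝ))
      (10 * δ * (-(1 / 2) * x ^ (-(1 / 2) - 1 : ℝ))) x := fun x hx =>
    (Real.hasDerivAt_rpow_const (Or.inl hx.ne')).const_mul _
  have hbound : ∀ x : ℝ, 1 ≤ x → |-s * x ^ (-s - 1) - -t * x ^ (-t - 1)| ≤
      5 * δ * x ^ (-(1 / 2) - 1 : ℝ) := by
    intro x hx
    have hx0 : 0 < x := by linarith
    have e1 : x ^ (-s - 1) = x ^ (-(3/2) : ℝ) * x ^ (-(s - 1/2)) := by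
      rw [← Real.rpow_add hx0]; congr 1; ring
    have e2 : x ^ (-t - 1) = x ^ (-(3/2) : ℝ) * (x ^ (-(s - 1/2)) * x ^ (-δ)) := by
      rw [← Real.rpow_add hx0, ← Real.rpow_add hx0]; congr 1; rw [hδ]; ring
    have e3 : x ^ (-(1 / 2) - 1 : ℝ) = x ^ (-(3/2) : ℝ) := by norm_num
    set A := x ^ (-(3/2) : ℝ) with hA
    have hA0 : 0 < A := by positivity
    set B := x ^ (-(s - 1/2)) with hB
    have hB0 : 0 < B := by positivity
    have hB1 : B ≤ 1 := Real.rpow_le_one_of_one_le_of_nonpos hx (by linarith)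
    set D := x ^ (-δ) with hD
    have hD0 : 0 < D := by positivity
    have hD1 : D ≤ 1 := Real.rpow_le_one_of_one_le_of_nonpos hx (by linarith)
    have hBD : B * (1 - D) ≤ 2 * δ := by
      have h1 : 1 - D ≤ δ * Real.log x := by
        rw [hD, Real.rpow_def_of_pos hx0]
        have := Real.add_one_le_exp (Real.log x * -δ)
        linarith
      have h2 : Real.log x ≤ 2 * x ^ (1/2 : ℝ) := by
        have := Real.log_le_rpow_div hx0.le (show (0:ℝ) < 1/2 by norm_num)
        linarith
      have h3 : B ≤ x ^ (-(1/2) : ℝ) := Real.rpow_le_rpow_of_exponent_le hx (by linarith)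
      have h4 : x ^ (-(1/2) : ℝ) * x ^ (1/2 : ℝ) = 1 := by
        rw [← Real.rpow_add hx0]; norm_num
      calc B * (1 - D) ≤ x ^ (-(1/2) : ℝ) * (δ * (2 * x ^ (1/2 : ℝ))) := by
            gcongr
            exact h1.trans (by gcongr)
        _ = 2 * δ * (x ^ (-(1/2) : ℝ) * x ^ (1/2 : ℝ)) := by ring
        _ = 2 * δ := by rw [h4, mul_one]
    rw [e1, e2, e3]
    have : -s * (A * B) - -t * (A * (B * D)) = A * (δ * (B * D) - s * (B * (1 - D))) := by
      rw [hδ]; ring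
    rw [this, abs_mul, abs_of_pos hA0, mul_comm (5 * δ)]
    gcongr
    have hBD0 : 0 ≤ B * (1 - D) := mul_nonneg hB0.le (by linarith)
    have hBD1 : B * D ≤ 1 := mul_le_one₀ hB1 hD0.le hD1
    have hBDp : 0 ≤ B * D := by positivity
    rw [abs_le]
    constructor
    · nlinarith
    · nlinarith
  have hmono : ∀ σ : ℝ, |σ| = 1 → AntitoneOn
      (fun x : ℝ => 10 * δ * x ^ (-(1 / 2) : ℝ) + σ * (x ^ (-s) - x ^ (-t))) (Set.Ici 1) := by
    intro σ hσ
    have hd : ∀ x : ℝ, 0 < x → HasDerivAt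
        (fun x : ℝ => 10 * δ * x ^ (-(1 / 2) : ℝ) + σ * (x ^ (-s) - x ^ (-t)))
        (10 * δ * (-(1 / 2) * x ^ (-(1 / 2) - 1 : ℝ)) +
          σ * (-s * x ^ (-s - 1) - -t * x ^ (-t - 1))) x := fun x hx =>
      (hder2 x hx).add ((hder x hx).const_mul σ)
    refine antitoneOn_of_deriv_nonpos (convex_Ici 1) ?_ ?_ ?_
    · exact fun x hx => (hd x (by linarith [Set.mem_Ici.mp hx])).continuousAt.continuousWithinAt
    · rw [interior_Ici]
      exact fun x hx =>
        (hd x (by linarith [Set.mem_Ioi.mp hx])).differentiableAt.differentiableWithinAt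
    · rw [interior_Ici]
      intro x hx
      have hx1 : 1 < x := hx
      rw [(hd x (by linarith)).deriv]
      have h1 := hbound x hx1.le
      have h2 : σ * (-s * x ^ (-s - 1) - -t * x ^ (-t - 1)) ≤
          |-s * x ^ (-s - 1) - -t * x ^ (-t - 1)| := by
        refine (le_abs_self _).trans ?_
        rw [abs_mul, hσ, one_mul]
      linarith
  have h1 := hmono 1 (by simp) (Set.mem_Ici.mpr ha) (Set.mem_Ici.mpr (ha.trans hab)) hab
  have h2 := hmono (-1) (by simp) (Set.mem_Ici.mpr ha) (Set.mem_Ici.mpr (ha.trans hab)) hab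
  simp only at h1 h2
  rw [abs_le]
  constructor <;> linarith

lemma norm_sum_character_rpow_sub_rpow_le {q : ℕ} [NeZero q] {χ : DirichletCharacter ℂ q}
    (hχ : χ ≠ 1) {s t : ℝ} (hs : 1 ≤ s) (hst : s ≤ t) (ht : t ≤ 2) (N : ℕ) :
    ‖∑ i ∈ Finset.range N, χ ((i + 1 : ℕ) : ZMod q) *
      ((((i : ℝ) + 1) ^ (-s) - ((i : ℝ) + 1) ^ (-t) : ℝ) : ℂ)‖ ≤ 20 * q * (t - s) := by
  have hd0 : 0 ≤ t - s := by linarith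
  cases N with
  | zero => simp only [Finset.range_zero, Finset.sum_empty, norm_zero]; positivity
  | succ N =>
    refine (norm_sum_mul_le_of_bounded_partial_sums (norm_sum_range_succ_character_le hχ) N
      (g := fun i : ℕ => ((i : ℝ) + 1) ^ (-s) - ((i : ℝ) + 1) ^ (-t))).trans ?_
    have h1 : |((N : ℝ) + 1) ^ (-s) - ((N : ℝ) + 1) ^ (-t)| ≤ 10 * (t - s) := by
      have h := abs_rpow_sub_rpow_le hs hst ht le_rfl
        (show (1 : ℝ) ≤ (N : ℝ) + 1 by linarith [(Nat.cast_nonneg N : (0 : ℝ) ≤ N)])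
      simp only [Real.one_rpow, sub_self, sub_zero] at h
      refine h.trans ?_
      have : (0 : ℝ) ≤ ((N : ℝ) + 1) ^ (-(1 / 2) : ℝ) := by positivity
      nlinarith
    have h2 : ∑ i ∈ Finset.range N, |((((i + 1 : ℕ) : ℝ) + 1) ^ (-s) -
        (((i + 1 : ℕ) : ℝ) + 1) ^ (-t)) - (((i : ℝ) + 1) ^ (-s) - ((i : ℝ) + 1) ^ (-t))| ≤
        10 * (t - s) := by
      calc _ ≤ ∑ i ∈ Finset.range N, 10 * (t - s) * (((i : ℝ) + 1) ^ (-(1 / 2) : ℝ) -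
            (((i + 1 : ℕ) : ℝ) + 1) ^ (-(1 / 2) : ℝ)) := by
            refine Finset.sum_le_sum fun i _ => abs_rpow_sub_rpow_le hs hst ht ?_ ?_
            · linarith [(Nat.cast_nonneg i : (0 : ℝ) ≤ i)]
            · push_cast; linarith
        _ = 10 * (t - s) * (1 - ((N : ℝ) + 1) ^ (-(1 / 2) : ℝ)) := by
            rw [← Finset.mul_sum,
              Finset.sum_range_sub' (fun i : ℕ => ((i : ℝ) + 1) ^ (-(1 / 2) : ℝ))]
            simp
        _ ≤ 10 * (t - s) := by
            have : (0 : ℝ) ≤ ((N : ℝ) + 1) ^ (-(1 / 2) : ℝ) := by positivity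
            nlinarith
    have : (0 : ℝ) ≤ q := Nat.cast_nonneg q
    calc _ ≤ (q : ℝ) * (10 * (t - s) + 10 * (t - s)) := by gcongr
      _ = _ := by ring

lemma norm_realL_sub_realL_le {q : ℕ} [NeZero q] {χ : DirichletCharacter ℂ q} (hχ : χ ≠ 1)
    {s t : ℝ} (hs : 1 < s) (hst : s ≤ t) (ht : t ≤ 2) :
    ‖realL χ s - realL χ t‖ ≤ 20 * q * (t - s) := by
  refine le_of_tendsto ((realL_tendsto χ hs).sub (realL_tendsto χ (hs.trans_le hst))).norm
    (Eventually.of_forall fun N => ?_)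
  refine le_trans (le_of_eq ?_) (norm_sum_character_rpow_sub_rpow_le hχ hs.le hst ht N)
  rw [← Finset.sum_sub_distrib]
  congr 1
  refine Finset.sum_congr rfl fun i _ => ?_
  push_cast
  ring

lemma rpow_neg_tangent_le {x h δ : ℝ} (hx : 0 < x) (hxh : 0 < x + h) (hδ : 0 ≤ δ) :
    x ^ (-δ) - δ * h * x ^ (-(1 + δ)) ≤ (x + h) ^ (-δ) := by
  have h0 : x + h = x * (1 + h / x) := by field_simp
  have h1 : 0 < 1 + h / x := by
    rw [h0] at hxh
    exact (pos_iff_pos_of_mul_pos hxh).mp hx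
  have h2 : x ^ (-(1 + δ)) = x ^ (-δ) / x := by
    rw [neg_add, add_comm, Real.rpow_add hx, Real.rpow_neg_one, div_eq_mul_inv]
  rw [h0, Real.mul_rpow hx.le h1.le, h2]
  have h3 : 1 - δ * (h / x) ≤ (1 + h / x) ^ (-δ) := by
    rw [Real.rpow_def_of_pos h1]
    have h4 := Real.add_one_le_exp (Real.log (1 + h / x) * -δ)
    have h5 := Real.log_le_sub_one_of_pos h1
    nlinarith
  calc x ^ (-δ) - δ * h * (x ^ (-δ) / x) = x ^ (-δ) * (1 - δ * (h / x)) := by ring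
    _ ≤ _ := by gcongr

lemma sum_Ioc_rpow_le {δ : ℝ} (hδ : 0 < δ) {n N : ℕ} (hn : 1 ≤ n) :
    ∑ m ∈ Finset.Ioc n N, (m : ℝ) ^ (-(1 + δ)) ≤ (n : ℝ) ^ (-δ) / δ := by
  rcases le_total N n with h | h
  · rw [Finset.Ioc_eq_empty (by lia), Finset.sum_empty]
    positivity
  have key : ∑ m ∈ Finset.Ioc n N, (m : ℝ) ^ (-(1 + δ)) ≤
      ((n : ℝ) ^ (-δ) - (N : ℝ) ^ (-δ)) / δ := by
    induction N, h using Nat.le_induction with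
    | base => simp
    | succ N hN ih =>
      rw [← Finset.insert_Ioc_right_eq_Ioc_add_one (by lia), Finset.sum_insert (by simp)]
      have h1 : (0 : ℝ) < N := by exact_mod_cast (by lia : 0 < N)
      have h2 := rpow_neg_tangent_le (x := (N : ℝ) + 1) (h := -1) (by linarith) (by linarith) hδ.le
      have h3 : (N : ℝ) + 1 + -1 = N := by ring
      rw [h3] at h2
      rw [le_div_iff₀ hδ] at ih ⊢
      push_cast
      linarith
  refine key.trans ?_
  gcongr
  have : (0 : ℝ) ≤ (N : ℝ) ^ (-δ) := by positivity
  linarith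

lemma realZeta_le {δ : ℝ} (hδ : 0 < δ) : realZeta (1 + δ) ≤ 1 + 1 / δ := by
  refine le_of_tendsto (summable_nat_rpow_neg (by linarith)).hasSum.tendsto_sum_nat
    (Eventually.of_forall fun N => ?_)
  have h : ∑ i ∈ Finset.range N, (i : ℝ) ^ (-(1 + δ)) ≤
      ∑ i ∈ insert 0 (insert 1 (Finset.Ioc 1 N)), (i : ℝ) ^ (-(1 + δ)) := by
    refine Finset.sum_le_sum_of_subset_of_nonneg (fun i hi => ?_) fun _ _ _ => by positivity
    simp only [Finset.mem_insert, Finset.mem_Ioc, Finset.mem_range] at hi ⊢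
    lia
  refine h.trans ?_
  rw [Finset.sum_insert (by simp), Finset.sum_insert (by simp), Nat.cast_zero,
    Real.zero_rpow (by linarith), Nat.cast_one, Real.one_rpow, zero_add]
  gcongr
  simpa using sum_Ioc_rpow_le hδ (le_refl 1) (N := N)

lemma one_div_le_realZeta {δ : ℝ} (hδ : 0 < δ) : 1 / δ ≤ realZeta (1 + δ) := by
  have hs := (summable_nat_rpow_neg (s := 1 + δ) (by linarith)).hasSum.tendsto_sum_nat
  have key : ∀ N : ℕ, (1 - ((N : ℝ) + 1) ^ (-δ)) / δ ≤
      ∑ i ∈ Finset.range (N + 1), (i : ℝ) ^ (-(1 + δ)) := by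
    intro N
    induction N with
    | zero => simp [Real.zero_rpow (by linarith : -δ + -1 ≠ 0)]
    | succ N ih =>
      rw [Finset.sum_range_succ]
      have h1 : (0 : ℝ) ≤ N := Nat.cast_nonneg N
      have h2 := rpow_neg_tangent_le (x := (N : ℝ) + 1) (h := 1) (by linarith) (by linarith) hδ.le
      rw [div_le_iff₀ hδ] at ih ⊢
      push_cast
      linarith
  have hlim : Tendsto (fun N : ℕ => (1 - ((N : ℝ) + 1) ^ (-δ)) / δ) atTop (nhds ((1 - 0) / δ)) := by
    refine Tendsto.div_const (tendsto_const_nhds.sub ?_) _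
    exact (tendsto_rpow_neg_atTop hδ).comp
      (tendsto_atTop_add_const_right _ _ tendsto_natCast_atTop_atTop)
  rw [sub_zero] at hlim
  exact le_of_tendsto_of_tendsto' hlim (hs.comp (tendsto_add_atTop_nat 1)) key

lemma sq_mul_pow_le_geom_sum_sq {x : ℝ} (hx : 0 ≤ x) (n : ℕ) :
    (n : ℝ) ^ 2 * x ^ (n - 1) ≤ (∑ i ∈ Finset.range n, x ^ i) ^ 2 := by
  have h := Finset.sum_sq_le_sum_mul_sum_of_sq_le_mul (Finset.range n)
    (r := fun _ => Real.sqrt (x ^ (n - 1))) (f := fun i => x ^ i) (g := fun i => x ^ (n - 1 - i))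
    (fun i _ => by positivity) (fun i _ => by positivity) (fun i hi => by
      rw [Real.sq_sqrt (by positivity), ← pow_add]
      have : i + (n - 1 - i) = n - 1 := by have := Finset.mem_range.mp hi; lia
      rw [this])
  rw [Finset.sum_const, Finset.card_range, nsmul_eq_mul, mul_pow, Real.sq_sqrt (by positivity),
    Finset.sum_range_reflect (fun i => x ^ i) n] at h
  rwa [sq (∑ i ∈ Finset.range n, x ^ i)]

lemma mul_pow_le_geom_sum_mul {x : ℝ} (hx : 0 ≤ x) (hx1 : x ≤ 1) (n : ℕ) :
    (n : ℝ) * (n + 1) * x ^ n ≤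
      (∑ i ∈ Finset.range n, x ^ i) * ∑ i ∈ Finset.range (n + 1), x ^ i := by
  refine (sq_le_sq₀ (by positivity) (by positivity)).mp ?_
  have h1 := sq_mul_pow_le_geom_sum_sq hx n
  have h2 := sq_mul_pow_le_geom_sum_sq hx (n + 1)
  rw [mul_pow, mul_pow, mul_pow, ← pow_mul]
  calc (n : ℝ) ^ 2 * ((n : ℝ) + 1) ^ 2 * x ^ (n * 2)
      ≤ (n : ℝ) ^ 2 * ((n : ℝ) + 1) ^ 2 * x ^ ((n - 1) + n) := by
        gcongr ?_ * ?_
        exact pow_le_pow_of_le_one hx hx1 (by lia)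
    _ = ((n : ℝ) ^ 2 * x ^ (n - 1)) * (((n + 1 : ℕ) : ℝ) ^ 2 * x ^ (n + 1 - 1)) := by
        rw [pow_add]; push_cast; ring
    _ ≤ _ := by gcongr

/-- The weights `1 / (n (1 - x)) - xⁿ / (1 - xⁿ)`, indexed from `n = 1`. -/
def lambertWeight (x : ℝ) (i : ℕ) : ℝ :=
  1 / (((i : ℝ) + 1) * (1 - x)) - x ^ (i + 1) / (1 - x ^ (i + 1))

lemma lambertWeight_eq {x : ℝ} (hx1 : x < 1) (i : ℕ) :
    lambertWeight x i = (1 / ((i : ℝ) + 1) - x ^ (i + 1) / ∑ j ∈ Finset.range (i + 1), x ^ j) /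
      (1 - x) := by
  have h : 1 - x ^ (i + 1) = (1 - x) * ∑ j ∈ Finset.range (i + 1), x ^ j := by
    rw [mul_comm, geom_sum_mul_neg]
  have h1 : 1 - x ≠ 0 := by linarith
  rw [lambertWeight, h, sub_div, div_div, div_div, mul_comm (1 - x) (∑ j ∈ _, _)]

lemma lambertWeight_zero {x : ℝ} (hx1 : x < 1) : lambertWeight x 0 = 1 := by
  have h1 : 1 - x ≠ 0 := by linarith
  rw [lambertWeight]
  simp only [Nat.cast_zero, zero_add, one_mul, pow_one, ← sub_div]
  exact div_self h1

lemma lambertWeight_nonneg {x : ℝ} (hx : 0 < x) (hx1 : x < 1) (i : ℕ) :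
    0 ≤ lambertWeight x i := by
  rw [lambertWeight_eq hx1]
  refine div_nonneg (sub_nonneg.mpr ?_) (by linarith)
  have hS : 0 < ∑ j ∈ Finset.range (i + 1), x ^ j :=
    Finset.sum_pos (fun _ _ => by positivity) (by simp)
  rw [div_le_div_iff₀ hS (by positivity), one_mul]
  calc x ^ (i + 1) * ((i : ℝ) + 1) = ∑ j ∈ Finset.range (i + 1), x ^ (i + 1) := by
        simp [mul_comm]
    _ ≤ _ := Finset.sum_le_sum fun j hj =>
        pow_le_pow_of_le_one hx.le hx1.le (Finset.mem_range.mp hj).le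

lemma antitone_lambertWeight {x : ℝ} (hx : 0 < x) (hx1 : x < 1) : Antitone (lambertWeight x) := by
  refine antitone_nat_of_succ_le fun i => ?_
  rw [lambertWeight_eq hx1, lambertWeight_eq hx1]
  have h1 : 0 < 1 - x := by linarith
  refine div_le_div_of_nonneg_right ?_ h1.le
  have hS : ∀ n, 0 < ∑ j ∈ Finset.range (n + 1), x ^ j := fun n =>
    Finset.sum_pos (fun _ _ => by positivity) (by simp)
  have hS1 := hS i
  have hS2 := hS (i + 1)
  have hrec : ∑ j ∈ Finset.range (i + 1 + 1), x ^ j =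
      1 + x * ∑ j ∈ Finset.range (i + 1), x ^ j := by
    rw [Finset.sum_range_succ', Finset.mul_sum, pow_zero, add_comm]
    simp [pow_succ, mul_comm]
  have hprod := mul_pow_le_geom_sum_mul hx.le hx1.le (i + 1)
  set S := ∑ j ∈ Finset.range (i + 1), x ^ j
  set T := ∑ j ∈ Finset.range (i + 1 + 1), x ^ j
  have e1 : x ^ (i + 1) / S - x ^ (i + 1 + 1) / T = x ^ (i + 1) / (S * T) := by
    rw [div_sub_div _ _ hS1.ne' hS2.ne']
    congr 1
    rw [hrec]
    ring
  have e2 : 1 / ((i : ℝ) + 1) - 1 / (((i + 1 : ℕ) : ℝ) + 1) =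
      1 / (((i : ℝ) + 1) * ((i : ℝ) + 1 + 1)) := by
    push_cast
    field_simp
    ring
  have e3 : x ^ (i + 1) / (S * T) ≤ 1 / (((i : ℝ) + 1) * ((i : ℝ) + 1 + 1)) := by
    rw [div_le_div_iff₀ (by positivity) (by positivity)]
    push_cast at hprod
    linarith
  linarith

lemma norm_sum_character_lambertWeight_le {q : ℕ} [NeZero q] {χ : DirichletCharacter ℂ q}
    (hχ : χ ≠ 1) {x : ℝ} (hx : 0 < x) (hx1 : x < 1) (N : ℕ) :
    ‖∑ i ∈ Finset.range N, χ ((i + 1 : ℕ) : ZMod q) * (lambertWeight x i : ℂ)‖ ≤ q := by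
  have h := norm_sum_character_mul_antitone_le hχ (antitone_lambertWeight hx hx1)
    (lambertWeight_nonneg hx hx1) N
  rwa [lambertWeight_zero hx1, mul_one] at h

lemma hasSum_lambert {q : ℕ} (χ : DirichletCharacter ℂ q) {x : ℝ} (hx : 0 < x) (hx1 : x < 1) :
    ∃ a : ℝ, HasSum (fun i : ℕ => (χ ((i + 1 : ℕ) : ZMod q)).re *
        (x ^ (i + 1) / (1 - x ^ (i + 1)))) a ∧
      HasSum (fun n : ℕ+ => (∑ d ∈ (n : ℕ).divisors, (χ (d : ZMod q)).re) * x ^ (n : ℕ)) a := by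
  have hxn : ‖x‖ < 1 := by rwa [Real.norm_of_nonneg hx.le]
  set F : ℕ+ × ℕ+ → ℝ := fun c => (χ ((c.1 : ℕ) : ZMod q)).re * x ^ ((c.1 : ℕ) * (c.2 : ℕ)) with hF
  have hFs : Summable F := by
    have := summable_prod_mul_pow (𝕜 := ℝ) 0 hxn
    simp only [pow_zero, one_mul] at this
    refine Summable.of_norm_bounded this fun c => ?_
    rw [hF, norm_mul, Real.norm_of_nonneg (by positivity : (0 : ℝ) ≤ x ^ _)]
    exact mul_le_of_le_one_left (by positivity)
      ((Complex.abs_re_le_norm _).trans (χ.norm_le_one _))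
  refine ⟨∑' c, F c, ?_, ?_⟩
  · have h1 : ∀ d : ℕ+, HasSum (fun c : ℕ+ => F (d, c))
        ((χ ((d : ℕ) : ZMod q)).re * (x ^ (d : ℕ) / (1 - x ^ (d : ℕ)))) := by
      intro d
      refine HasSum.mul_left _ ?_
      have hxd : x ^ (d : ℕ) < 1 := pow_lt_one₀ hx.le hx1 d.ne_zero
      have h2 := (hasSum_geometric_of_lt_one (pow_nonneg hx.le (d : ℕ)) hxd).mul_left (x ^ (d : ℕ))
      rw [← div_eq_mul_inv] at h2
      rw [← Equiv.pnatEquivNat.symm.hasSum_iff]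
      refine h2.congr_fun ?_
      intro n
      simp [Function.comp, Equiv.pnatEquivNat, pow_mul, pow_succ, mul_comm, mul_pow, pow_right_comm]
    have h3 := hFs.hasSum.prod_fiberwise h1
    rw [← Equiv.pnatEquivNat.symm.hasSum_iff] at h3
    exact h3
  · have h1 := (sigmaAntidiagonalEquivProd.hasSum_iff.mpr hFs.hasSum)
    have h2 := h1.sigma (g := fun n : ℕ+ =>
      (∑ d ∈ (n : ℕ).divisors, (χ (d : ZMod q)).re) * x ^ (n : ℕ)) ?_
    · exact h2
    · intro n
      have h3 : (∑ d ∈ (n : ℕ).divisors, (χ (d : ZMod q)).re) * x ^ (n : ℕ) =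
          ∑ c : Nat.divisorsAntidiagonal n, (χ ((c.1.1 : ℕ) : ZMod q)).re * x ^ (n : ℕ) := by
        rw [← Finset.sum_mul]
        congr 1
        rw [Finset.sum_coe_sort _ (fun c : ℕ × ℕ => (χ ((c.1 : ℕ) : ZMod q)).re),
          Nat.sum_divisorsAntidiagonal (fun i _ => (χ ((i : ℕ) : ZMod q)).re)]
      rw [h3]
      convert hasSum_fintype _ using 2 with c
      have h4 : ((sigmaAntidiagonalEquivProd ⟨n, c⟩).1 : ℕ) *
          ((sigmaAntidiagonalEquivProd ⟨n, c⟩).2 : ℕ) = n := divisorsAntidiagonalFactors_eq c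
      simp only [Function.comp, hF]
      rw [h4]
      rfl

lemma zetaMul_re_eq {q : ℕ} (χ : DirichletCharacter ℂ q) (n : ℕ) :
    (χ.zetaMul n).re = ∑ d ∈ n.divisors, (χ (d : ZMod q)).re := by
  rw [DirichletCharacter.zetaMul, ArithmeticFunction.coe_zeta_mul_apply, Complex.re_sum]
  refine Finset.sum_congr rfl fun d hd => ?_
  have : d ≠ 0 := (Nat.pos_of_mem_divisors hd).ne'
  simp [toArithmeticFunction, this]

lemma sum_divisors_re_nonneg {q : ℕ} {χ : DirichletCharacter ℂ q} (h2 : χ ^ 2 = 1) (n : ℕ) :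
    0 ≤ ∑ d ∈ n.divisors, (χ (d : ZMod q)).re := by
  rw [← zetaMul_re_eq]
  exact (Complex.nonneg_iff.mp (DirichletCharacter.zetaMul_nonneg h2 n)).1

lemma sum_divisors_prime_pow_of_dvd {q p : ℕ} (χ : DirichletCharacter ℂ q) (hp : p.Prime)
    (hpq : p ∣ q) (j : ℕ) : ∑ d ∈ (p ^ j).divisors, (χ (d : ZMod q)).re = 1 := by
  have h0 : χ ((p : ℕ) : ZMod q) = 0 := by
    refine χ.map_nonunit fun hu => ?_
    have := (ZMod.isUnit_iff_coprime p q).mp hu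
    exact hp.one_lt.ne' (Nat.Coprime.eq_one_of_dvd this hpq)
  rw [Nat.sum_divisors_prime_pow hp, Finset.sum_range_succ']
  simp [pow_succ, h0]

lemma sum_pow_prime_pow_le {q p : ℕ} {χ : DirichletCharacter ℂ q} (h2 : χ ^ 2 = 1)
    (hp : p.Prime) (hpq : p ∣ q) {x : ℝ} (hx : 0 < x) {a : ℝ}
    (ha : HasSum (fun n : ℕ+ => (∑ d ∈ (n : ℕ).divisors, (χ (d : ZMod q)).re) * x ^ (n : ℕ)) a)
    (J : ℕ) : ∑ j ∈ Finset.range J, x ^ (p ^ j) ≤ a := by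
  set e : ℕ ↪ ℕ+ := ⟨fun j => ⟨p ^ j, pow_pos hp.pos j⟩, fun i j h => by
    exact Nat.pow_right_injective hp.two_le (congrArg PNat.val h)⟩ with he
  have h := sum_le_hasSum ((Finset.range J).map e) (fun n _ => mul_nonneg
    (sum_divisors_re_nonneg h2 n) (by positivity)) ha
  rw [Finset.sum_map] at h
  refine le_trans (le_of_eq (Finset.sum_congr rfl fun j _ => ?_)) h
  have : ((e j : ℕ+) : ℕ) = p ^ j := rfl
  rw [this, sum_divisors_prime_pow_of_dvd χ hp hpq, one_mul]

lemma half_mul_le_sum_pow {p : ℕ} (hp : p.Prime) (J : ℕ) :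
    (J : ℝ) / 2 ≤ ∑ j ∈ Finset.range J, (1 - ((p : ℝ) ^ J)⁻¹ / 2) ^ (p ^ j) := by
  have hP : (1 : ℝ) ≤ (p : ℝ) ^ J := one_le_pow₀ (by exact_mod_cast hp.one_le)
  have hinv : ((p : ℝ) ^ J)⁻¹ ≤ 1 := inv_le_one_of_one_le₀ hP
  have hinv0 : 0 < ((p : ℝ) ^ J)⁻¹ := by positivity
  calc (J : ℝ) / 2 = ∑ j ∈ Finset.range J, (1 / 2 : ℝ) := by simp; ring
    _ ≤ _ := Finset.sum_le_sum fun j hj => ?_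
  have h1 := one_add_mul_le_pow (a := -(((p : ℝ) ^ J)⁻¹ / 2)) (by linarith) (p ^ j)
  rw [← sub_eq_add_neg] at h1
  refine le_trans ?_ h1
  have h3 : (p : ℝ) ^ j ≤ (p : ℝ) ^ J :=
    pow_le_pow_right₀ (by exact_mod_cast hp.one_le) (Finset.mem_range.mp hj).le
  have h2 : (p : ℝ) ^ j * ((p : ℝ) ^ J)⁻¹ ≤ 1 := by
    rw [← div_eq_mul_inv, div_le_one (by linarith)]; exact h3
  push_cast
  linarith

/-- Near `s = 1` the `L`-series of a quadratic character is bounded below. -/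
lemma le_norm_realL_of_quadratic_near {q : ℕ} [NeZero q] {χ : DirichletCharacter ℂ q}
    (hχ : χ ≠ 1) (h2 : χ ^ 2 = 1) {p : ℕ} (hp : p.Prime) (hpq : p ∣ q) {s : ℝ} (hs : 1 < s)
    (hs2 : s ≤ 2) (hnear : 20 * q * (s - 1) ≤ ((p : ℝ) ^ (2 * q + 4))⁻¹ / 2) :
    ((p : ℝ) ^ (2 * q + 4))⁻¹ / 2 ≤ ‖realL χ s‖ := by
  have hP : (1 : ℝ) ≤ (p : ℝ) ^ (2 * q + 4) := one_le_pow₀ (by exact_mod_cast hp.one_le)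
  have hinv : ((p : ℝ) ^ (2 * q + 4))⁻¹ ≤ 1 := inv_le_one_of_one_le₀ hP
  have hinv0 : 0 < ((p : ℝ) ^ (2 * q + 4))⁻¹ := by positivity
  have hhalf := half_mul_le_sum_pow hp (2 * q + 4)
  set ε := ((p : ℝ) ^ (2 * q + 4))⁻¹ / 2 with hε
  have hx : 0 < 1 - ε := by linarith
  have hx1 : 1 - ε < 1 := by linarith
  obtain ⟨a, ha1, ha2⟩ := hasSum_lambert χ hx hx1
  have ha := hhalf.trans (sum_pow_prime_pow_le h2 hp hpq hx ha2 _)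
  push_cast at ha
  have hfin : ∀ N : ℕ, ε * (∑ i ∈ Finset.range N, (χ ((i + 1 : ℕ) : ZMod q)).re *
      ((1 - ε) ^ (i + 1) / (1 - (1 - ε) ^ (i + 1))) - q) - 20 * q * (s - 1) ≤
      (∑ i ∈ Finset.range N, χ ((i + 1 : ℕ) : ZMod q) *
        ((((i : ℝ) + 1) ^ (-s) : ℝ) : ℂ)).re := by
    intro N
    have h1 := (Complex.abs_re_le_norm _).trans
      (norm_sum_character_rpow_sub_rpow_le hχ le_rfl hs.le hs2 N)
    have h2 := (Complex.abs_re_le_norm _).trans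
      (norm_sum_character_lambertWeight_le hχ hx hx1 N)
    rw [Complex.re_sum] at h1 h2 ⊢
    simp only [Complex.re_mul_ofReal] at h1 h2 ⊢
    have e1 := (abs_le.mp h1).2
    have e2 := (abs_le.mp h2).1
    have hid : ∑ i ∈ Finset.range N, (χ ((i + 1 : ℕ) : ZMod q)).re * ((i : ℝ) + 1) ^ (-1 : ℝ) =
        ε * (∑ i ∈ Finset.range N, (χ ((i + 1 : ℕ) : ZMod q)).re * lambertWeight (1 - ε) i +
        ∑ i ∈ Finset.range N, (χ ((i + 1 : ℕ) : ZMod q)).re *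
          ((1 - ε) ^ (i + 1) / (1 - (1 - ε) ^ (i + 1)))) := by
      rw [← Finset.sum_add_distrib, Finset.mul_sum]
      refine Finset.sum_congr rfl fun i _ => ?_
      rw [← mul_add, lambertWeight, sub_add_cancel, sub_sub_cancel, Real.rpow_neg_one]
      have : ε ≠ 0 := by positivity
      field_simp
    simp only [mul_sub, Finset.sum_sub_distrib] at e1
    rw [hid] at e1
    have hε0 : 0 < ε := by positivity
    nlinarith
  have hlim := le_of_tendsto_of_tendsto'
    (((ha1.tendsto_sum_nat.sub_const (q : ℝ)).const_mul ε).sub_const (20 * q * (s - 1)))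
    ((Complex.continuous_re.tendsto _).comp (realL_tendsto χ hs)) hfin
  refine le_trans ?_ ((le_abs_self _).trans (Complex.abs_re_le_norm _))
  have hε0 : 0 < ε := by positivity
  refine le_trans ?_ hlim
  nlinarith

lemma primeL_neg_le {q : ℕ} (χ : DirichletCharacter ℂ q) {s : ℝ} (hs : 1 < s) :
    |primeL χ s| ≤ primeL (1 : DirichletCharacter ℂ 1) s := by
  rw [primeL_one_eq, ← Real.norm_eq_abs]
  exact tsum_of_norm_bounded (summable_primes_rpow_neg hs).hasSum fun p =>
    (Real.norm_eq_abs _).trans_le (abs_re_mul_rpow_le χ s p)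

lemma norm_realL_one_eq (s : ℝ) :
    ‖realL (1 : DirichletCharacter ℂ 1) s‖ = realZeta s := by
  rw [realL_one_eq, Complex.norm_real, realZeta,
    Real.norm_of_nonneg (tsum_nonneg fun n => by positivity)]

lemma primeL_one_le_log {δ : ℝ} (hδ : 0 < δ) :
    primeL (1 : DirichletCharacter ℂ 1) (1 + δ) ≤ Real.log (1 + 1 / δ) + 2 := by
  have h := abs_log_norm_realL_sub_primeL_le (1 : DirichletCharacter ℂ 1)
    (show (1 : ℝ) < 1 + δ by linarith)
  rw [norm_realL_one_eq] at h
  have h1 := (abs_le.mp h).1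
  have h2 : Real.log (realZeta (1 + δ)) ≤ Real.log (1 + 1 / δ) :=
    Real.log_le_log (lt_of_lt_of_le (by positivity) (one_div_le_realZeta hδ)) (realZeta_le hδ)
  linarith

lemma log_le_primeL_one {δ : ℝ} (hδ : 0 < δ) :
    Real.log (1 / δ) - 2 ≤ primeL (1 : DirichletCharacter ℂ 1) (1 + δ) := by
  have h := abs_log_norm_realL_sub_primeL_le (1 : DirichletCharacter ℂ 1)
    (show (1 : ℝ) < 1 + δ by linarith)
  rw [norm_realL_one_eq] at h
  have h1 := (abs_le.mp h).2
  have h2 := Real.log_le_log (by positivity) (one_div_le_realZeta hδ)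
  linarith

lemma neg_log_le_log_norm_realL {q : ℕ} (χ : DirichletCharacter ℂ q) {δ : ℝ} (hδ : 0 < δ) :
    -Real.log (1 + 1 / δ) - 4 ≤ Real.log ‖realL χ (1 + δ)‖ := by
  have h1 := (abs_le.mp (abs_log_norm_realL_sub_primeL_le χ
    (show (1 : ℝ) < 1 + δ by linarith))).1
  have h2 := (abs_le.mp (primeL_neg_le χ (show (1 : ℝ) < 1 + δ by linarith))).1
  have h3 := primeL_one_le_log hδ
  linarith

lemma log_norm_realL_ge_of_sq_eq_one {q : ℕ} [NeZero q] {χ : DirichletCharacter ℂ q} (hχ : χ ≠ 1)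
    (h2 : χ ^ 2 = 1) {s : ℝ} (hs : 1 < s) (hs2 : s ≤ 2) :
    -(20 * (q : ℝ) ^ 2) ≤ Real.log ‖realL χ s‖ := by
  have hq1 : q ≠ 1 := by
    rintro rfl
    exact hχ (Subsingleton.elim _ _)
  have hq2 : (2 : ℝ) ≤ q := by
    have := NeZero.pos q
    exact_mod_cast (by lia : 2 ≤ q)
  have hp := Nat.minFac_prime hq1
  set p := q.minFac with hpdef
  have hpq : p ∣ q := Nat.minFac_dvd q
  have hlp : Real.log p ≤ q - 1 := by
    have h1 : Real.log p ≤ Real.log q := Real.log_le_log (by exact_mod_cast hp.pos)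
      (by exact_mod_cast Nat.minFac_le (NeZero.pos q))
    have h2 := Real.log_le_sub_one_of_pos (show (0 : ℝ) < q by linarith)
    linarith
  have hlp0 : 0 ≤ Real.log p := Real.log_natCast_nonneg p
  set ε := ((p : ℝ) ^ (2 * q + 4))⁻¹ / 2 with hε
  have hp0 : (0 : ℝ) < p := by exact_mod_cast hp.pos
  have hε0 : 0 < ε := by positivity
  have hlogε : Real.log ε = -((2 * q + 4) * Real.log p) - Real.log 2 := by
    rw [hε, Real.log_div (by positivity) (by norm_num), Real.log_inv, Real.log_pow]
    push_cast
    ring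
  have hl2 := Real.log_two_lt_d9
  have hJ : (2 * q + 4) * Real.log p ≤ (2 * q + 4) * ((q : ℝ) - 1) := by gcongr
  by_cases hnear : 20 * q * (s - 1) ≤ ε
  · have h := Real.log_le_log hε0 (le_norm_realL_of_quadratic_near hχ h2 hp hpq hs hs2 hnear)
    rw [hlogε] at h
    nlinarith
  · push Not at hnear
    obtain ⟨δ, rfl⟩ : ∃ δ, s = 1 + δ := ⟨s - 1, by ring⟩
    have hδ : 0 < δ := by linarith
    have h := neg_log_le_log_norm_realL χ hδ
    have h3 : 1 + 1 / δ ≤ 40 * q / ε := by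
      have : 1 + 1 / δ ≤ 2 / δ := by
        rw [← sub_nonneg]
        have : 2 / δ - (1 + 1 / δ) = (1 - δ) / δ := by field_simp; ring
        rw [this]
        exact div_nonneg (by linarith) hδ.le
      refine this.trans ?_
      rw [div_le_div_iff₀ hδ hε0]
      linarith
    have h4 := Real.log_le_log (by positivity) h3
    rw [Real.log_div (by positivity) hε0.ne', Real.log_mul (by norm_num) (by positivity),
      hlogε] at h4
    have h5 : Real.log 40 ≤ 6 * Real.log 2 := by
      rw [← Real.log_rpow (by norm_num)]
      exact Real.log_le_log (by norm_num) (by norm_num)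
    have h6 := Real.log_le_sub_one_of_pos (show (0 : ℝ) < q by linarith)
    nlinarith

lemma norm_realL_pow_four_ge {q : ℕ} [NeZero q] {χ : DirichletCharacter ℂ q} (h2 : χ ^ 2 ≠ 1)
    {x : ℝ} (hx : 0 < x) (hx1 : x ≤ 1) : x ^ 3 / (8 * q) ≤ ‖realL χ (1 + x)‖ ^ 4 := by
  have h := DirichletCharacter.norm_LSeries_product_ge_one χ hx 0
  have hne : (1 + x : ℝ) ≠ 0 := by linarith
  have e : (1 + x : ℂ) = ((1 + x : ℝ) : ℂ) := by push_cast; rfl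
  simp only [Complex.ofReal_zero, mul_zero, add_zero, e] at h
  rw [LSeries_eq_realL _ hne, LSeries_eq_realL _ hne, LSeries_eq_realL _ hne, norm_mul, norm_mul,
    norm_pow, norm_pow] at h
  have h1 : ‖realL (1 : DirichletCharacter ℂ q) (1 + x)‖ ≤ 2 / x := by
    refine ((norm_realL_le_realZeta _ (by linarith)).trans (realZeta_le hx)).trans ?_
    rw [← sub_nonneg]
    have : 2 / x - (1 + 1 / x) = (1 - x) / x := by field_simp; ring
    rw [this]
    exact div_nonneg (by linarith) hx.le
  have h3 := norm_realL_le h2 (show 1 < 1 + x by linarith)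
  have hq : (0 : ℝ) < q := by exact_mod_cast NeZero.pos q
  have h4 : 1 ≤ (2 / x) ^ 3 * ‖realL χ (1 + x)‖ ^ 4 * q := h.le.trans (by gcongr)
  rw [div_le_iff₀ (by positivity)]
  have h5 : (2 / x) ^ 3 * ‖realL χ (1 + x)‖ ^ 4 * q = 8 * ‖realL χ (1 + x)‖ ^ 4 * q / x ^ 3 := by
    field_simp
    ring
  rw [h5, one_le_div (by positivity)] at h4
  linarith

lemma log_norm_realL_ge_of_sq_ne_one {q : ℕ} [NeZero q] {χ : DirichletCharacter ℂ q}
    (h2 : χ ^ 2 ≠ 1) {s : ℝ} (hs : 1 < s) (hs2 : s ≤ 2) :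
    -(20 * (q : ℝ) ^ 2) ≤ Real.log ‖realL χ s‖ := by
  have hχ : χ ≠ 1 := by
    rintro rfl
    exact h2 (one_pow 2)
  have hq : (1 : ℝ) ≤ q := by exact_mod_cast NeZero.pos q
  have hq0 : (0 : ℝ) < q := by linarith
  set η : ℝ := 1 / (8 * 40 ^ 4 * (q : ℝ) ^ 5) with hη
  have hη0 : 0 < η := by positivity
  have hη1 : η ≤ 1 := by
    rw [hη, div_le_one (by positivity)]
    have : (1 : ℝ) ≤ (q : ℝ) ^ 5 := one_le_pow₀ hq
    linarith
  have hkey : η ^ 3 / (8 * q) = (40 * q * η) ^ 4 := by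
    rw [hη]
    field_simp
  have hlow : 20 * q * η ≤ ‖realL χ s‖ := by
    rcases le_total (1 + η) s with h | h
    · obtain ⟨x, rfl⟩ : ∃ x, s = 1 + x := ⟨s - 1, by ring⟩
      have h3 := norm_realL_pow_four_ge h2 (x := x) (by linarith) (by linarith)
      have h4 : (40 * q * η) ^ 4 ≤ ‖realL χ (1 + x)‖ ^ 4 := by
        rw [← hkey]
        refine le_trans ?_ h3
        gcongr
        linarith
      have h5 := le_of_pow_le_pow_left₀ (by norm_num) (norm_nonneg _) h4
      have : 0 < q * η := by positivity
      linarith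
    · have h3 := norm_realL_pow_four_ge h2 hη0 hη1
      rw [hkey] at h3
      have h4 := le_of_pow_le_pow_left₀ (by norm_num) (norm_nonneg _) h3
      have h5 := norm_realL_sub_realL_le hχ hs h (by linarith)
      have h6 := norm_sub_norm_le (realL χ (1 + η)) (realL χ s)
      rw [norm_sub_rev] at h6
      have h7 : 20 * q * (1 + η - s) ≤ 20 * q * η := by
        gcongr
        linarith
      linarith
  have hval : 20 * q * η = 1 / (1024000 * (q : ℝ) ^ 4) := by
    rw [hη]
    field_simp
    norm_num
  rw [hval] at hlow
  have h3 := Real.log_le_log (by positivity) hlow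
  rw [one_div, Real.log_inv, Real.log_mul (by norm_num) (by positivity), Real.log_pow] at h3
  have h4 : Real.log 1024000 ≤ 20 * Real.log 2 := by
    rw [← Real.log_rpow (by norm_num)]
    exact Real.log_le_log (by norm_num) (by norm_num)
  have h5 := Real.log_two_lt_d9
  have h6 := Real.log_le_sub_one_of_pos hq0
  push_cast at h3
  nlinarith

lemma log_norm_realL_ge {q : ℕ} [NeZero q] {χ : DirichletCharacter ℂ q} (hχ : χ ≠ 1) {s : ℝ}
    (hs : 1 < s) (hs2 : s ≤ 2) : -(20 * (q : ℝ) ^ 2) ≤ Real.log ‖realL χ s‖ := by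
  by_cases h2 : χ ^ 2 = 1
  · exact log_norm_realL_ge_of_sq_eq_one hχ h2 hs hs2
  · exact log_norm_realL_ge_of_sq_ne_one h2 hs hs2

/-- The sum of `p⁻ˢ` over the primes `p ≡ 1 (mod q)`. -/
def apSum (q : ℕ) (s : ℝ) : ℝ :=
  ∑' m : ℕ, if m.Prime ∧ m % q = 1 % q then (m : ℝ) ^ (-s) else 0

lemma apSum_nonneg (q : ℕ) (s : ℝ) : 0 ≤ apSum q s :=
  tsum_nonneg fun m => by split_ifs <;> positivity

lemma summable_apSum (q : ℕ) {s : ℝ} (hs : 1 < s) :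
    Summable fun m : ℕ => if m.Prime ∧ m % q = 1 % q then (m : ℝ) ^ (-s) else 0 := by
  refine Summable.of_nonneg_of_le (fun m => ?_) (fun m => ?_) (summable_nat_rpow_neg hs)
  · split_ifs <;> positivity
  · split_ifs
    · exact le_rfl
    · positivity

lemma totient_mul_apSum {q : ℕ} [NeZero q] {s : ℝ} (hs : 1 < s) :
    (q.totient : ℝ) * apSum q s = ∑ χ : DirichletCharacter ℂ q, primeL χ s := by
  have hU : apSum q s = ∑' p : Nat.Primes,
      if (p : ℕ) % q = 1 % q then ((p : ℕ) : ℝ) ^ (-s) else 0 := by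
    unfold apSum
    refine Eq.trans ?_ (tsum_subtype {m : ℕ | m.Prime}
      fun m : ℕ => if m % q = 1 % q then (m : ℝ) ^ (-s) else 0).symm
    refine tsum_congr fun m => ?_
    by_cases hm : m.Prime <;> simp [Set.indicator, hm]
  rw [hU, ← tsum_mul_left]
  unfold primeL
  rw [← Summable.tsum_finsetSum fun χ _ => summable_primeL χ hs]
  refine tsum_congr fun p => ?_
  rw [← Finset.sum_mul, ← Complex.re_sum, DirichletCharacter.sum_characters_eq]
  have h : ((p : ℕ) : ZMod q) = 1 ↔ (p : ℕ) % q = 1 % q := by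
    rw [← Nat.cast_one, ZMod.natCast_eq_natCast_iff]
    rfl
  by_cases hp : (p : ℕ) % q = 1 % q
  · rw [if_pos hp, if_pos (h.mpr hp), Complex.natCast_re]
  · rw [if_neg hp, if_neg (fun hh => hp (h.mp hh))]
    simp

lemma card_dirichletCharacter {q : ℕ} [NeZero q] :
    Fintype.card (DirichletCharacter ℂ q) = q.totient := by
  rw [← Nat.card_eq_fintype_card]
  exact DirichletCharacter.card_eq_totient_of_hasEnoughRootsOfUnity ℂ q

lemma primeL_le_primeL_one {q : ℕ} (χ : DirichletCharacter ℂ q) {s : ℝ} (hs : 1 < s) :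
    primeL χ s ≤ primeL (1 : DirichletCharacter ℂ 1) s :=
  (le_abs_self _).trans (primeL_neg_le χ hs)

lemma primeL_trivial_ge {q : ℕ} (hq : IsPrimePow q) {s : ℝ} (hs : 1 < s) :
    primeL (1 : DirichletCharacter ℂ 1) s - 1 ≤ primeL (1 : DirichletCharacter ℂ q) s := by
  obtain ⟨p, k, hp, hk, rfl⟩ := (isPrimePow_nat_iff q).mp hq
  have hs1 := summable_primes_rpow_neg hs
  have hs2 := summable_primeL (1 : DirichletCharacter ℂ (p ^ k)) hs
  rw [primeL_one_eq, sub_le_comm]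
  unfold primeL
  rw [← hs1.tsum_sub hs2]
  have hz : ∀ r : Nat.Primes, r ≠ ⟨p, hp⟩ → ((r : ℕ) : ℝ) ^ (-s) -
      ((1 : DirichletCharacter ℂ (p ^ k)) (((r : ℕ) : ℕ) : ZMod (p ^ k))).re *
        ((r : ℕ) : ℝ) ^ (-s) = 0 := by
    intro r hr
    have hcop : Nat.Coprime (r : ℕ) (p ^ k) := Nat.Coprime.pow_right k
      ((Nat.coprime_primes r.2 hp).mpr fun h => hr (Subtype.ext h))
    rw [MulChar.one_apply ((ZMod.isUnit_iff_coprime _ _).mpr hcop), Complex.one_re, one_mul,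
      sub_self]
  rw [tsum_eq_single ⟨p, hp⟩ hz]
  have h0 : ¬ IsUnit (((p : ℕ) : ZMod (p ^ k))) := fun hu => by
    have := (ZMod.isUnit_iff_coprime _ _).mp hu
    exact hp.one_lt.ne' (Nat.Coprime.eq_one_of_dvd this (dvd_pow_self p hk.ne'))
  rw [MulChar.map_nonunit _ h0, Complex.zero_re, zero_mul, sub_zero]
  exact Real.rpow_le_one_of_one_le_of_nonpos (by exact_mod_cast hp.one_le) (by linarith)

lemma apSum_le {q : ℕ} [NeZero q] {s : ℝ} (hs : 1 < s) :
    apSum q s ≤ primeL (1 : DirichletCharacter ℂ 1) s / q.totient + Real.log q + 2 := by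
  have hφ : (0 : ℝ) < q.totient := by exact_mod_cast Nat.totient_pos.mpr (NeZero.pos q)
  have hlq : 0 ≤ Real.log q := Real.log_natCast_nonneg q
  have h := totient_mul_apSum (q := q) hs
  have hb : ∑ χ : DirichletCharacter ℂ q, primeL χ s ≤
      primeL (1 : DirichletCharacter ℂ 1) s + q.totient * (Real.log q + 2) := by
    classical
    rw [← Finset.add_sum_erase _ _ (Finset.mem_univ (1 : DirichletCharacter ℂ q))]
    refine add_le_add (primeL_le_primeL_one _ hs) ?_
    calc ∑ χ ∈ Finset.univ.erase (1 : DirichletCharacter ℂ q), primeL χ s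
        ≤ ∑ χ ∈ Finset.univ.erase (1 : DirichletCharacter ℂ q), (Real.log q + 2) := by
          refine Finset.sum_le_sum fun χ hχ => ?_
          have hχ1 := Finset.ne_of_mem_erase hχ
          have h1 := (abs_le.mp (abs_log_norm_realL_sub_primeL_le χ hs)).1
          have h2 := Real.log_le_log (norm_pos_iff.mpr (realL_ne_zero χ hs)) (norm_realL_le hχ1 hs)
          linarith
      _ ≤ ∑ χ : DirichletCharacter ℂ q, (Real.log q + 2) :=
          Finset.sum_le_sum_of_subset_of_nonneg (Finset.erase_subset _ _)
            fun _ _ _ => by positivity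
      _ = _ := by
          rw [Finset.sum_const, Finset.card_univ, card_dirichletCharacter, nsmul_eq_mul]
  have h2 : apSum q s = (∑ χ : DirichletCharacter ℂ q, primeL χ s) / q.totient := by
    rw [← h]; field_simp
  rw [h2, add_assoc, div_add' _ _ _ hφ.ne']
  gcongr
  linarith

lemma le_apSum {q : ℕ} (hq : IsPrimePow q) {s : ℝ} (hs : 1 < s) (hs2 : s ≤ 2) :
    primeL (1 : DirichletCharacter ℂ 1) s / q.totient - 20 * (q : ℝ) ^ 2 - 3 ≤ apSum q s := by
  have : NeZero q := ⟨hq.ne_zero⟩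
  have hφ : (1 : ℝ) ≤ q.totient := by exact_mod_cast Nat.totient_pos.mpr (NeZero.pos q)
  have h := totient_mul_apSum (q := q) hs
  have hb : primeL (1 : DirichletCharacter ℂ 1) s - 1 + q.totient * (-(20 * (q : ℝ) ^ 2) - 2) ≤
      ∑ χ : DirichletCharacter ℂ q, primeL χ s := by
    classical
    rw [← Finset.add_sum_erase _ _ (Finset.mem_univ (1 : DirichletCharacter ℂ q))]
    refine add_le_add (primeL_trivial_ge hq hs) ?_
    calc (q.totient : ℝ) * (-(20 * (q : ℝ) ^ 2) - 2)
        = ∑ χ : DirichletCharacter ℂ q, (-(20 * (q : ℝ) ^ 2) - 2) := by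
          rw [Finset.sum_const, Finset.card_univ, card_dirichletCharacter, nsmul_eq_mul]
      _ ≤ ∑ χ ∈ Finset.univ.erase (1 : DirichletCharacter ℂ q), (-(20 * (q : ℝ) ^ 2) - 2) := by
          rw [← Finset.add_sum_erase _ _ (Finset.mem_univ (1 : DirichletCharacter ℂ q))]
          have : 0 ≤ (q : ℝ) ^ 2 := by positivity
          linarith
      _ ≤ ∑ χ ∈ Finset.univ.erase (1 : DirichletCharacter ℂ q), primeL χ s := by
          refine Finset.sum_le_sum fun χ hχ => ?_
          have hχ1 := Finset.ne_of_mem_erase hχ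
          have h1 := (abs_le.mp (abs_log_norm_realL_sub_primeL_le χ hs)).2
          have h2 := log_norm_realL_ge hχ1 hs hs2
          linarith
  have h2 : apSum q s = (∑ χ : DirichletCharacter ℂ q, primeL χ s) / q.totient := by
    rw [← h]; field_simp
  rw [h2, le_div_iff₀ (by linarith)]
  refine le_trans ?_ hb
  rw [sub_mul, sub_mul, div_mul_cancel₀ _ (by linarith)]
  nlinarith [sq_nonneg (q : ℝ)]

lemma sum_apPrimes_rpow_le_apSum {n q : ℕ} {s : ℝ} (hs : 1 < s) :
    ∑ p ∈ apPrimes n q, (p : ℝ) ^ (-s) ≤ apSum q s := by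
  have h := (summable_apSum q hs).sum_le_tsum (apPrimes n q) fun m _ => by split_ifs <;> positivity
  refine le_trans (le_of_eq (Finset.sum_congr rfl fun p hp => ?_)) h
  rw [if_pos (mem_apPrimes.mp hp).2]

lemma apSum_le_sum_apPrimes_add {n q : ℕ} (hn : 1 ≤ n) {δ : ℝ} (hδ : 0 < δ) :
    apSum q (1 + δ) ≤ ∑ p ∈ apPrimes n q, (p : ℝ) ^ (-(1 + δ)) + (n : ℝ) ^ (-δ) / δ := by
  refine le_of_tendsto (summable_apSum q (by linarith)).hasSum.tendsto_sum_nat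
    (Eventually.of_forall fun N => ?_)
  rw [← Finset.sum_filter]
  have hsub : (Finset.range N).filter (fun m => m.Prime ∧ m % q = 1 % q) ⊆
      apPrimes n q ∪ Finset.Ioc n N := by
    intro m hm
    rw [Finset.mem_filter, Finset.mem_range] at hm
    rw [Finset.mem_union, mem_apPrimes, Finset.mem_Ioc]
    rcases le_or_gt m n with h | h
    · exact Or.inl ⟨h, hm.2⟩
    · exact Or.inr ⟨h, hm.1.le⟩
  calc _ ≤ ∑ m ∈ apPrimes n q ∪ Finset.Ioc n N, (m : ℝ) ^ (-(1 + δ)) :=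
        Finset.sum_le_sum_of_subset_of_nonneg hsub fun _ _ _ => by positivity
    _ ≤ ∑ m ∈ apPrimes n q, (m : ℝ) ^ (-(1 + δ)) + ∑ m ∈ Finset.Ioc n N, (m : ℝ) ^ (-(1 + δ)) := by
        rw [← Finset.sum_union_inter]
        exact le_add_of_nonneg_right (Finset.sum_nonneg fun _ _ => by positivity)
    _ ≤ _ := by
        gcongr
        exact sum_Ioc_rpow_le hδ hn

lemma exp_LL {n : ℕ} (hn : 1 ≤ LL n) : Real.exp (LL n) = Real.log n := by
  unfold LL at *
  refine Real.exp_log ?_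
  by_contra h
  have h0 : 0 ≤ Real.log n := Real.log_natCast_nonneg n
  have : Real.log n = 0 := le_antisymm (not_lt.mp h) h0
  rw [this, Real.log_zero] at hn
  linarith

lemma one_le_of_one_le_LL {n : ℕ} (hn : 1 ≤ LL n) : 1 ≤ n := by
  by_contra h
  have : n = 0 := by lia
  subst this
  simp [LL] at hn
  linarith

lemma recipSum_le_of_one_le_LL {q : ℕ} [NeZero q] {n : ℕ} (hn : 1 ≤ LL n) :
    recipSum n q ≤ LL n / q.totient + 3 * Real.log (LL n) + 3 * Real.log q + 17 := by
  have hn1 : 1 ≤ n := one_le_of_one_le_LL hn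
  have hlog := exp_LL hn
  have hL : 0 < Real.log n := by rw [← hlog]; exact Real.exp_pos _
  set l := LL n with hl
  have hl0 : 0 < l := by linarith
  set δ := 1 / (l * Real.log n) with hδ
  have hδ0 : 0 < δ := by positivity
  have hφ : (1 : ℝ) ≤ q.totient := by exact_mod_cast Nat.totient_pos.mpr (NeZero.pos q)
  have hnδ : (n : ℝ) ^ δ ≤ 1 + 2 / l := by
    rw [Real.rpow_def_of_pos (by exact_mod_cast hn1), hδ]
    have h1 : Real.log n * (1 / (l * Real.log n)) = 1 / l := by field_simp
    rw [h1]
    have h2 : 1 / l ≤ 1 := by rw [div_le_one hl0]; exact hn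
    have h3 := Real.abs_exp_sub_one_le (x := 1 / l) (by rw [abs_of_pos (by positivity)]; exact h2)
    rw [abs_of_pos (show 0 < 1 / l by positivity)] at h3
    have h4 := (abs_le.mp h3).2
    have h5 : 2 * (1 / l) = 2 / l := by ring
    linarith
  have h1 : recipSum n q ≤ (n : ℝ) ^ δ * apSum q (1 + δ) := by
    refine le_trans ?_ (mul_le_mul_of_nonneg_left
      (sum_apPrimes_rpow_le_apSum (n := n) (by linarith)) (by positivity))
    rw [recipSum, Finset.mul_sum]
    refine Finset.sum_le_sum fun p hp => ?_
    obtain ⟨hpn, hpp, -⟩ := mem_apPrimes.mp hp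
    have hp0 : (0 : ℝ) < p := by exact_mod_cast hpp.pos
    have e : (1 : ℝ) / p = (p : ℝ) ^ δ * (p : ℝ) ^ (-(1 + δ)) := by
      rw [← Real.rpow_add hp0, one_div, ← Real.rpow_neg_one]
      congr 1
      ring
    rw [e]
    gcongr
  have h2 := apSum_le (q := q) (s := 1 + δ) (by linarith)
  have h3 := primeL_one_le_log hδ0
  have hlogl : 0 ≤ Real.log l := Real.log_nonneg hn
  have hlq : 0 ≤ Real.log q := Real.log_natCast_nonneg q
  have hLbig : 1 ≤ Real.log n := by
    rw [← hlog]
    linarith [Real.add_one_le_exp l]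
  have h4 : Real.log (1 + 1 / δ) ≤ l + Real.log l + 1 := by
    have e : 1 / δ = l * Real.log n := by rw [hδ, one_div_one_div]
    have h5 : 1 + 1 / δ ≤ 2 * (l * Real.log n) := by
      rw [e]
      nlinarith
    refine (Real.log_le_log (by positivity) h5).trans ?_
    rw [Real.log_mul (by norm_num) (by positivity), Real.log_mul hl0.ne' hL.ne']
    have := Real.log_two_lt_d9
    have e2 : Real.log (Real.log n) = l := rfl
    rw [e2]
    linarith
  have h5 : primeL (1 : DirichletCharacter ℂ 1) (1 + δ) / q.totient ≤
      l / q.totient + (Real.log l + 3) := by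
    have h6 : primeL (1 : DirichletCharacter ℂ 1) (1 + δ) ≤ l + (Real.log l + 3) := by linarith
    calc _ ≤ (l + (Real.log l + 3)) / q.totient := by gcongr
      _ = l / q.totient + (Real.log l + 3) / q.totient := add_div _ _ _
      _ ≤ _ := by
        gcongr
        exact div_le_self (by linarith) hφ
  have h6 : apSum q (1 + δ) ≤ l / q.totient + (Real.log l + Real.log q + 5) := by linarith
  have h7 : (0 : ℝ) ≤ l / q.totient + (Real.log l + Real.log q + 5) := by positivity
  calc recipSum n q ≤ (1 + 2 / l) * (l / q.totient + (Real.log l + Real.log q + 5)) := by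
        exact h1.trans (mul_le_mul hnδ h6 (apSum_nonneg _ _) (by positivity))
    _ = l / q.totient + 2 / q.totient + (1 + 2 / l) * (Real.log l + Real.log q + 5) := by
        field_simp
    _ ≤ l / q.totient + 2 + 3 * (Real.log l + Real.log q + 5) := by
        have : 2 / l ≤ 2 := div_le_self (by norm_num) hn
        gcongr
        · exact div_le_self (by norm_num) hφ
        · linarith
    _ = _ := by ring

lemma le_recipSum_of_one_le_LL {q : ℕ} (hq : IsPrimePow q) {n : ℕ} (hn : 1 ≤ LL n) :
    LL n / q.totient - Real.log (LL n) - 20 * (q : ℝ) ^ 2 - 6 ≤ recipSum n q := by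
  have : NeZero q := ⟨hq.ne_zero⟩
  have hn1 : 1 ≤ n := one_le_of_one_le_LL hn
  have hlog := exp_LL hn
  have hL : 0 < Real.log n := by rw [← hlog]; exact Real.exp_pos _
  set l := LL n with hl
  have hl0 : 0 < l := by linarith
  set δ := l / Real.log n with hδ
  have hδ0 : 0 < δ := by positivity
  have hδ1 : δ ≤ 1 := by
    rw [hδ, div_le_one hL, ← hlog]
    linarith [Real.add_one_le_exp l]
  have hφ : (1 : ℝ) ≤ q.totient := by exact_mod_cast Nat.totient_pos.mpr (NeZero.pos q)
  have htail : (n : ℝ) ^ (-δ) / δ ≤ 1 := by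
    rw [Real.rpow_def_of_pos (by exact_mod_cast hn1), hδ]
    have h1 : Real.log n * -(l / Real.log n) = -l := by field_simp
    rw [h1, Real.exp_neg, hlog]
    have : (Real.log n)⁻¹ / (l / Real.log n) = 1 / l := by field_simp
    rw [this, div_le_one hl0]
    exact hn
  have h1 := apSum_le_sum_apPrimes_add (q := q) hn1 hδ0
  have h2 : ∑ p ∈ apPrimes n q, (p : ℝ) ^ (-(1 + δ)) ≤ recipSum n q := by
    refine Finset.sum_le_sum fun p hp => ?_
    obtain ⟨-, hpp, -⟩ := mem_apPrimes.mp hp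
    rw [one_div, ← Real.rpow_neg_one]
    exact Real.rpow_le_rpow_of_exponent_le (by exact_mod_cast hpp.one_le) (by linarith)
  have h3 := le_apSum hq (s := 1 + δ) (by linarith) (by linarith)
  have h4 := log_le_primeL_one hδ0
  have h5 : Real.log (1 / δ) = l - Real.log l := by
    have e : 1 / δ = Real.log n / l := by rw [hδ, one_div_div]
    rw [e, Real.log_div hL.ne' hl0.ne']
    rfl
  rw [h5] at h4
  have hlogl : 0 ≤ Real.log l := Real.log_nonneg hn
  have h6 : l / q.totient - (Real.log l + 2) ≤
      primeL (1 : DirichletCharacter ℂ 1) (1 + δ) / q.totient := by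
    calc l / q.totient - (Real.log l + 2) ≤ l / q.totient - (Real.log l + 2) / q.totient := by
          gcongr
          exact div_le_self (by linarith) hφ
      _ = (l - (Real.log l + 2)) / q.totient := by ring
      _ ≤ _ := by
        gcongr
        linarith
  linarith

lemma omegaQ_eq_card_filter {m n q : ℕ} (hm : 0 < m) (hmn : m ≤ n) :
    omegaQ m q = ((apPrimes n q).filter (· ∣ m)).card := by
  unfold omegaQ
  congr 1
  ext p
  simp only [Finset.mem_filter, Nat.mem_primeFactors, mem_apPrimes]
  constructor
  · rintro ⟨⟨hp, hpm, -⟩, hq⟩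
    exact ⟨⟨(Nat.le_of_dvd hm hpm).trans hmn, hp, hq⟩, hpm⟩
  · rintro ⟨⟨-, hp, hq⟩, hpm⟩
    exact ⟨⟨hp, hpm, hm.ne'⟩, hq⟩

lemma omegaQ_le_of_dvd {a b : ℕ} (hb : b ≠ 0) (h : a ∣ b) (q : ℕ) : omegaQ a q ≤ omegaQ b q :=
  Finset.card_le_card (Finset.filter_subset_filter _ (Nat.primeFactors_mono h hb))

/-- A Chernoff-type moment bound for `ω(m;q,1)` with a weight `z ≥ 1`. -/
lemma sum_pow_omegaQ_le_of_one_le {z : ℝ} (hz : 1 ≤ z) (n q : ℕ) :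
    ∑ m ∈ Finset.Ioc 0 n, z ^ omegaQ m q ≤ n * Real.exp ((z - 1) * recipSum n q) := by
  have hz0 : 0 ≤ z - 1 := by linarith
  have h1 : ∀ m ∈ Finset.Ioc 0 n, z ^ omegaQ m q = ∑ t ∈ (apPrimes n q).powerset,
      if (∏ p ∈ t, p) ∣ m then (z - 1) ^ t.card else 0 := by
    intro m hm
    obtain ⟨hm0, hmn⟩ := Finset.mem_Ioc.mp hm
    have e : z ^ omegaQ m q = ∏ p ∈ apPrimes n q, (1 + if p ∣ m then z - 1 else 0) := by
      rw [omegaQ_eq_card_filter hm0 hmn, ← Finset.prod_const, Finset.prod_filter]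
      refine Finset.prod_congr rfl fun p _ => ?_
      split_ifs <;> ring
    rw [e, Finset.prod_one_add]
    refine Finset.sum_congr rfl fun t ht => ?_
    have ht' := Finset.mem_powerset.mp ht
    rw [Finset.prod_ite_zero, Finset.prod_const]
    have : (∀ p ∈ t, p ∣ m) ↔ (∏ p ∈ t, p) ∣ m :=
      ⟨fun h => Finset.prod_primes_dvd m (fun p hp => (mem_apPrimes.mp (ht' hp)).2.1.prime) h,
        fun h p hp => (Finset.dvd_prod_of_mem _ hp).trans h⟩
    simp only [this]
  rw [Finset.sum_congr rfl h1, Finset.sum_comm]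
  have h2 : ∀ t ∈ (apPrimes n q).powerset,
      (∑ m ∈ Finset.Ioc 0 n, if (∏ p ∈ t, p) ∣ m then (z - 1) ^ t.card else 0) ≤
        n * ∏ p ∈ t, (z - 1) / (p : ℝ) := by
    intro t _
    rw [← Finset.sum_filter, Finset.sum_const, Nat.Ioc_filter_dvd_card_eq_div, nsmul_eq_mul,
      Finset.prod_div_distrib, Finset.prod_const, ← Nat.cast_prod]
    calc ((n / ∏ p ∈ t, p : ℕ) : ℝ) * (z - 1) ^ t.card
        ≤ (n : ℝ) / (∏ p ∈ t, p : ℕ) * (z - 1) ^ t.card := by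
          gcongr
          exact Nat.cast_div_le
      _ = _ := by ring
  refine (Finset.sum_le_sum h2).trans ?_
  rw [← Finset.mul_sum, ← Finset.prod_one_add]
  gcongr
  rw [recipSum, Finset.mul_sum, Real.exp_sum]
  refine Finset.prod_le_prod (fun p _ => by positivity) fun p _ => ?_
  have := Real.add_one_le_exp ((z - 1) * (1 / (p : ℝ)))
  rw [mul_one_div] at this ⊢
  linarith

lemma sum_one_div_mul_pred_le (n : ℕ) :
    ∑ p ∈ apPrimes n 1, (1 : ℝ) / (p * (p - 1)) ≤ 1 := by
  have h : ∀ N : ℕ, ∑ k ∈ Finset.range N, (1 : ℝ) / ((k + 2) * (k + 1)) ≤ 1 - 1 / (N + 1) := by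
    intro N
    induction N with
    | zero => simp
    | succ N ih =>
      rw [Finset.sum_range_succ]
      have : (1 : ℝ) / ((N + 2) * (N + 1)) = 1 / (N + 1) - 1 / (N + 2) := by
        field_simp
        ring
      push_cast
      rw [this]
      have e : (N : ℝ) + 1 + 1 = N + 2 := by ring
      rw [e]
      linarith
  have h2 : ∑ p ∈ apPrimes n 1, (1 : ℝ) / (p * (p - 1)) ≤
      ∑ k ∈ Finset.range n, (1 : ℝ) / ((k + 2) * (k + 1)) := by
    rw [show (∑ k ∈ Finset.range n, (1 : ℝ) / ((k + 2) * (k + 1))) =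
      ∑ p ∈ (Finset.range n).image (fun k : ℕ => k + 2), (1 : ℝ) / ((p : ℝ) * (p - 1)) by
        rw [Finset.sum_image fun a _ b _ h => Nat.add_right_cancel h]
        refine Finset.sum_congr rfl fun k _ => ?_
        push_cast
        congr 2
        ring]
    refine Finset.sum_le_sum_of_subset_of_nonneg (fun p hp => ?_) fun p hp _ => ?_
    · obtain ⟨h1, h2, -⟩ := mem_apPrimes.mp hp
      have := h2.two_le
      exact Finset.mem_image.mpr ⟨p - 2, Finset.mem_range.mpr (by omega), by omega⟩
    · obtain ⟨k, -, rfl⟩ := Finset.mem_image.mp hp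
      have : (0 : ℝ) ≤ ((k + 2 : ℕ) : ℝ) - 1 := by push_cast; linarith [k.cast_nonneg (α := ℝ)]
      positivity
  have : (0 : ℝ) ≤ 1 / (n + 1) := by positivity
  linarith [h n]

/-- The Euler product bound for the logarithmic average of `z ^ ω(m;q,1)`. -/
lemma sum_pow_omegaQ_div_le {z : ℝ} (hz : 0 < z) (n q : ℕ) :
    ∑ m ∈ Finset.Ioc 0 n, z ^ omegaQ m q / (m : ℝ) ≤
      ∏ p ∈ apPrimes n 1, (1 + (if p % q = 1 % q then z else 1) / ((p : ℝ) - 1)) := by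
  set f : ℕ → ℝ := fun m => z ^ omegaQ m q / (m : ℝ) with hf
  have hf1 : f 1 = 1 := by simp [hf, omegaQ]
  have hmul : ∀ {a b : ℕ}, a.Coprime b → f (a * b) = f a * f b := by
    intro a b hab
    simp only [hf, omegaQ_mul_of_coprime hab q, pow_add, Nat.cast_mul]
    ring
  have hpk : ∀ {p : ℕ}, p.Prime → ∀ k : ℕ,
      f (p ^ (k + 1)) = (if p % q = 1 % q then z else 1) / (p : ℝ) * (1 / (p : ℝ)) ^ k := by
    intro p hp k
    simp only [hf, omegaQ_prime_pow hp k.succ_ne_zero q]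
    have : (p : ℝ) ≠ 0 := by exact_mod_cast hp.ne_zero
    rw [one_div, inv_pow]
    split_ifs
    · push_cast
      field_simp
      ring
    · push_cast
      field_simp
      ring
  have hp1 : ∀ {p : ℕ}, p.Prime → 1 / (p : ℝ) < 1 := by
    intro p hp
    have : (1 : ℝ) < p := by exact_mod_cast hp.one_lt
    rw [div_lt_one (by linarith)]
    exact this
  have hsum : ∀ {p : ℕ}, p.Prime → HasSum (fun k => f (p ^ k))
      (1 + (if p % q = 1 % q then z else 1) / ((p : ℝ) - 1)) := by
    intro p hp
    have h1 := (hasSum_geometric_of_lt_one (r := 1 / (p : ℝ)) (by positivity) (hp1 hp)).mul_left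
      ((if p % q = 1 % q then z else 1) / (p : ℝ))
    have h2 : HasSum (fun k => f (p ^ (k + 1)))
        ((if p % q = 1 % q then z else 1) / ((p : ℝ) - 1)) := by
      simp only [hpk hp]
      have hp2 : (1 : ℝ) < p := by exact_mod_cast hp.one_lt
      have : (p : ℝ) - 1 ≠ 0 := by linarith
      have hp3 : (p : ℝ) ≠ 0 := by linarith
      have e : (if p % q = 1 % q then z else 1) / ((p : ℝ) - 1) =
          (if p % q = 1 % q then z else 1) / (p : ℝ) * (1 - 1 / (p : ℝ))⁻¹ := by
        rw [one_sub_div hp3]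
        field_simp
      rw [e]
      exact h1
    have h3 := (hasSum_nat_add_iff' (f := fun k => f (p ^ k))
      (g := 1 + (if p % q = 1 % q then z else 1) / ((p : ℝ) - 1)) 1).mp
    refine h3 ?_
    simpa [hf1] using h2
  have hf0 : ∀ m, 0 ≤ f m := fun m => by positivity
  obtain ⟨hS, hP⟩ := EulerProduct.summable_and_hasSum_smoothNumbers_prod_primesBelow_tsum hf1 hmul
    (fun {p} hp => by simpa only [Real.norm_of_nonneg (hf0 _)] using (hsum hp).summable) (n + 1)
  have e : (n + 1).primesBelow = apPrimes n 1 := by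
    ext p
    simp only [Nat.mem_primesBelow, mem_apPrimes, Nat.mod_one, and_true]
    rw [Nat.lt_succ_iff]
  rw [e, Finset.prod_congr rfl fun p hp => (hsum (mem_apPrimes.mp hp).2.1).tsum_eq] at hP
  have h4 := sum_le_hasSum (f := fun m : (n + 1).smoothNumbers => f m)
    ((Finset.Ioc 0 n).subtype (· ∈ (n + 1).smoothNumbers)) (fun m _ => hf0 m) hP
  refine le_trans (le_of_eq ?_) h4
  rw [Finset.sum_subtype_of_mem]
  intro m hm
  obtain ⟨h0, h1⟩ := Finset.mem_Ioc.mp hm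
  exact Nat.mem_smoothNumbers_of_lt h0 (by omega)

lemma prod_one_add_le_exp {z : ℝ} (hz : 0 < z) (hz1 : z ≤ 1) (n q : ℕ) :
    ∏ p ∈ apPrimes n 1, (1 + (if p % q = 1 % q then z else 1) / ((p : ℝ) - 1)) ≤
      Real.exp (recipSum n 1 - (1 - z) * recipSum n q + 1) := by
  have h1 : recipSum n q = ∑ p ∈ apPrimes n 1, if p % q = 1 % q then (1 : ℝ) / p else 0 := by
    rw [recipSum, ← Finset.sum_filter]
    refine Finset.sum_congr ?_ fun _ _ => rfl
    ext p
    simp [mem_apPrimes, Nat.mod_one, and_assoc]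
  calc _ ≤ ∏ p ∈ apPrimes n 1, Real.exp (1 / (p : ℝ) -
        (1 - z) * (if p % q = 1 % q then (1 : ℝ) / p else 0) + 1 / ((p : ℝ) * (p - 1))) := by
        have hpos : ∀ p ∈ apPrimes n 1, (1 : ℝ) < p := fun p hp => by
          exact_mod_cast (mem_apPrimes.mp hp).2.1.one_lt
        refine Finset.prod_le_prod (fun p hp => ?_) fun p hp => ?_
        · have := sub_pos.mpr (hpos p hp)
          split_ifs <;> positivity
        · have h2 := hpos p hp
          have h3 := sub_pos.mpr h2
          rw [add_comm]
          refine (Real.add_one_le_exp _).trans (Real.exp_le_exp.mpr ?_)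
          have e : 1 / ((p : ℝ) - 1) = 1 / p + 1 / (p * (p - 1)) := by
            field_simp
            ring
          split_ifs
          · have : z / ((p : ℝ) - 1) = z * (1 / p) + z * (1 / (p * (p - 1))) := by
              rw [← mul_one_div, e]; ring
            rw [this]
            have : z * (1 / ((p : ℝ) * (p - 1))) ≤ 1 * (1 / (p * (p - 1))) := by gcongr
            linarith
          · rw [e]; linarith
    _ = Real.exp (∑ p ∈ apPrimes n 1, (1 / (p : ℝ) -
        (1 - z) * (if p % q = 1 % q then (1 : ℝ) / p else 0) + 1 / ((p : ℝ) * (p - 1)))) :=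
        (Real.exp_sum _ _).symm
    _ ≤ _ := by
        rw [Finset.sum_add_distrib, Finset.sum_sub_distrib, ← Finset.mul_sum, ← h1]
        have := sum_one_div_mul_pred_le n
        have e : recipSum n 1 = ∑ p ∈ apPrimes n 1, (1 : ℝ) / p := rfl
        rw [e]
        gcongr

lemma log_mul_sum_pow_omegaQ_le {z : ℝ} (hz : 0 < z) (hz1 : z ≤ 1) (n q : ℕ) :
    Real.log n * ∑ m ∈ Finset.Ioc 0 n, z ^ omegaQ m q ≤
      7 * n * ∑ m ∈ Finset.Ioc 0 n, z ^ omegaQ m q / (m : ℝ) := by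
  let F : ArithmeticFunction ℝ := ⟨fun m => if m = 0 then 0 else z ^ omegaQ m q, by simp⟩
  have hF : ∀ m, m ≠ 0 → F m = z ^ omegaQ m q := fun m hm => by
    simp [F, hm]
  have hlam : ∀ m ∈ Finset.Ioc 0 n, z ^ omegaQ m q * Real.log m ≤
      (F * ArithmeticFunction.vonMangoldt) m := by
    intro m hm
    obtain ⟨h0, -⟩ := Finset.mem_Ioc.mp hm
    rw [ArithmeticFunction.mul_apply, ← ArithmeticFunction.vonMangoldt_sum, Finset.mul_sum,
      Nat.sum_divisorsAntidiagonal' (f := fun a b => F a * ArithmeticFunction.vonMangoldt b)]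
    refine Finset.sum_le_sum fun d hd => ?_
    have hd' := Nat.dvd_of_mem_divisors hd
    have hmd : m / d ≠ 0 := (Nat.div_pos (Nat.le_of_dvd h0 hd') (Nat.pos_of_dvd_of_pos hd' h0)).ne'
    rw [hF _ hmd]
    exact mul_le_mul_of_nonneg_right (pow_le_pow_of_le_one hz.le hz1
      (omegaQ_le_of_dvd h0.ne' (Nat.div_dvd_of_dvd hd') q)) ArithmeticFunction.vonMangoldt_nonneg
  have h1 : ∑ m ∈ Finset.Ioc 0 n, z ^ omegaQ m q * Real.log m ≤
      6 * n * ∑ m ∈ Finset.Ioc 0 n, z ^ omegaQ m q / (m : ℝ) := by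
    refine (Finset.sum_le_sum hlam).trans ?_
    rw [ArithmeticFunction.sum_Ioc_mul_eq_sum_sum, Finset.mul_sum]
    refine Finset.sum_le_sum fun m hm => ?_
    obtain ⟨h0, -⟩ := Finset.mem_Ioc.mp hm
    have h2 := Chebyshev.psi_le_const_mul_self (x := (n : ℝ) / m) (by positivity)
    rw [Chebyshev.psi, Nat.floor_div_natCast, Nat.floor_natCast] at h2
    have h3 : Real.log 4 + 4 ≤ 6 := by
      have : Real.log 4 = 2 * Real.log 2 := by
        rw [show (4 : ℝ) = 2 ^ 2 by norm_num, Real.log_pow]; norm_num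
      linarith [Real.log_two_lt_d9]
    rw [hF m h0.ne']
    calc _ ≤ z ^ omegaQ m q * (6 * ((n : ℝ) / m)) := by
          gcongr
          exact h2.trans (by gcongr)
      _ = _ := by ring
  have h2 : ∑ m ∈ Finset.Ioc 0 n, z ^ omegaQ m q * (Real.log n - Real.log m) ≤
      n * ∑ m ∈ Finset.Ioc 0 n, z ^ omegaQ m q / (m : ℝ) := by
    rw [Finset.mul_sum]
    refine Finset.sum_le_sum fun m hm => ?_
    obtain ⟨h0, h1⟩ := Finset.mem_Ioc.mp hm
    have h0' : (0 : ℝ) < m := by exact_mod_cast h0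
    have hn : (0 : ℝ) < n := by exact_mod_cast h0.trans_le h1
    rw [← Real.log_div hn.ne' h0'.ne']
    have := Real.log_le_sub_one_of_pos (x := (n : ℝ) / m) (by positivity)
    calc _ ≤ z ^ omegaQ m q * ((n : ℝ) / m) := by gcongr; linarith
      _ = _ := by ring
  have h3 : Real.log n * ∑ m ∈ Finset.Ioc 0 n, z ^ omegaQ m q =
      ∑ m ∈ Finset.Ioc 0 n, z ^ omegaQ m q * Real.log m +
      ∑ m ∈ Finset.Ioc 0 n, z ^ omegaQ m q * (Real.log n - Real.log m) := by
    rw [Finset.mul_sum, ← Finset.sum_add_distrib]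
    refine Finset.sum_congr rfl fun m _ => by ring
  rw [h3]
  linarith

/-- A Chernoff-type moment bound for `ω(m;q,1)` with a weight `0 < z ≤ 1`. -/
lemma sum_pow_omegaQ_le_of_le_one {z : ℝ} (hz : 0 < z) (hz1 : z ≤ 1) {n : ℕ} (hn : 1 ≤ LL n)
    (q : ℕ) :
    ∑ m ∈ Finset.Ioc 0 n, z ^ omegaQ m q ≤
      n * Real.exp (3 * Real.log (LL n) + 20 - (1 - z) * recipSum n q) := by
  have h1 := log_mul_sum_pow_omegaQ_le hz hz1 n q
  have h2 := (sum_pow_omegaQ_div_le hz n q).trans (prod_one_add_le_exp hz hz1 n q)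
  have h3 := recipSum_le_of_one_le_LL (q := 1) hn
  simp only [Nat.totient_one, Nat.cast_one, div_one, Real.log_one, mul_zero, add_zero] at h3
  have hlog := exp_LL hn
  rw [← hlog] at h1
  have h7 : (7 : ℝ) ≤ Real.exp 2 := by
    have := Real.exp_one_gt_d9
    rw [show (2 : ℝ) = 1 + 1 by norm_num, Real.exp_add]
    nlinarith
  have h4 : 7 * n * ∑ m ∈ Finset.Ioc 0 n, z ^ omegaQ m q / (m : ℝ) ≤
      Real.exp (LL n) *
        (n * Real.exp (3 * Real.log (LL n) + 20 - (1 - z) * recipSum n q)) := by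
    calc _ ≤ Real.exp 2 * n * Real.exp (recipSum n 1 - (1 - z) * recipSum n q + 1) := by gcongr
      _ = n * Real.exp (2 + (recipSum n 1 - (1 - z) * recipSum n q + 1)) := by
        rw [Real.exp_add 2]; ring
      _ ≤ n * Real.exp (LL n + (3 * Real.log (LL n) + 20 - (1 - z) * recipSum n q)) := by
        gcongr ?_ * Real.exp ?_
        linarith
      _ = _ := by rw [Real.exp_add (LL n)]; ring
  exact le_of_mul_le_mul_left (h1.trans h4) (Real.exp_pos _)

lemma recipSum_nonneg (n q : ℕ) : 0 ≤ recipSum n q := Finset.sum_nonneg fun _ _ => by positivity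

lemma card_omegaQ_le_le {θ : ℝ} (hθ : 0 ≤ θ) (T : ℝ) {n : ℕ} (hn : 1 ≤ LL n) (q : ℕ) :
    (((Finset.Ioc 0 n).filter fun m => (omegaQ m q : ℝ) ≤ T).card : ℝ) ≤
      n * Real.exp (3 * Real.log (LL n) + 20 + θ * T - (1 - Real.exp (-θ)) * recipSum n q) := by
  have h1 := sum_pow_omegaQ_le_of_le_one (Real.exp_pos (-θ))
    (Real.exp_le_one_iff.mpr (by linarith)) hn q
  have h2 : (((Finset.Ioc 0 n).filter fun m => (omegaQ m q : ℝ) ≤ T).card : ℝ) ≤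
      Real.exp (θ * T) * ∑ m ∈ Finset.Ioc 0 n, Real.exp (-θ) ^ omegaQ m q := by
    rw [Finset.card_filter, Nat.cast_sum, Finset.mul_sum]
    refine Finset.sum_le_sum fun m _ => ?_
    split_ifs with h
    · rw [← Real.exp_nat_mul, ← Real.exp_add, Nat.cast_one, Real.one_le_exp_iff]
      nlinarith
    · rw [Nat.cast_zero]
      positivity
  refine h2.trans ((mul_le_mul_of_nonneg_left h1 (Real.exp_pos _).le).trans (le_of_eq ?_))
  rw [mul_left_comm, ← Real.exp_add]
  congr 2
  ring

lemma card_le_omegaQ_le {θ : ℝ} (hθ : 0 ≤ θ) (T : ℝ) (n q : ℕ) :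
    (((Finset.Ioc 0 n).filter fun m => T ≤ (omegaQ m q : ℝ)).card : ℝ) ≤
      n * Real.exp ((Real.exp θ - 1) * recipSum n q - θ * T) := by
  have h1 := sum_pow_omegaQ_le_of_one_le (Real.one_le_exp hθ) n q
  have h2 : (((Finset.Ioc 0 n).filter fun m => T ≤ (omegaQ m q : ℝ)).card : ℝ) ≤
      Real.exp (-(θ * T)) * ∑ m ∈ Finset.Ioc 0 n, Real.exp θ ^ omegaQ m q := by
    rw [Finset.card_filter, Nat.cast_sum, Finset.mul_sum]
    refine Finset.sum_le_sum fun m _ => ?_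
    split_ifs with h
    · rw [← Real.exp_nat_mul, ← Real.exp_add, Nat.cast_one, Real.one_le_exp_iff]
      nlinarith
    · rw [Nat.cast_zero]
      positivity
  refine h2.trans ((mul_le_mul_of_nonneg_left h1 (Real.exp_pos _).le).trans (le_of_eq ?_))
  rw [mul_left_comm, ← Real.exp_add]
  congr 2
  ring

lemma le_two_mul_totient {q : ℕ} (hq : IsPrimePow q) : q ≤ 2 * q.totient := by
  obtain ⟨p, k, hp, hk, rfl⟩ := (isPrimePow_nat_iff q).mp hq
  rw [Nat.totient_prime_pow hp hk, mul_left_comm]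
  calc p ^ k = p ^ (k - 1) * p := by rw [← pow_succ, Nat.sub_add_cancel hk]
    _ ≤ p ^ (k - 1) * (2 * (p - 1)) := by
      have := hp.two_le
      gcongr
      omega

/-- One quarter of the distance between `l / a` and `l / (a + 1)`. -/
def gap (l a : ℝ) : ℝ := l / (4 * a * (a + 1))

section Gap

variable {l a y : ℝ}

lemma gap_pos (hl : 0 < l) (ha : 1 ≤ a) : 0 < gap l a := by
  unfold gap
  positivity

lemma thousand_mul_sq_le_sqrt (hl : 10 ^ 6 * y ^ 4 ≤ l) : 1000 * y ^ 2 ≤ √l := by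
  refine Real.le_sqrt_of_sq_le ?_
  calc (1000 * y ^ 2) ^ 2 = 10 ^ 6 * y ^ 4 := by ring
    _ ≤ l := hl

lemma le_gap (ha : 1 ≤ a) (hay : a ≤ y) (hy : 2 ≤ y) (hl : 10 ^ 6 * y ^ 4 ≤ l) :
    166 * √l ≤ gap l a := by
  have hy4 : 0 < y ^ 4 := by positivity
  have hl0 : 0 < l := by linarith
  have h1 := thousand_mul_sq_le_sqrt hl
  have hs := Real.mul_self_sqrt hl0.le
  rw [gap, le_div_iff₀ (by positivity)]
  have h2 : 4 * a * (a + 1) ≤ 6 * y ^ 2 := by nlinarith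
  calc 166 * √l * (4 * a * (a + 1)) ≤ 166 * √l * (6 * y ^ 2) := by gcongr
    _ ≤ √l * (1000 * y ^ 2) := by nlinarith [mul_nonneg (Real.sqrt_nonneg l) (sq_nonneg y)]
    _ ≤ √l * √l := by gcongr
    _ = l := hs

lemma log_le_two_mul_sqrt (hl : 0 < l) : Real.log l ≤ 2 * √l := by
  have h := Real.log_le_sub_one_of_pos (Real.sqrt_pos.mpr hl)
  rw [Real.log_sqrt hl.le] at h
  linarith

lemma sq_add_log_le_gap (ha : 1 ≤ a) (hay : a ≤ y) (hy : 2 ≤ y) (hl : 10 ^ 6 * y ^ 4 ≤ l) :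
    80 * a ^ 2 + Real.log l + 6 ≤ gap l a / 2 := by
  have hl0 : 0 < l := lt_of_lt_of_le (by positivity) hl
  have h1 := le_gap ha hay hy hl
  have h2 := log_le_two_mul_sqrt hl0
  have h3 := thousand_mul_sq_le_sqrt hl
  have h4 : a ^ 2 ≤ y ^ 2 := by gcongr
  nlinarith

lemma log_le_gap (ha : 1 ≤ a) (hay : a ≤ y) (hy : 2 ≤ y) (hl : 10 ^ 6 * y ^ 4 ≤ l) :
    15 * Real.log l + 17 ≤ gap l a / 2 := by
  have hl0 : 0 < l := lt_of_lt_of_le (by positivity) hl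
  have h1 := le_gap ha hay hy hl
  have h2 := log_le_two_mul_sqrt hl0
  have h3 := thousand_mul_sq_le_sqrt hl
  nlinarith

lemma rate_le (ha : 1 ≤ a) (hay : a ≤ y) (hy : 2 ≤ y) (hl : 0 < l) :
    l / (576 * y ^ 3) ≤ l / (256 * a * (a + 1) ^ 2) := by
  gcongr l / ?_
  have h1 : a + 1 ≤ 3 / 2 * y := by linarith
  calc 256 * a * (a + 1) ^ 2 ≤ 256 * y * (3 / 2 * y) ^ 2 := by gcongr
    _ = 576 * y ^ 3 := by ring

lemma gap_eq (ha : 1 ≤ a) : l / a - l / (a + 1) = 4 * gap l a := by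
  unfold gap
  field_simp
  ring

end Gap

lemma card_omegaQ_le_sub_gap {q : ℕ} (hq : IsPrimePow q) {y : ℝ} (hy : 2 ≤ y)
    (hqy : (q.totient : ℝ) ≤ y) {n : ℕ} (hn : 10 ^ 6 * y ^ 4 ≤ LL n) :
    (((Finset.Ioc 0 n).filter fun m =>
      (omegaQ m q : ℝ) ≤ LL n / q.totient - gap (LL n) q.totient).card : ℝ) ≤
      n * Real.exp (3 * Real.log (LL n) + 20 - LL n / (576 * y ^ 3)) := by
  have hy4 : (1 : ℝ) ≤ y ^ 4 := one_le_pow₀ (by linarith)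
  have hn1 : 1 ≤ LL n := by linarith
  have ha : (1 : ℝ) ≤ q.totient := by exact_mod_cast Nat.totient_pos.mpr hq.pos
  have hR := le_recipSum_of_one_le_LL hq hn1
  have hq2 : (q : ℝ) ≤ 2 * q.totient := by exact_mod_cast le_two_mul_totient hq
  have hg := sq_add_log_le_gap ha hqy hy hn
  set l := LL n
  set a := (q.totient : ℝ)
  set g := gap l a with hgdef
  set θ := 1 / (16 * (a + 1)) with hθ
  have hθ0 : 0 < θ := by positivity
  have hθ1 : θ ≤ 1 := by rw [hθ, div_le_one (by positivity)]; linarith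
  refine (card_omegaQ_le_le hθ0.le _ hn1 q).trans ?_
  gcongr n * Real.exp ?_
  have hq3 : (q : ℝ) ^ 2 ≤ (2 * a) ^ 2 := by gcongr
  have hR' : l / a - g / 2 ≤ recipSum n q := by nlinarith
  have he : θ - θ ^ 2 ≤ 1 - Real.exp (-θ) := by
    have := (abs_le.mp (Real.abs_exp_sub_one_sub_id_le (x := -θ)
      (by rw [abs_neg, abs_of_pos hθ0]; exact hθ1))).2
    linarith [neg_sq θ]
  have hg0 : 0 < g := gap_pos (by linarith) ha
  have hl0 : 0 < l := by linarith
  have hla : l / a = 4 * g * (a + 1) := by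
    rw [hgdef, gap]
    field_simp
  have h1 : (θ - θ ^ 2) * (l / a - g / 2) ≤ (1 - Real.exp (-θ)) * recipSum n q := by
    refine mul_le_mul he hR' ?_ ?_
    · rw [hla]; nlinarith
    · linarith [Real.exp_le_one_iff.mpr (show -θ ≤ 0 by linarith)]
  have h2 := rate_le (l := l) ha hqy hy hl0
  have h3 : θ * (l / a - g) - (θ - θ ^ 2) * (l / a - g / 2) ≤ - (l / (256 * a * (a + 1) ^ 2)) := by
    have e1 : l / (256 * a * (a + 1) ^ 2) = g * θ / 4 := by
      rw [hgdef, gap, hθ]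
      field_simp
      ring
    have e2 : θ ^ 2 * (l / a) = θ * g / 4 := by
      rw [hla, hθ]
      field_simp
      ring
    rw [e1]
    nlinarith [mul_pos (pow_pos hθ0 2) hg0]
  linarith

section UpperTail

variable {q₁ q₂ : ℕ} {y : ℝ} {n : ℕ}

lemma card_sub_gap_le_omegaQ_of_le (hq₁ : IsPrimePow q₁) (hq₂ : IsPrimePow q₂) (hy : 2 ≤ y)
    (hqy : (q₁.totient : ℝ) ≤ y) (hq : q₁.totient < q₂.totient) (hn : 10 ^ 6 * y ^ 4 ≤ LL n)
    (hq₂n : (q₂ : ℝ) ≤ LL n ^ 4) :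
    (((Finset.Ioc 0 n).filter fun m =>
      LL n / q₁.totient - gap (LL n) q₁.totient - 2 ≤ (omegaQ m q₂ : ℝ)).card : ℝ) ≤
      n * Real.exp (-(LL n / (576 * y ^ 3))) := by
  have hy4 : (1 : ℝ) ≤ y ^ 4 := one_le_pow₀ (by linarith)
  have hn1 : 1 ≤ LL n := by linarith
  have ha : (1 : ℝ) ≤ q₁.totient := by exact_mod_cast Nat.totient_pos.mpr hq₁.pos
  have : NeZero q₂ := ⟨hq₂.ne_zero⟩
  have hR := recipSum_le_of_one_le_LL (q := q₂) hn1
  have hb : (q₁.totient : ℝ) + 1 ≤ q₂.totient := by exact_mod_cast hq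
  have hg := log_le_gap ha hqy hy hn
  have hlq : Real.log q₂ ≤ 4 * Real.log (LL n) := by
    have := Real.log_le_log (by exact_mod_cast hq₂.pos) hq₂n
    rwa [Real.log_pow, Nat.cast_ofNat] at this
  have hlog : 0 ≤ Real.log (LL n) := Real.log_nonneg hn1
  set l := LL n
  set a := (q₁.totient : ℝ)
  set g := gap l a with hgdef
  set θ := 1 / (16 * (a + 1)) with hθ
  have hθ0 : 0 < θ := by positivity
  have hθ1 : θ ≤ 1 := by rw [hθ, div_le_one (by positivity)]; linarith
  refine (card_le_omegaQ_le hθ0.le _ n q₂).trans ?_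
  gcongr n * Real.exp ?_
  have hl0 : 0 < l := by linarith
  have hlb : l / q₂.totient ≤ l / (a + 1) := by gcongr
  have hg0 : 0 < g := gap_pos hl0 ha
  have hge : l / a - l / (a + 1) = 4 * g := gap_eq ha
  have hR' : recipSum n q₂ ≤ l / a - 7 / 2 * g := by linarith
  have hla : l / a = 4 * g * (a + 1) := by
    rw [hgdef, gap]
    field_simp
  have he : Real.exp θ - 1 ≤ θ + θ ^ 2 := by
    have := (abs_le.mp (Real.abs_exp_sub_one_sub_id_le (x := θ)
      (by rw [abs_of_pos hθ0]; exact hθ1))).2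
    linarith
  have h1 : (Real.exp θ - 1) * recipSum n q₂ ≤ (θ + θ ^ 2) * (l / a - 7 / 2 * g) :=
    mul_le_mul he hR' (recipSum_nonneg _ _) (by positivity)
  have h2 := rate_le (l := l) ha hqy hy hl0
  have h3 : (θ + θ ^ 2) * (l / a - 7 / 2 * g) - θ * (l / a - g - 2) ≤
      - (l / (256 * a * (a + 1) ^ 2)) := by
    have e1 : l / (256 * a * (a + 1) ^ 2) = g * θ / 4 := by
      rw [hgdef, gap, hθ]
      field_simp
      ring
    have e2 : θ ^ 2 * (l / a) = θ * g / 4 := by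
      rw [hla, hθ]
      field_simp
      ring
    rw [e1]
    have hg2 : 2 ≤ g := by linarith
    nlinarith [mul_pos (pow_pos hθ0 2) hg0, mul_le_mul_of_nonneg_left hg2 hθ0.le]
  linarith

lemma sqrt_mul_recipSum_le (hq₂ : IsPrimePow q₂) (hn3 : 3 ≤ n) (hn : 1 ≤ LL n)
    (hq₂n : LL n ^ 4 ≤ q₂) : √q₂ * recipSum n q₂ ≤ 90 := by
  have hR := recipSum_le hq₂ hn3
  set t := √(√(q₂ : ℝ)) with ht
  have ht2 : t ^ 2 = √(q₂ : ℝ) := Real.sq_sqrt (Real.sqrt_nonneg _)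
  have ht4 : t ^ 4 = q₂ := by
    rw [show t ^ 4 = (t ^ 2) ^ 2 by ring, ht2, Real.sq_sqrt (Nat.cast_nonneg _)]
  have ht0 : 0 ≤ t := Real.sqrt_nonneg _
  have hl : LL n ≤ t := by
    refine le_of_pow_le_pow_left₀ (n := 4) (by norm_num) ht0 ?_
    rw [ht4]
    exact hq₂n
  have ht1 : 1 ≤ t := hn.trans hl
  have hlog : Real.log (q₂ + 1) ≤ 5 * t := by
    have h1 : (q₂ : ℝ) + 1 ≤ 2 * t ^ 4 := by
      rw [ht4]
      have : (1 : ℝ) ≤ q₂ := by exact_mod_cast hq₂.pos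
      linarith
    refine (Real.log_le_log (by positivity) h1).trans ?_
    rw [Real.log_mul (by norm_num) (by positivity), Real.log_pow]
    have := Real.log_le_sub_one_of_pos (show 0 < t by linarith)
    have := Real.log_two_lt_d9
    push_cast
    linarith
  rw [← ht2]
  calc t ^ 2 * recipSum n q₂ ≤ t ^ 2 * (6 * (5 * t) / t ^ 4 * (t + 2 * t)) := by
        rw [ht4]
        refine mul_le_mul_of_nonneg_left (hR.trans ?_) (by positivity)
        gcongr
        linarith
    _ = 90 := by
        field_simp
        norm_num

lemma card_sub_gap_le_omegaQ_of_ge (hq₁ : IsPrimePow q₁) (hq₂ : IsPrimePow q₂) (hy : 2 ≤ y)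
    (hqy : (q₁.totient : ℝ) ≤ y) (hn3 : 3 ≤ n) (hn : 10 ^ 6 * y ^ 4 ≤ LL n)
    (hq₂n : LL n ^ 4 ≤ q₂) :
    (((Finset.Ioc 0 n).filter fun m =>
      LL n / q₁.totient - gap (LL n) q₁.totient - 2 ≤ (omegaQ m q₂ : ℝ)).card : ℝ) ≤
      n * (Real.exp (90 - LL n / (576 * y ^ 3)) / q₂ ^ 2) := by
  have hy4 : (2 : ℝ) ^ 4 ≤ y ^ 4 := by gcongr
  have hn1 : 10 ^ 7 ≤ LL n := by linarith
  have ha : (1 : ℝ) ≤ q₁.totient := by exact_mod_cast Nat.totient_pos.mpr hq₁.pos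
  have hq0 : (0 : ℝ) < q₂ := by exact_mod_cast hq₂.pos
  have hR := sqrt_mul_recipSum_le hq₂ hn3 (by linarith) hq₂n
  have hlogl : 1 ≤ Real.log (LL n) := by
    rw [← Real.log_exp 1]
    refine Real.log_le_log (Real.exp_pos _) ?_
    linarith [Real.exp_one_lt_d9]
  have hlq : 4 * Real.log (LL n) ≤ Real.log q₂ := by
    have := Real.log_le_log (by positivity) hq₂n
    rwa [Real.log_pow, Nat.cast_ofNat] at this
  have hg := log_le_gap ha hqy hy hn
  have hrate := rate_le (l := LL n) ha hqy hy (by linarith)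
  set l := LL n
  set a := (q₁.totient : ℝ)
  set g := gap l a with hgdef
  have hla : l / a = 4 * g * (a + 1) := by
    rw [hgdef, gap]
    field_simp
  have hg0 : 0 < g := gap_pos (by linarith) ha
  have e1 : l / (256 * a * (a + 1) ^ 2) = g / (64 * (a + 1)) := by
    rw [hgdef, gap]
    field_simp
    ring
  have e2 : g / (64 * (a + 1)) ≤ g := div_le_self hg0.le (by linarith)
  refine (card_le_omegaQ_le (θ := Real.log q₂ / 2) (by linarith) _ n q₂).trans ?_
  gcongr n * ?_
  rw [show ((q₂ : ℝ)) ^ 2 = Real.exp (2 * Real.log q₂) by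
    rw [mul_comm, Real.exp_mul, Real.exp_log hq0, Real.rpow_ofNat], ← Real.exp_sub]
  refine Real.exp_le_exp.mpr ?_
  rw [← Real.log_sqrt hq0.le, Real.exp_log (Real.sqrt_pos.mpr hq0), Real.log_sqrt hq0.le]
  have h0 := recipSum_nonneg n q₂
  have h1 : g ≤ l / a - g - 2 - 4 := by nlinarith
  have h2 : 1 * (l / a - g - 2 - 4) ≤ Real.log q₂ / 2 * (l / a - g - 2 - 4) := by
    gcongr
    · linarith
    · linarith
  nlinarith

lemma card_sub_gap_le_omegaQ (hq₁ : IsPrimePow q₁) (hq₂ : IsPrimePow q₂) (hy : 2 ≤ y)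
    (hqy : (q₁.totient : ℝ) ≤ y) (hq : q₁.totient < q₂.totient) (hn3 : 3 ≤ n)
    (hn : 10 ^ 6 * y ^ 4 ≤ LL n) :
    (((Finset.Ioc 0 n).filter fun m =>
      LL n / q₁.totient - gap (LL n) q₁.totient - 2 ≤ (omegaQ m q₂ : ℝ)).card : ℝ) ≤
      n * (Real.exp (90 + 8 * Real.log (LL n) - LL n / (576 * y ^ 3)) / q₂ ^ 2) := by
  have hy4 : (1 : ℝ) ≤ y ^ 4 := one_le_pow₀ (by linarith)
  have hn1 : 1 ≤ LL n := by linarith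
  have hlog : 0 ≤ Real.log (LL n) := Real.log_nonneg hn1
  have hq0 : (0 : ℝ) < q₂ := by exact_mod_cast hq₂.pos
  rcases le_total (q₂ : ℝ) (LL n ^ 4) with h | h
  · refine (card_sub_gap_le_omegaQ_of_le hq₁ hq₂ hy hqy hq hn h).trans ?_
    gcongr n * ?_
    rw [le_div_iff₀ (by positivity)]
    have h1 : (q₂ : ℝ) ^ 2 ≤ Real.exp (90 + 8 * Real.log (LL n)) := by
      calc (q₂ : ℝ) ^ 2 ≤ (LL n ^ 4) ^ 2 := by gcongr
        _ = Real.exp (8 * Real.log (LL n)) := by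
          rw [mul_comm, Real.exp_mul, Real.exp_log (by linarith), ← pow_mul, Real.rpow_ofNat]
        _ ≤ _ := Real.exp_le_exp.mpr (by linarith)
    rw [sub_eq_add_neg, Real.exp_add, mul_comm]
    gcongr
  · refine (card_sub_gap_le_omegaQ_of_ge hq₁ hq₂ hy hqy hn3 hn h).trans ?_
    gcongr
    linarith

end UpperTail

lemma cnt_eq_card (P : ℕ → Prop) [DecidablePred P] (n : ℕ) :
    cnt P n = ((Finset.Ioc 0 n).filter P).card := by
  rw [cnt, ← Set.ncard_coe_finset]
  congr 1
  ext m
  simp [Nat.succ_le_iff, and_assoc]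

lemma cnt_le (P : ℕ → Prop) (n : ℕ) : cnt P n ≤ n := by
  classical
  rw [cnt_eq_card]
  exact (Finset.card_filter_le _ _).trans (by simp)

lemma cnt_add_cnt_not (P : ℕ → Prop) (n : ℕ) : cnt P n + cnt (fun m => ¬ P m) n = n := by
  classical
  rw [cnt_eq_card, cnt_eq_card, Finset.card_filter_add_card_filter_not]
  simp

lemma cnt_mono {P Q : ℕ → Prop} (h : ∀ m, P m → Q m) (n : ℕ) : cnt P n ≤ cnt Q n := by
  classical
  rw [cnt_eq_card, cnt_eq_card]
  exact Finset.card_le_card (Finset.monotone_filter_right _ fun m _ => h m)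

lemma lt_of_omegaQ_pos {m n q : ℕ} (hq : 1 < q) (hm : 0 < m) (hmn : m ≤ n)
    (h : 0 < omegaQ m q) : q < n := by
  obtain ⟨p, hp⟩ := Finset.card_pos.mp h
  obtain ⟨hp1, hp2⟩ := Finset.mem_filter.mp hp
  have hpp := Nat.prime_of_mem_primeFactors hp1
  have hpm := Nat.le_of_dvd hm (Nat.dvd_of_mem_primeFactors hp1)
  by_contra! hnq
  rcases (hpm.trans (hmn.trans hnq)).lt_or_eq with h | h
  · rw [Nat.mod_eq_of_lt h, Nat.mod_eq_of_lt hq] at hp2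
    exact hpp.one_lt.ne' hp2
  · rw [h, Nat.mod_self, Nat.mod_eq_of_lt hq] at hp2
    exact zero_ne_one hp2

lemma cnt_not_yTypical_le {y : ℝ} {n : ℕ} (hy : 2 ≤ y) (hn3 : 3 ≤ n)
    (hn : 10 ^ 6 * y ^ 4 ≤ LL n) :
    (cnt (fun m => ¬ yTypical y m) n : ℝ) ≤
      n * (6 * y * Real.exp (90 + 8 * Real.log (LL n) - LL n / (576 * y ^ 3))) := by
  classical
  have hy4 : (1 : ℝ) ≤ y ^ 4 := one_le_pow₀ (by linarith)
  have hn1 : 1 ≤ LL n := by linarith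
  have hlog : 0 ≤ Real.log (LL n) := Real.log_nonneg hn1
  set B := Real.exp (90 + 8 * Real.log (LL n) - LL n / (576 * y ^ 3)) with hB
  let S := (Finset.Icc 1 ⌊2 * y⌋₊).filter fun q : ℕ => IsPrimePow q ∧ (q.totient : ℝ) ≤ y
  let A : ℕ → Finset ℕ := fun q => (Finset.Ioc 0 n).filter fun m =>
    (omegaQ m q : ℝ) ≤ LL n / q.totient - gap (LL n) q.totient
  let D : ℕ → ℕ → Finset ℕ := fun q₁ q₂ => (Finset.Ioc 0 n).filter fun m =>
    LL n / q₁.totient - gap (LL n) q₁.totient - 2 ≤ (omegaQ m q₂ : ℝ)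
  let R : ℕ → Finset ℕ := fun q₁ =>
    (Finset.Ioo 0 (n + 1)).filter fun q : ℕ => IsPrimePow q ∧ q₁.totient < q.totient
  have hsub : (Finset.Ioc 0 n).filter (fun m => ¬ yTypical y m) ⊆
      S.biUnion fun q₁ => A q₁ ∪ (R q₁).biUnion (D q₁) := by
    intro m hm
    obtain ⟨hm1, hm2⟩ := Finset.mem_filter.mp hm
    obtain ⟨hm0, hmn⟩ := Finset.mem_Ioc.mp hm1
    unfold yTypical at hm2
    push Not at hm2
    obtain ⟨q₁, q₂, hq₁, hq₂, hqy, hq, hprm⟩ := hm2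
    have ha : (1 : ℝ) ≤ q₁.totient := by exact_mod_cast Nat.totient_pos.mpr hq₁.pos
    have hq2 : (q₁ : ℝ) ≤ 2 * q₁.totient := by exact_mod_cast le_two_mul_totient hq₁
    refine Finset.mem_biUnion.mpr ⟨q₁, Finset.mem_filter.mpr ⟨Finset.mem_Icc.mpr
      ⟨hq₁.pos, Nat.le_floor (by linarith)⟩, hq₁, hqy⟩, ?_⟩
    rw [Finset.mem_union]
    by_cases h : (omegaQ m q₁ : ℝ) ≤ LL n / q₁.totient - gap (LL n) q₁.totient
    · exact Or.inl (Finset.mem_filter.mpr ⟨hm1, h⟩)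
    right
    have h1 : (omegaQ m q₁ : ℝ) ≤ omegaQ m q₂ + 2 := by
      exact_mod_cast (omegaQ_le_prm hq₁ hm0.ne').trans
        (hprm.trans (prm_le_omegaQ_add_two hq₂ hm0.ne'))
    have hg := log_le_gap ha hqy hy hn
    have hla : LL n / q₁.totient = 4 * gap (LL n) q₁.totient * (q₁.totient + 1) := by
      rw [gap]
      field_simp
    have h2 : LL n / q₁.totient - gap (LL n) q₁.totient - 2 ≤ (omegaQ m q₂ : ℝ) := by
      linarith
    have h3 : 0 < omegaQ m q₂ := by
      have : (0 : ℝ) < omegaQ m q₂ := lt_of_lt_of_le (by nlinarith) h2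
      exact_mod_cast this
    have h4 := lt_of_omegaQ_pos hq₂.one_lt hm0 hmn h3
    exact Finset.mem_biUnion.mpr ⟨q₂, Finset.mem_filter.mpr ⟨Finset.mem_Ioo.mpr
      ⟨hq₂.pos, by omega⟩, hq₂, hq⟩, Finset.mem_filter.mpr ⟨hm1, h2⟩⟩
  have hq : ∀ q₁ ∈ S, ((A q₁ ∪ (R q₁).biUnion (D q₁)).card : ℝ) ≤ n * (3 * B) := by
    intro q₁ hS
    obtain ⟨-, hq₁, hqy⟩ := Finset.mem_filter.mp hS
    have h1 : ((A q₁).card : ℝ) ≤ n * B := by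
      refine (card_omegaQ_le_sub_gap hq₁ hy hqy hn).trans ?_
      rw [hB]
      gcongr n * Real.exp ?_
      linarith
    have h2 : (((R q₁).biUnion (D q₁)).card : ℝ) ≤ n * (2 * B) := by
      calc (((R q₁).biUnion (D q₁)).card : ℝ) ≤ ∑ q₂ ∈ R q₁, ((D q₁ q₂).card : ℝ) := by
            exact_mod_cast Finset.card_biUnion_le
        _ ≤ ∑ q₂ ∈ R q₁, n * (B / q₂ ^ 2) := by
            refine Finset.sum_le_sum fun q₂ hR => ?_
            obtain ⟨-, hq₂, hlt⟩ := Finset.mem_filter.mp hR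
            exact card_sub_gap_le_omegaQ hq₁ hq₂ hy hqy hlt hn3 hn
        _ ≤ ∑ q₂ ∈ Finset.Ioo 0 (n + 1), n * (B / (q₂ : ℝ) ^ 2) :=
            Finset.sum_le_sum_of_subset_of_nonneg (Finset.filter_subset _ _)
              fun _ _ _ => by positivity
        _ = n * B * ∑ q₂ ∈ Finset.Ioo 0 (n + 1), ((q₂ : ℝ) ^ 2)⁻¹ := by
            rw [Finset.mul_sum]
            exact Finset.sum_congr rfl fun _ _ => by ring
        _ ≤ n * B * 2 := by
            gcongr
            simpa using sum_Ioo_inv_sq_le (α := ℝ) 0 (n + 1)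
        _ = _ := by ring
    have h3 : ((A q₁ ∪ (R q₁).biUnion (D q₁)).card : ℝ) ≤
        (A q₁).card + ((R q₁).biUnion (D q₁)).card := by
      exact_mod_cast Finset.card_union_le _ _
    linarith
  have hS : (S.card : ℝ) ≤ 2 * y := by
    have h1 : S.card ≤ ⌊2 * y⌋₊ := (Finset.card_filter_le _ _).trans (by simp)
    exact (Nat.cast_le.mpr h1).trans (Nat.floor_le (by linarith))
  rw [cnt_eq_card]
  calc (((Finset.Ioc 0 n).filter fun m => ¬ yTypical y m).card : ℝ)
      ≤ ∑ q₁ ∈ S, ((A q₁ ∪ (R q₁).biUnion (D q₁)).card : ℝ) := by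
        exact_mod_cast (Finset.card_le_card hsub).trans Finset.card_biUnion_le
    _ ≤ ∑ q₁ ∈ S, n * (3 * B) := Finset.sum_le_sum hq
    _ = S.card * (n * (3 * B)) := by rw [Finset.sum_const, nsmul_eq_mul]
    _ ≤ 2 * y * (n * (3 * B)) := by gcongr
    _ = _ := by ring

lemma exists_rpow_mul_exp_le (s : ℝ) :
    ∃ K : ℝ, 0 < K ∧ ∀ w : ℝ, 1 ≤ w → w ^ s * Real.exp (-(w / 576)) ≤ K := by
  set k := ⌈s⌉₊
  refine ⟨576 ^ k * k.factorial, by positivity, fun w hw => ?_⟩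
  have h1 := Real.pow_div_factorial_le_exp (w / 576) (by positivity) k
  rw [div_pow, div_div, div_le_iff₀ (by positivity)] at h1
  have h2 : w ^ s ≤ w ^ k := by
    rw [← Real.rpow_natCast]
    exact Real.rpow_le_rpow_of_exponent_le hw (Nat.le_ceil s)
  calc w ^ s * Real.exp (-(w / 576))
      ≤ Real.exp (w / 576) * (576 ^ k * k.factorial) * Real.exp (-(w / 576)) := by
        gcongr
        exact h2.trans h1
    _ = (Real.exp (w / 576) * Real.exp (-(w / 576))) * (576 ^ k * k.factorial) := by ring
    _ = _ := by rw [← Real.exp_add]; simp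

lemma LL_pos {n : ℕ} (hn : 3 ≤ n) : 0 < LL n := by
  refine Real.log_pos ?_
  rw [Real.lt_log_iff_exp_lt (by positivity)]
  have : (3 : ℝ) ≤ n := by exact_mod_cast hn
  linarith [Real.exp_one_lt_d9]

theorem exists_cnt_not_yTypical_div_le {r : ℝ} (hr : 1 ≤ r) : ∃ C : ℝ, ∀ y : ℝ, 2 ≤ y →
    ∀ n : ℕ, 3 ≤ n → (cnt (fun m => ¬ yTypical y m) n : ℝ) / n ≤ C * y ^ (4 * r) / LL n ^ r := by
  obtain ⟨K, hK0, hK⟩ := exists_rpow_mul_exp_le (36 + r)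
  refine ⟨max ((10 ^ 6) ^ r) (6 * Real.exp 90 * K), fun y hy n hn => ?_⟩
  have hl := LL_pos hn
  have hn0 : (0 : ℝ) < n := by positivity
  have hy0 : 0 < y := by linarith
  have hyr : y ^ (4 * r) = (y ^ 4) ^ r := by
    rw [Real.rpow_mul hy0.le, Real.rpow_ofNat]
  have e : ∀ C : ℝ, C * y ^ (4 * r) / LL n ^ r = C * (LL n / y ^ 4) ^ (-r) := fun C => by
    rw [hyr, Real.rpow_neg (by positivity), Real.div_rpow hl.le (by positivity), inv_div,
      mul_div_assoc]
  rw [e]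
  have hY : 0 < LL n / y ^ 4 := by positivity
  rcases lt_or_ge (LL n) (10 ^ 6 * y ^ 4) with h | h
  · have h1 : (cnt (fun m => ¬ yTypical y m) n : ℝ) / n ≤ 1 := by
      rw [div_le_one hn0]
      exact_mod_cast cnt_le _ n
    refine h1.trans ?_
    have h2 : ((10 : ℝ) ^ 6) ^ (-r) ≤ (LL n / y ^ 4) ^ (-r) := by
      refine Real.rpow_le_rpow_of_nonpos hY ?_ (by linarith)
      rw [div_le_iff₀ (by positivity)]
      exact h.le
    calc (1 : ℝ) = (10 ^ 6) ^ r * (10 ^ 6) ^ (-r) := by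
          rw [← Real.rpow_add (by norm_num)]; simp
      _ ≤ _ := by
          gcongr
          exact le_max_left _ _
  · have hy4 : (1 : ℝ) ≤ y ^ 4 := one_le_pow₀ (by linarith)
    have hy41 : y ^ 4 ≤ LL n := by linarith
    set l := LL n with hldef
    set w := l / y ^ 3 with hw
    have hYw : l / y ^ 4 ≤ w := by
      rw [hw]
      gcongr
      · linarith
      · norm_num
    have hY1 : 1 ≤ l / y ^ 4 := by rwa [le_div_iff₀ (by positivity), one_mul]
    have hw1 : 1 ≤ w := hY1.trans hYw
    have hlw : l ≤ w ^ 4 := by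
      rw [hw, div_pow, le_div_iff₀ (by positivity)]
      calc l * (y ^ 3) ^ 4 = l * (y ^ 4) ^ 3 := by ring
        _ ≤ l * l ^ 3 := by gcongr
        _ = l ^ 4 := by ring
    have hyl : y ≤ l := le_trans (by
      calc y = y ^ 1 := (pow_one y).symm
        _ ≤ y ^ 4 := pow_le_pow_right₀ (by linarith) (by norm_num)) hy41
    have h1 := cnt_not_yTypical_le hy hn h
    have h2 : Real.exp (90 + 8 * Real.log l - l / (576 * y ^ 3)) =
        Real.exp 90 * l ^ 8 * Real.exp (-(w / 576)) := by
      rw [sub_eq_add_neg, Real.exp_add, Real.exp_add]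
      congr 2
      · rw [mul_comm, Real.exp_mul, Real.exp_log hl, Real.rpow_ofNat]
      · rw [hw]
        field_simp
    have h3 : (cnt (fun m => ¬ yTypical y m) n : ℝ) / n ≤
        6 * y * (Real.exp 90 * l ^ 8 * Real.exp (-(w / 576))) := by
      rw [div_le_iff₀ hn0, ← h2, mul_comm]
      exact h1
    refine h3.trans ?_
    have h4 : w ^ (36 : ℕ) * Real.exp (-(w / 576)) ≤ K * (l / y ^ 4) ^ (-r) := by
      have h5 : w ^ (-r) ≤ (l / y ^ 4) ^ (-r) := Real.rpow_le_rpow_of_nonpos hY hYw (by linarith)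
      have h6 : w ^ (36 : ℕ) = w ^ (36 + r) * w ^ (-r) := by
        rw [← Real.rpow_add (by linarith), add_neg_cancel_right, Real.rpow_ofNat]
      calc _ = w ^ (36 + r) * Real.exp (-(w / 576)) * w ^ (-r) := by rw [h6]; ring
        _ ≤ K * (l / y ^ 4) ^ (-r) := by
          gcongr
          exact hK w hw1
    calc 6 * y * (Real.exp 90 * l ^ 8 * Real.exp (-(w / 576)))
        ≤ 6 * l * (Real.exp 90 * l ^ 8 * Real.exp (-(w / 576))) := by gcongr
      _ = 6 * Real.exp 90 * (l ^ 9 * Real.exp (-(w / 576))) := by ring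
      _ ≤ 6 * Real.exp 90 * ((w ^ 4) ^ 9 * Real.exp (-(w / 576))) := by gcongr
      _ = 6 * Real.exp 90 * (w ^ 36 * Real.exp (-(w / 576))) := by rw [← pow_mul]
      _ ≤ 6 * Real.exp 90 * (K * (l / y ^ 4) ^ (-r)) := by gcongr
      _ = 6 * Real.exp 90 * K * (l / y ^ 4) ^ (-r) := by ring
      _ ≤ _ := by
        gcongr
        exact le_max_right _ _

lemma yTypical_of_le {y z : ℝ} (h : y ≤ z) {m : ℕ} (hm : yTypical z m) : yTypical y m :=
  fun q₁ q₂ h₁ h₂ hy hq => hm q₁ q₂ h₁ h₂ (hy.trans h) hq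

lemma tendsto_LL : Tendsto LL atTop atTop :=
  Real.tendsto_log_atTop.comp (Real.tendsto_log_atTop.comp tendsto_natCast_atTop_atTop)

open Asymptotics in
theorem statement15 :
    (∀ r : ℝ, 1 ≤ r → ∃ C : ℝ, ∀ y : ℝ, 2 ≤ y → ∀ n : ℕ, 3 ≤ n →
      (cnt (fun m => ¬ yTypical y m) n : ℝ) / n ≤ C * y ^ (4 * r) / LL n ^ r) ∧
    (∀ y : ℕ → ℝ, (y =o[Filter.atTop] fun n : ℕ => LL n ^ ((1 : ℝ) / 4)) →
      Filter.Tendsto (fun n : ℕ => (cnt (fun m => yTypical (y n) m) n : ℝ) / n)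
        Filter.atTop (nhds 1)) := by
  refine ⟨fun r hr => exists_cnt_not_yTypical_div_le hr, fun y hy => ?_⟩
  obtain ⟨C, hC⟩ := exists_cnt_not_yTypical_div_le le_rfl
  have hrpow : Tendsto (fun n : ℕ => LL n ^ ((1 : ℝ) / 4)) atTop atTop :=
    (tendsto_rpow_atTop (by norm_num)).comp tendsto_LL
  have hz : (fun n => |y n| + 2) =o[atTop] fun n : ℕ => LL n ^ ((1 : ℝ) / 4) := by
    refine hy.abs_left.add ?_
    rw [isLittleO_const_left]
    exact Or.inr (tendsto_norm_atTop_atTop.comp hrpow)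
  have hlim : Tendsto (fun n => C * ((|y n| + 2) / LL n ^ ((1 : ℝ) / 4)) ^ 4) atTop (nhds 0) := by
    simpa using (hz.tendsto_div_nhds_zero.pow 4).const_mul C
  have hnot : Tendsto (fun n : ℕ => (cnt (fun m => ¬ yTypical (y n) m) n : ℝ) / n)
      atTop (nhds 0) := by
    refine squeeze_zero' (Eventually.of_forall fun n => by positivity) ?_ hlim
    filter_upwards [eventually_ge_atTop 3] with n hn
    have hl := LL_pos hn
    have h2 : 2 ≤ |y n| + 2 := by linarith [abs_nonneg (y n)]
    calc (cnt (fun m => ¬ yTypical (y n) m) n : ℝ) / n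
        ≤ (cnt (fun m => ¬ yTypical (|y n| + 2) m) n : ℝ) / n := by
          gcongr
          exact cnt_mono (fun m hm h => hm (yTypical_of_le (by linarith [le_abs_self (y n)]) h)) n
      _ ≤ _ := hC _ h2 n hn
      _ = _ := by
          rw [mul_one, Real.rpow_one, Real.rpow_ofNat, div_pow, ← Real.rpow_mul_natCast hl.le]
          norm_num [mul_div_assoc]
  have hone := hnot.const_sub 1
  rw [sub_zero] at hone
  refine hone.congr' ?_
  filter_upwards [eventually_ge_atTop 1] with n hn
  have hn0 : (n : ℝ) ≠ 0 := by positivity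
  have h : (cnt (fun m => yTypical (y n) m) n : ℝ) + cnt (fun m => ¬ yTypical (y n) m) n = n := by
    exact_mod_cast cnt_add_cnt_not _ n
  rw [eq_div_iff hn0, sub_mul, div_mul_cancel₀ _ hn0]
  linarith

end
end

section
/- For every integer m ≥ 1 and every prime power p^α, the cardinality of the subgroup {x ∈ (ℤ/mℤ)^× : x^p = 1 and x = y^{p^{α−1}} for some y ∈ (ℤ/mℤ)^×} of (ℤ/mℤ)^× equals p^{ω(m;p^α,1) + Ē(m;p^α)}; that is, prm(m;p^α) = ω(m;p^α,1) + Ē(m;p^α). In particular, prm(m;p^α) ≤ prm(m;2) for every prime power p^α. -/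
open MeasureTheory ProbabilityTheory Filter

noncomputable section

/-- The number of `p`-torsion elements of `G` that are `p ^ (α - 1)`-th powers. -/
def torsionPowCard (G : Type*) [Monoid G] (p α : ℕ) : ℕ :=
  Nat.card {x : G // x ^ p = 1 ∧ ∃ y : G, y ^ p ^ (α - 1) = x}

theorem torsionPowCard_congr {G H : Type*} [Monoid G] [Monoid H] (e : G ≃* H) (p α : ℕ) :
    torsionPowCard G p α = torsionPowCard H p α := by
  refine Nat.card_congr (e.toEquiv.subtypeEquiv fun x => and_congr ?_ ?_)
  · simp [← map_pow]
  · rw [← e.toEquiv.exists_congr_right]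
    simp [← map_pow]

theorem torsionPowCard_prod (G H : Type*) [Monoid G] [Monoid H] (p α : ℕ) :
    torsionPowCard (G × H) p α = torsionPowCard G p α * torsionPowCard H p α := by
  rw [torsionPowCard, torsionPowCard, torsionPowCard, ← Nat.card_prod]
  refine Nat.card_congr ((Equiv.subtypeEquivRight fun x => ?_).trans Equiv.subtypeProdEquivProd)
  simp only [Prod.ext_iff, Prod.exists, Prod.pow_fst, Prod.pow_snd, Prod.fst_one, Prod.snd_one]
  constructor
  · rintro ⟨⟨h₁, h₂⟩, a, b, h₃, h₄⟩
    exact ⟨⟨h₁, a, h₃⟩, h₂, b, h₄⟩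
  · rintro ⟨⟨h₁, a, h₃⟩, h₂, b, h₄⟩
    exact ⟨⟨h₁, h₂⟩, a, b, h₃, h₄⟩

theorem torsionPowCard_of_not_dvd {G : Type*} [Group G] {p α : ℕ} (hp : p.Prime) (hα : 1 ≤ α)
    (h : ¬ p ^ α ∣ Nat.card G) : torsionPowCard G p α = 1 := by
  refine Nat.card_eq_one_iff_exists.mpr ⟨⟨1, one_pow _, 1, one_pow _⟩, ?_⟩
  rintro ⟨x, hx, y, rfl⟩
  have hy : y ^ p ^ α = 1 := by
    rw [← pow_mul, ← pow_succ, Nat.sub_add_cancel hα] at hx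
    exact hx
  obtain ⟨k, hk, hky⟩ := (Nat.dvd_prime_pow hp).mp (orderOf_dvd_of_pow_eq_one hy)
  have hk' : k ≠ α := by
    rintro rfl
    exact h (hky ▸ orderOf_dvd_natCard y)
  refine Subtype.ext (orderOf_dvd_iff_pow_eq_one.mp ?_)
  rw [hky]
  exact pow_dvd_pow _ (by lia)

theorem torsionPowCard_of_isCyclic {G : Type*} [Group G] [Finite G] [IsCyclic G] {p α : ℕ}
    (hp : p.Prime) (hα : 1 ≤ α) (h : p ^ α ∣ Nat.card G) : torsionPowCard G p α = p := by
  obtain ⟨g, hg⟩ := IsCyclic.exists_generator (α := G)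
  have hg' : orderOf g = Nat.card G := orderOf_eq_card_of_forall_mem_zpowers hg
  have hpG : p ∣ Nat.card G := (dvd_pow_self p (by lia)).trans h
  have key (x : G) : (x ^ p = 1 ∧ ∃ y : G, y ^ p ^ (α - 1) = x) ↔
      x ∈ Subgroup.zpowers (g ^ (Nat.card G / p)) := by
    constructor
    · rintro ⟨hx, -⟩
      obtain ⟨i, rfl⟩ := Subgroup.mem_zpowers_iff.mp (hg x)
      rw [← zpow_natCast, ← zpow_mul, ← orderOf_dvd_iff_zpow_eq_one, hg'] at hx
      obtain ⟨n, hn⟩ := hpG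
      rw [hn, Nat.mul_div_cancel_left _ hp.pos]
      rw [hn, Nat.cast_mul, mul_comm,
        mul_dvd_mul_iff_right (by exact_mod_cast hp.ne_zero)] at hx
      obtain ⟨j, rfl⟩ := hx
      exact Subgroup.mem_zpowers_iff.mpr ⟨j, by rw [← zpow_natCast, ← zpow_mul]⟩
    · intro hx
      obtain ⟨j, rfl⟩ := Subgroup.mem_zpowers_iff.mp hx
      constructor
      · rw [← zpow_natCast, zpow_comm, zpow_natCast, ← pow_mul, Nat.div_mul_cancel hpG,
          ← hg', pow_orderOf_eq_one, one_zpow]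
      · obtain ⟨n, hn⟩ := h
        have : Nat.card G / p = n * p ^ (α - 1) := by
          refine Nat.div_eq_of_eq_mul_left hp.pos ?_
          rw [hn, mul_assoc, ← pow_succ, Nat.sub_add_cancel hα, mul_comm]
        refine ⟨(g ^ n) ^ j, ?_⟩
        rw [this, pow_mul, ← zpow_natCast, zpow_comm, zpow_natCast]
  calc torsionPowCard G p α = Nat.card (Subgroup.zpowers (g ^ (Nat.card G / p))) :=
        Nat.card_congr (Equiv.subtypeEquivRight key)
    _ = p := by
      rw [Nat.card_zpowers, orderOf_pow, hg', Nat.gcd_eq_right (Nat.div_dvd_of_dvd hpG),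
        Nat.div_div_self hpG Nat.card_pos.ne']

theorem torsionPowCard_units_mul {a b : ℕ} (h : a.Coprime b) (p α : ℕ) :
    torsionPowCard (ZMod (a * b))ˣ p α =
      torsionPowCard (ZMod a)ˣ p α * torsionPowCard (ZMod b)ˣ p α := by
  rw [← torsionPowCard_prod]
  exact torsionPowCard_congr
    ((Units.mapEquiv (ZMod.chineseRemainder h).toMulEquiv).trans MulEquiv.prodUnits) p α

/-- The unit group of `ℤ/2^(n+3)` is the internal direct product of `⟨-1⟩` and `⟨5⟩`. -/
theorem ZMod.exists_units_two_pow_equiv (n : ℕ) :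
    ∃ H K : Subgroup (ZMod (2 ^ (n + 3)))ˣ, IsCyclic H ∧ IsCyclic K ∧
      Nat.card H = 2 ∧ Nat.card K = 2 ^ (n + 1) ∧
      Nonempty (H × K ≃* (ZMod (2 ^ (n + 3)))ˣ) := by
  have h4 : 4 ∣ 2 ^ (n + 3) := by
    exact pow_dvd_pow 2 (show 2 ≤ n + 3 by lia)
  have h5 : orderOf (5 : ZMod (2 ^ (n + 3))) = 2 ^ (n + 1) := ZMod.orderOf_five (n + 1)
  let r : (ZMod (2 ^ (n + 3)))ˣ →* (ZMod 4)ˣ := ZMod.unitsMap h4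
  have hr1 : r (-1) ≠ 1 := by
    have : r (-1) = -1 := Units.ext (by simp [r, ZMod.unitsMap_def])
    rw [this]
    decide
  let v : (ZMod (2 ^ (n + 3)))ˣ :=
    Units.ofPowEqOne (5 : ZMod (2 ^ (n + 3))) (2 ^ (n + 1))
      (by rw [← h5, pow_orderOf_eq_one]) (by positivity)
  have hv : orderOf v = 2 ^ (n + 1) := by
    rw [← orderOf_units, ← h5]
    rfl
  have hrv : r v = 1 := by
    refine Units.ext ?_
    have : ((r v : (ZMod 4)ˣ) : ZMod 4) = ZMod.castHom h4 (ZMod 4) 5 := rfl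
    rw [this, map_ofNat]
    decide
  have hu : orderOf (-1 : (ZMod (2 ^ (n + 3)))ˣ) = 2 := by
    refine orderOf_eq_prime (by simp) fun h => hr1 ?_
    rw [h, map_one]
  refine ⟨Subgroup.zpowers (-1), Subgroup.zpowers v, inferInstance, inferInstance,
    by rw [Nat.card_zpowers, hu], by rw [Nat.card_zpowers, hv], ⟨?_⟩⟩
  let f : Subgroup.zpowers (-1 : (ZMod (2 ^ (n + 3)))ˣ) × Subgroup.zpowers v →*
      (ZMod (2 ^ (n + 3)))ˣ :=
    (Subgroup.zpowers (-1 : (ZMod (2 ^ (n + 3)))ˣ)).subtype.coprod (Subgroup.zpowers v).subtype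
  refine MulEquiv.ofBijective f ((Nat.bijective_iff_injective_and_card f).mpr ⟨?_, ?_⟩)
  · rw [injective_iff_map_eq_one]
    rintro ⟨⟨a, ha⟩, ⟨b, hb⟩⟩ hab
    replace hab : a * b = 1 := hab
    have hrb : r b = 1 := by
      obtain ⟨j, rfl⟩ := Subgroup.mem_zpowers_iff.mp hb
      rw [map_zpow, hrv, one_zpow]
    have hra : r a = 1 := by simpa [hrb] using congrArg r hab
    have ha1 : a = 1 := by
      obtain ⟨j, rfl⟩ := Subgroup.mem_zpowers_iff.mp ha
      rcases Int.even_or_odd j with hj | hj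
      · exact hj.neg_one_zpow
      · rw [hj.neg_one_zpow] at hra
        exact absurd hra hr1
    rw [ha1, one_mul] at hab
    simp [ha1, hab]
  · rw [Nat.card_prod, Nat.card_zpowers, Nat.card_zpowers, hu, hv, Nat.card_eq_fintype_card,
      ZMod.card_units_eq_totient, Nat.totient_prime_pow Nat.prime_two (by lia)]
    simp [pow_succ]
    ring

theorem card_units_prime_pow {r n : ℕ} (hr : r.Prime) (hn : 0 < n) :
    Nat.card (ZMod (r ^ n))ˣ = r ^ (n - 1) * (r - 1) := by
  have := NeZero.mk (pow_ne_zero n hr.ne_zero)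
  rw [Nat.card_eq_fintype_card, ZMod.card_units_eq_totient, Nat.totient_prime_pow hr hn]

theorem omegaQ_mul {a b : ℕ} (h : a.Coprime b) (q : ℕ) (ha : a ≠ 0) (hb : b ≠ 0) :
    omegaQ (a * b) q = omegaQ a q + omegaQ b q := by
  rw [omegaQ, Nat.primeFactors_mul ha hb, Finset.filter_union, Finset.card_union_of_disjoint]
  · rfl
  · exact Finset.disjoint_filter_filter h.disjoint_primeFactors

theorem omegaQ_prime_pow_s16 {r n : ℕ} (hr : r.Prime) (hn : 0 < n) (q : ℕ) :
    omegaQ (r ^ n) q = if q ∣ r - 1 then 1 else 0 := by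
  rw [omegaQ, Nat.primeFactors_prime_pow hn.ne' hr, Finset.filter_singleton, apply_ite Finset.card]
  have : r % q = 1 % q ↔ q ∣ r - 1 := by
    rw [← Nat.modEq_iff_dvd' hr.one_le]
    exact eq_comm
  simp [this]

theorem Nat.Coprime.prime_pow_dvd_mul {a b p k : ℕ} (h : a.Coprime b) (hp : p.Prime) :
    p ^ k ∣ a * b ↔ p ^ k ∣ a ∨ p ^ k ∣ b := by
  rcases Nat.eq_zero_or_pos k with rfl | hk
  · simp
  · exact h.isPrimePow_dvd_mul (hp.isPrimePow.pow hk.ne')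

theorem not_prime_pow_dvd_and {a b p k : ℕ} (h : a.Coprime b) (hp : p.Prime) (hk : k ≠ 0)
    {l : ℕ} (hl : l ≠ 0) : ¬ (p ^ k ∣ a ∧ p ^ l ∣ b) := fun ⟨h₁, h₂⟩ =>
  Nat.not_coprime_of_dvd_of_dvd hp.one_lt ((dvd_pow_self p hk).trans h₁)
    ((dvd_pow_self p hl).trans h₂) h

theorem pow_eq_two_iff {p α : ℕ} (hp : p.Prime) : p ^ α = 2 ↔ p = 2 ∧ α = 1 := by
  constructor
  · intro h
    have hα := (Nat.Prime.eq_one_of_pow (h ▸ Nat.prime_two))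
    subst hα
    exact ⟨by simpa using h, rfl⟩
  · rintro ⟨rfl, rfl⟩
    rfl

theorem Ebar_two_one (m : ℕ) :
    Ebar m 2 1 = if 2 ^ 3 ∣ m then 2 else if 2 ^ 2 ∣ m then 1 else 0 := by
  norm_num [Ebar]
  grind

theorem Ebar_two {α : ℕ} (hα : 2 ≤ α) (m : ℕ) : Ebar m 2 α = if 2 ^ (α + 2) ∣ m then 1 else 0 := by
  have : 2 ^ α ≠ 2 := fun h => by
    have := (pow_eq_two_iff Nat.prime_two).mp h
    lia
  simp [Ebar, this, hα]

theorem Ebar_odd {p : ℕ} (hp : p.Prime) (hp2 : p ≠ 2) (m α : ℕ) :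
    Ebar m p α = if p ^ (α + 1) ∣ m then 1 else 0 := by
  have : p ^ α ≠ 2 := fun h => hp2 ((pow_eq_two_iff hp).mp h).1
  simp [Ebar, this, hp2]

theorem Ebar_mul {a b p α : ℕ} (h : a.Coprime b) (hp : p.Prime) (hα : 1 ≤ α) :
    Ebar (a * b) p α = Ebar a p α + Ebar b p α := by
  by_cases hp2 : p = 2
  · subst hp2
    rcases hα.eq_or_lt with rfl | hα
    · have h33 := not_prime_pow_dvd_and h hp (k := 3) (l := 3) (by lia) (by lia)
      have h22 := not_prime_pow_dvd_and h hp (k := 2) (l := 2) (by lia) (by lia)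
      have h23 := not_prime_pow_dvd_and h hp (k := 2) (l := 3) (by lia) (by lia)
      have h32 := not_prime_pow_dvd_and h hp (k := 3) (l := 2) (by lia) (by lia)
      simp only [Ebar_two_one, h.prime_pow_dvd_mul hp]
      split_ifs <;> tauto
    · have := not_prime_pow_dvd_and h hp (k := α + 2) (l := α + 2) (by lia) (by lia)
      simp only [Ebar_two hα, h.prime_pow_dvd_mul hp]
      split_ifs <;> tauto
  · have := not_prime_pow_dvd_and h hp (k := α + 1) (l := α + 1) (by lia) (by lia)
    simp only [Ebar_odd hp hp2, h.prime_pow_dvd_mul hp]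
    split_ifs <;> tauto

theorem torsionPowCard_units_odd_prime_pow {r n p α : ℕ} (hr : r.Prime) (hr2 : r ≠ 2)
    (hn : 0 < n) (hp : p.Prime) (hα : 1 ≤ α) :
    torsionPowCard (ZMod (r ^ n))ˣ p α = p ^ (omegaQ (r ^ n) (p ^ α) + Ebar (r ^ n) p α) := by
  have := NeZero.mk (pow_ne_zero n hr.ne_zero)
  have := ZMod.isCyclic_units_of_prime_pow r hr hr2 n
  have key : p ^ (omegaQ (r ^ n) (p ^ α) + Ebar (r ^ n) p α) =
      if p ^ α ∣ Nat.card (ZMod (r ^ n))ˣ then p else 1 := by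
    rw [card_units_prime_pow hr hn, omegaQ_prime_pow_s16 hr hn]
    by_cases hpr : p = r
    · subst hpr
      have hcop : (p ^ α).Coprime (p - 1) :=
        ((Nat.coprime_self_sub_right hp.one_le).mpr (Nat.coprime_one_right p)).pow_left α
      have hnd : ¬ p ^ α ∣ p - 1 := fun h =>
        (Nat.one_lt_pow (by lia) hp.one_lt).ne' (hcop.eq_one_of_dvd h)
      rw [Ebar_odd hp hr2, if_neg hnd]
      have : α + 1 ≤ n ↔ α ≤ n - 1 := by lia
      simp only [hcop.dvd_mul_right, Nat.pow_dvd_pow_iff_le_right hp.one_lt, this]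
      split_ifs <;> simp
    · have hcop (k : ℕ) : (p ^ k).Coprime (r ^ n) :=
        ((Nat.coprime_primes hp hr).mpr hpr).pow k n
      have hE : Ebar (r ^ n) p α = 0 := by
        have hnd (k : ℕ) (hk : k ≠ 0) : ¬ p ^ k ∣ r ^ n := fun h =>
          (Nat.one_lt_pow hk hp.one_lt).ne' ((hcop k).eq_one_of_dvd h)
        by_cases hp2 : p = 2
        · subst hp2
          rcases hα.eq_or_lt with rfl | hα
          · rw [Ebar_two_one, if_neg (hnd _ (by lia)), if_neg (hnd _ (by lia))]
          · rw [Ebar_two hα, if_neg (hnd _ (by lia))]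
        · rw [Ebar_odd hp hp2, if_neg (hnd _ (by lia))]
      have hcop' : (p ^ α).Coprime (r ^ (n - 1)) :=
        ((Nat.coprime_primes hp hr).mpr hpr).pow _ _
      simp only [hE, hcop'.dvd_mul_left]
      split_ifs <;> simp
  rw [key]
  split_ifs with h
  · exact torsionPowCard_of_isCyclic hp hα h
  · exact torsionPowCard_of_not_dvd hp hα h

theorem torsionPowCard_units_two_pow {n p α : ℕ} (hn : 0 < n) (hp : p.Prime) (hα : 1 ≤ α) :
    torsionPowCard (ZMod (2 ^ n))ˣ p α = p ^ (omegaQ (2 ^ n) (p ^ α) + Ebar (2 ^ n) p α) := by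
  have hcard := card_units_prime_pow Nat.prime_two hn
  have hω : omegaQ (2 ^ n) (p ^ α) = 0 := by
    rw [omegaQ_prime_pow_s16 Nat.prime_two hn, if_neg]
    intro h
    exact (Nat.one_lt_pow (by lia) hp.one_lt).ne' (Nat.dvd_one.mp h)
  rw [hω, zero_add]
  by_cases hp2 : p = 2
  · subst hp2
    obtain rfl | rfl | ⟨n, rfl⟩ : n = 1 ∨ n = 2 ∨ ∃ k, n = k + 3 := by
      rcases n with _ | _ | _ | n
      · lia
      · simp
      · simp
      · exact Or.inr (Or.inr ⟨n, rfl⟩)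
    · have hE : Ebar (2 ^ 1) 2 α = 0 := by
        rcases hα.eq_or_lt with rfl | hα
        · rw [Ebar_two_one]
          norm_num
        · rw [Ebar_two hα, if_neg]
          rw [Nat.pow_dvd_pow_iff_le_right (by lia)]
          lia
      rw [hE, torsionPowCard_of_not_dvd hp hα, pow_zero]
      rw [hcard]
      simp
      lia
    · have hc : Nat.card (ZMod (2 ^ 2))ˣ = 2 := by simpa using hcard
      have : IsCyclic (ZMod (2 ^ 2))ˣ := isCyclic_of_prime_card hc
      rcases hα.eq_or_lt with rfl | hα
      · rw [Ebar_two_one, torsionPowCard_of_isCyclic hp le_rfl (by rw [hc, pow_one])]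
        norm_num
      · rw [Ebar_two hα, if_neg, torsionPowCard_of_not_dvd hp hα.le, pow_zero]
        · rw [hc, ← pow_one 2, ← pow_mul, Nat.pow_dvd_pow_iff_le_right (by lia)]
          lia
        · rw [Nat.pow_dvd_pow_iff_le_right (by lia)]
          lia
    · obtain ⟨H, K, _, _, hH, hK, ⟨e⟩⟩ := ZMod.exists_units_two_pow_equiv n
      rw [← torsionPowCard_congr e, torsionPowCard_prod]
      rcases hα.eq_or_lt with rfl | hα
      · rw [Ebar_two_one, if_pos (pow_dvd_pow 2 (by lia)),
          torsionPowCard_of_isCyclic hp le_rfl (by simp [hH]),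
          torsionPowCard_of_isCyclic hp le_rfl (by rw [hK]; exact pow_dvd_pow 2 (by lia))]
        rfl
      · rw [Ebar_two hα, torsionPowCard_of_not_dvd (G := H) hp hα.le, one_mul]
        · split_ifs with h <;> rw [Nat.pow_dvd_pow_iff_le_right (by lia)] at h
          · rw [torsionPowCard_of_isCyclic hp hα.le (by rw [hK]; exact pow_dvd_pow 2 (by lia)),
              pow_one]
          · rw [torsionPowCard_of_not_dvd hp hα.le, pow_zero]
            rw [hK, Nat.pow_dvd_pow_iff_le_right (by lia)]
            lia
        · rw [hH]
          intro h
          have := (Nat.pow_dvd_pow_iff_le_right (x := 2) (l := 1) (by lia)).mp (by simpa using h)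
          lia
  · have hcop (k l : ℕ) (hk : k ≠ 0) : ¬ p ^ k ∣ 2 ^ l := fun h =>
      (Nat.one_lt_pow hk hp.one_lt).ne'
        ((((Nat.coprime_primes hp Nat.prime_two).mpr hp2).pow k l).eq_one_of_dvd h)
    rw [Ebar_odd hp hp2, if_neg (hcop _ _ (by lia)), torsionPowCard_of_not_dvd hp hα, pow_zero]
    rw [hcard, Nat.add_one_sub_one, mul_one]
    exact hcop _ _ (by lia)

theorem torsionPowCard_units {m p α : ℕ} (hm : 1 ≤ m) (hp : p.Prime) (hα : 1 ≤ α) :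
    torsionPowCard (ZMod m)ˣ p α = p ^ (omegaQ m (p ^ α) + Ebar m p α) := by
  induction m using Nat.recOnPosPrimePosCoprime with
  | prime_pow r n hr hn =>
    by_cases hr2 : r = 2
    · subst hr2
      exact torsionPowCard_units_two_pow hn hp hα
    · exact torsionPowCard_units_odd_prime_pow hr hr2 hn hp hα
  | zero => lia
  | one =>
    have h := Ebar_mul (Nat.coprime_one_left 1) hp hα
    rw [mul_one, left_eq_add] at h
    rw [h, torsionPowCard_of_not_dvd hp hα]
    · simp [omegaQ]
    · rw [Nat.card_unique, Nat.dvd_one]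
      exact (Nat.one_lt_pow (by lia) hp.one_lt).ne'
  | coprime a b ha hb hab iha ihb =>
    rw [torsionPowCard_units_mul hab, iha ha.le, ihb hb.le, Ebar_mul hab hp hα,
      omegaQ_mul hab _ (by lia) (by lia), ← pow_add]
    congr 1
    ring

theorem prm_prime_pow {m p α : ℕ} (hm : 1 ≤ m) (hp : p.Prime) (hα : 1 ≤ α) :
    prm m (p ^ α) = omegaQ m (p ^ α) + Ebar m p α := by
  have hq : p ^ α / p = p ^ (α - 1) := by
    rw [← Nat.pow_div hα hp.pos, pow_one]
  rw [prm, hp.pow_minFac (by lia), hq]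
  change (torsionPowCard (ZMod m)ˣ p α).factorization p = _
  rw [torsionPowCard_units hm hp hα, hp.factorization_pow, Finsupp.single_eq_same]

theorem omegaQ_add_Ebar_le {m p α : ℕ} (hm : 1 ≤ m) (hp : p.Prime) (hα : 1 ≤ α) :
    omegaQ m (p ^ α) + Ebar m p α ≤ omegaQ m 2 + Ebar m 2 1 := by
  have hsub : (m.primeFactors.filter fun r => r % p ^ α = 1 % p ^ α) ⊆
      m.primeFactors.filter fun r => r % 2 = 1 % 2 := by
    intro r hr
    rw [Finset.mem_filter] at hr ⊢
    refine ⟨hr.1, (Nat.prime_of_mem_primeFactors hr.1).mod_two_eq_one_iff_ne_two.mpr ?_⟩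
    rintro rfl
    have h1 : p ^ α ∣ 2 - 1 := (Nat.modEq_iff_dvd' (by lia)).mp hr.2.symm
    exact (Nat.one_lt_pow (by lia) hp.one_lt).ne' (Nat.dvd_one.mp h1)
  by_cases hp2 : p = 2
  · subst hp2
    refine Nat.add_le_add (Finset.card_le_card hsub) ?_
    rcases hα.eq_or_lt with rfl | hα
    · rfl
    · rw [Ebar_two hα, Ebar_two_one]
      split_ifs with h
      · lia
      · exact absurd ((pow_dvd_pow 2 (by lia)).trans h) ‹¬ 2 ^ 3 ∣ m›
      · exact absurd ((pow_dvd_pow 2 (by lia)).trans h) ‹¬ 2 ^ 3 ∣ m›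
      all_goals lia
  · rw [Ebar_odd hp hp2]
    split_ifs with h
    · refine Nat.le_add_right_of_le (Finset.card_lt_card (Finset.ssubset_iff_subset_ne.mpr
        ⟨hsub, fun heq => ?_⟩))
      have hmem : p ∈ m.primeFactors.filter fun r => r % 2 = 1 % 2 :=
        Finset.mem_filter.mpr ⟨Nat.mem_primeFactors.mpr
          ⟨hp, (dvd_pow_self p (by lia)).trans h, by lia⟩,
          hp.mod_two_eq_one_iff_ne_two.mpr hp2⟩
      rw [← heq, Finset.mem_filter] at hmem
      have h1 : p ^ α ∣ p - 1 := (Nat.modEq_iff_dvd' hp.one_le).mp hmem.2.symm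
      have := Nat.le_of_dvd (Nat.sub_pos_of_lt hp.one_lt) ((dvd_pow_self p (by lia)).trans h1)
      have := hp.pos
      lia
    · exact Nat.le_add_right_of_le (Finset.card_le_card hsub)

theorem statement16 (m : ℕ) (hm : 1 ≤ m) (p α : ℕ) (hp : p.Prime) (hα : 1 ≤ α) :
    Nat.card {x : (ZMod m)ˣ // x ^ p = 1 ∧ ∃ y : (ZMod m)ˣ, y ^ p ^ (α - 1) = x}
        = p ^ (omegaQ m (p ^ α) + Ebar m p α) ∧
      prm m (p ^ α) = omegaQ m (p ^ α) + Ebar m p α ∧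
      prm m (p ^ α) ≤ prm m 2 := by
  refine ⟨torsionPowCard_units hm hp hα, prm_prime_pow hm hp hα, ?_⟩
  have h2 := prm_prime_pow hm Nat.prime_two le_rfl
  rw [pow_one] at h2
  rw [prm_prime_pow hm hp hα, h2]
  exact omegaQ_add_Ebar_le hm hp hα

end
end

section
/- If q₁ < q₂ are prime powers satisfying φ(q₁) = φ(q₂), then q₁ is a prime. Consequently, there do not exist three pairwise distinct prime powers with equal totient values, and any two distinct prime powers with equal totient values are relatively prime. -/
open MeasureTheory ProbabilityTheory Filter

noncomputable section

/-- If two powers of primes `p < r` have equal totient, the power of the larger prime `r` is `r`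
itself. -/
theorem exponent_eq_zero_of_totient_eq {p r a b : ℕ} (hp : p.Prime) (hr : r.Prime) (hpr : p < r)
    (h : p ^ a * (p - 1) = r ^ b * (r - 1)) : b = 0 := by
  by_contra hb
  have hdvd : r ∣ p ^ a * (p - 1) := h ▸ (dvd_pow_self r hb).mul_right _
  have hp2 := hp.two_le
  rcases hr.dvd_mul.1 hdvd with h1 | h1
  · have := Nat.le_of_dvd hp.pos (hr.dvd_of_dvd_pow h1)
    omega
  · have := Nat.le_of_dvd (by omega) h1
    omega

/-- The smaller of two distinct prime powers with equal totient is prime. -/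
theorem prime_of_lt_of_totient_eq {q₁ q₂ : ℕ} (h₁ : IsPrimePow q₁) (h₂ : IsPrimePow q₂)
    (hlt : q₁ < q₂) (h : q₁.totient = q₂.totient) : q₁.Prime := by
  obtain ⟨p, a, hp, ha, rfl⟩ := (isPrimePow_nat_iff _).1 h₁
  obtain ⟨r, b, hr, hb, rfl⟩ := (isPrimePow_nat_iff _).1 h₂
  obtain ⟨a, rfl⟩ := Nat.exists_eq_succ_of_ne_zero ha.ne'
  obtain ⟨b, rfl⟩ := Nat.exists_eq_succ_of_ne_zero hb.ne'
  simp only [Nat.succ_eq_add_one] at *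
  rw [Nat.totient_prime_pow_succ hp, Nat.totient_prime_pow_succ hr] at h
  have hp2 := hp.two_le
  rcases lt_trichotomy p r with hpr | rfl | hpr
  · obtain rfl := exponent_eq_zero_of_totient_eq hp hr hpr h
    obtain ⟨k, rfl⟩ : ∃ k, p = k + 1 := ⟨p - 1, by omega⟩
    have hpos : 0 < (k + 1) ^ a := by positivity
    simp only [pow_succ, Nat.add_sub_cancel, pow_zero, one_mul, mul_add, mul_one] at h hlt
    omega
  · have hpow := Nat.eq_of_mul_eq_mul_right (by omega) h
    rw [pow_succ, pow_succ, hpow] at hlt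
    exact absurd hlt (lt_irrefl _)
  · obtain rfl := exponent_eq_zero_of_totient_eq hr hp hpr h.symm
    simpa using hp

/-- No three distinct prime powers, listed in increasing order, have equal totient. -/
theorem not_totient_eq_of_lt_of_lt {q₁ q₂ q₃ : ℕ} (h₁ : IsPrimePow q₁) (h₂ : IsPrimePow q₂)
    (h₃ : IsPrimePow q₃) (h₁₂ : q₁ < q₂) (h₂₃ : q₂ < q₃) (e₁₂ : q₁.totient = q₂.totient)
    (e₂₃ : q₂.totient = q₃.totient) : False := by
  have hp₁ := prime_of_lt_of_totient_eq h₁ h₂ h₁₂ e₁₂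
  have hp₂ := prime_of_lt_of_totient_eq h₂ h₃ h₂₃ e₂₃
  rw [Nat.totient_prime hp₁, Nat.totient_prime hp₂] at e₁₂
  have := hp₁.pos
  omega

/-- Distinct prime powers with equal totient are coprime. -/
theorem coprime_of_lt_of_totient_eq {q₁ q₂ : ℕ} (h₁ : IsPrimePow q₁) (h₂ : IsPrimePow q₂)
    (hlt : q₁ < q₂) (h : q₁.totient = q₂.totient) : Nat.Coprime q₁ q₂ := by
  have hp := prime_of_lt_of_totient_eq h₁ h₂ hlt h
  refine (Nat.Prime.coprime_iff_not_dvd hp).2 fun hdvd => ?_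
  obtain ⟨r, b, hr, hb, rfl⟩ := (isPrimePow_nat_iff _).1 h₂
  obtain rfl := (Nat.prime_dvd_prime_iff_eq hp hr).1 (hp.dvd_of_dvd_pow hdvd)
  have hp2 := hp.two_le
  rw [Nat.totient_prime hp, Nat.totient_prime_pow hp hb] at h
  have hpow : q₁ ^ (b - 1) = 1 := Nat.eq_of_mul_eq_mul_right (by omega : 0 < q₁ - 1) (by omega)
  rw [← Nat.sub_add_cancel hb, pow_succ, hpow, one_mul] at hlt
  exact lt_irrefl _ hlt

theorem statement18 :
    (∀ q₁ q₂ : ℕ, IsPrimePow q₁ → IsPrimePow q₂ → q₁ < q₂ →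
      q₁.totient = q₂.totient → q₁.Prime) ∧
    (¬ ∃ r₁ r₂ r₃ : ℕ, IsPrimePow r₁ ∧ IsPrimePow r₂ ∧ IsPrimePow r₃ ∧
      r₁ ≠ r₂ ∧ r₁ ≠ r₃ ∧ r₂ ≠ r₃ ∧
      r₁.totient = r₂.totient ∧ r₂.totient = r₃.totient) ∧
    (∀ q₁ q₂ : ℕ, IsPrimePow q₁ → IsPrimePow q₂ → q₁ ≠ q₂ →
      q₁.totient = q₂.totient → Nat.Coprime q₁ q₂) := by
  refine ⟨fun q₁ q₂ h₁ h₂ => prime_of_lt_of_totient_eq h₁ h₂, ?_, ?_⟩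
  · rintro ⟨r₁, r₂, r₃, h₁, h₂, h₃, n₁₂, n₁₃, n₂₃, e₁₂, e₂₃⟩
    have e₁₃ := e₁₂.trans e₂₃
    rcases n₁₂.lt_or_gt with l₁₂ | l₁₂ <;> rcases n₂₃.lt_or_gt with l₂₃ | l₂₃
    · exact not_totient_eq_of_lt_of_lt h₁ h₂ h₃ l₁₂ l₂₃ e₁₂ e₂₃
    · rcases n₁₃.lt_or_gt with l₁₃ | l₁₃
      · exact not_totient_eq_of_lt_of_lt h₁ h₃ h₂ l₁₃ l₂₃ e₁₃ e₂₃.symm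
      · exact not_totient_eq_of_lt_of_lt h₃ h₁ h₂ l₁₃ l₁₂ e₁₃.symm e₁₂
    · rcases n₁₃.lt_or_gt with l₁₃ | l₁₃
      · exact not_totient_eq_of_lt_of_lt h₂ h₁ h₃ l₁₂ l₁₃ e₁₂.symm e₁₃
      · exact not_totient_eq_of_lt_of_lt h₂ h₃ h₁ l₂₃ l₁₃ e₂₃ e₁₃.symm
    · exact not_totient_eq_of_lt_of_lt h₃ h₂ h₁ l₂₃ l₁₂ e₂₃.symm e₁₂.symm
  · intro q₁ q₂ h₁ h₂ hne h
    rcases hne.lt_or_gt with hlt | hlt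
    · exact coprime_of_lt_of_totient_eq h₁ h₂ hlt h
    · exact (coprime_of_lt_of_totient_eq h₂ h₁ hlt h.symm).symm

end
end
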